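/- arXiv:math/0512273 — 6 statements merged into one kernel-verified Lean document; each statement's English description precedes it below -/
import Mathlib

section
/- Every automorphism Φ of the monoid End A of K-algebra endomorphisms of the free associative algebra A lies in the subgroup of Aut End A generated by the semi-inner automorphisms and the mirror automorphisms; equivalently, every Φ ∈ Aut End A is a semi-inner automorphism, a mirror automorphism, or a composition of a semi-inner and a mirror automorphism. -/
/-!
Statement 0: Every automorphism `Φ` of the monoid `End A` of `K`-algebra endomorphisms
of the free associative algebra `A = K⟨x₁,…,xₙ⟩` (`n ≥ 2`) lies in the subgroup of
`Aut End A` generated by the semi-inner automorphisms and the mirror automorphisms.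
-/

namespace Stmt0

variable (K : Type*) [Field K] (n : ℕ)

/-- `s` is an adjoint bijection for `Φ`, i.e. `Φ ν = s ∘ ν ∘ s⁻¹` as set maps,
witnessing that `Φ` is quasi-inner. -/
def IsAdjoint (Φ : MulAut (FreeAlgebra K (Fin n) →ₐ[K] FreeAlgebra K (Fin n)))
    (s : FreeAlgebra K (Fin n) ≃ FreeAlgebra K (Fin n)) : Prop :=
  ∀ (ν : FreeAlgebra K (Fin n) →ₐ[K] FreeAlgebra K (Fin n)) (a : FreeAlgebra K (Fin n)),
    Φ ν a = s (ν (s.symm a))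

/-- `Φ` is a semi-inner automorphism of `End A`: it is quasi-inner with an adjoint
bijection `s` which is additive, multiplicative and semilinear over some field
automorphism `φ` of `K`. -/
def IsSemiInner (Φ : MulAut (FreeAlgebra K (Fin n) →ₐ[K] FreeAlgebra K (Fin n))) : Prop :=
  ∃ s : FreeAlgebra K (Fin n) ≃ FreeAlgebra K (Fin n), IsAdjoint K n Φ s ∧
    (∀ a b : FreeAlgebra K (Fin n), s (a + b) = s a + s b) ∧
    (∀ a b : FreeAlgebra K (Fin n), s (a * b) = s a * s b) ∧
    ∃ φ : K ≃+* K, ∀ (α : K) (a : FreeAlgebra K (Fin n)), s (α • a) = φ α • s a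

/-- `Φ` is a mirror automorphism of `End A`: it is quasi-inner with an adjoint
bijection `s` which is an anti-automorphism of `A` (an additive bijection
reversing products). -/
def IsMirror (Φ : MulAut (FreeAlgebra K (Fin n) →ₐ[K] FreeAlgebra K (Fin n))) : Prop :=
  ∃ s : FreeAlgebra K (Fin n) ≃ FreeAlgebra K (Fin n), IsAdjoint K n Φ s ∧
    (∀ a b : FreeAlgebra K (Fin n), s (a + b) = s a + s b) ∧
    (∀ a b : FreeAlgebra K (Fin n), s (a * b) = s b * s a)

end Stmt0

namespace FreeAlgebra

variable {K : Type*} [Field K] {X : Type*}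

open Polynomial

section Degree

@[simp]
theorem algebraMapInv_ι (i : X) : algebraMapInv (ι K i) = (0 : K) := by
  simp [algebraMapInv]

/-- The homomorphism into polynomials over the free algebra recording the word length as the
power of the polynomial variable. -/
noncomputable def degreeHom : FreeAlgebra K X →ₐ[K] (FreeAlgebra K X)[X] :=
  lift K fun i => C (ι K i) * Polynomial.X

@[simp]
theorem degreeHom_ι (i : X) :
    degreeHom (ι K i) = C (ι K i) * (Polynomial.X : (FreeAlgebra K X)[X]) := by
  simp [degreeHom]

theorem eval_one_degreeHom (a : FreeAlgebra K X) : (degreeHom a).eval 1 = a := by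
  have h : ∀ a : FreeAlgebra K X, (eval₂RingHom' (RingHom.id (FreeAlgebra K X)) 1
      fun b => Commute.one_right b) (degreeHom a) = a := by
    intro a
    induction a using FreeAlgebra.induction with
    | grade0 r => simp [Polynomial.algebraMap_apply, eval₂RingHom']
    | grade1 i => simp [eval₂RingHom']
    | mul a b ha hb => rw [map_mul, map_mul, ha, hb]
    | add a b ha hb => rw [map_add, map_add, ha, hb]
  exact h a

theorem degreeHom_injective :
    Function.Injective (degreeHom : FreeAlgebra K X →ₐ[K] (FreeAlgebra K X)[X]) := fun a b h => by
  rw [← eval_one_degreeHom a, h, eval_one_degreeHom]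

theorem coeff_zero_degreeHom (a : FreeAlgebra K X) :
    (degreeHom a).coeff 0 = algebraMap K _ (algebraMapInv a) := by
  induction a using FreeAlgebra.induction with
  | grade0 r => simp [Polynomial.algebraMap_apply]
  | grade1 i => simp [algebraMapInv]
  | mul a b ha hb => rw [map_mul, mul_coeff_zero, ha, hb, map_mul, map_mul]
  | add a b ha hb => rw [map_add, coeff_add, ha, hb, map_add, map_add]

theorem eq_algebraMap_of_natDegree_eq_zero {a : FreeAlgebra K X}
    (h : (degreeHom a).natDegree = 0) : a = algebraMap K _ (algebraMapInv a) := by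
  have := eval_one_degreeHom a
  rw [eq_C_of_natDegree_eq_zero h, eval_C, coeff_zero_degreeHom] at this
  exact this.symm

theorem natDegree_degreeHom_mul {a b : FreeAlgebra K X} (ha : a ≠ 0) (hb : b ≠ 0) :
    (degreeHom (a * b)).natDegree = (degreeHom a).natDegree + (degreeHom b).natDegree := by
  rw [map_mul, natDegree_mul]
  · exact fun h => ha (degreeHom_injective (by rw [h, map_zero]))
  · exact fun h => hb (degreeHom_injective (by rw [h, map_zero]))

theorem exists_eq_algebraMap_of_mul_eq_one {a b : FreeAlgebra K X} (h : a * b = 1) :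
    ∃ c : K, a = algebraMap K _ c := by
  have ha : a ≠ 0 := by rintro rfl; simp at h
  have hb : b ≠ 0 := by rintro rfl; simp at h
  have := natDegree_degreeHom_mul ha hb
  rw [h, map_one, natDegree_one] at this
  exact ⟨_, eq_algebraMap_of_natDegree_eq_zero (by omega)⟩

end Degree

section Fox

variable [DecidableEq X]

/-- The algebra homomorphism into upper triangular matrices whose corner entry is the left Fox
derivative with respect to `i`. -/
noncomputable def foxHom (i : X) :
    FreeAlgebra K X →ₐ[K] Matrix (Fin 2) (Fin 2) (FreeAlgebra K X) :=
  lift K fun j => !![0, if j = i then 1 else 0; 0, ι K j]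

theorem foxHom_diag (i : X) (a : FreeAlgebra K X) :
    foxHom i a 0 0 = algebraMap K _ (algebraMapInv a) ∧ foxHom i a 1 0 = 0 ∧
      foxHom i a 1 1 = a := by
  induction a using FreeAlgebra.induction with
  | grade0 r => simp [Matrix.algebraMap_matrix_apply]
  | grade1 i => simp [foxHom, algebraMapInv]
  | mul a b ha hb => simp [Matrix.mul_apply, ha, hb]
  | add a b ha hb => simp [ha, hb]

/-- The left Fox derivative: `fox i a` collects the words of `a` starting with the letter `i`,
with that letter removed. -/
noncomputable def fox (i : X) : FreeAlgebra K X →ₗ[K] FreeAlgebra K X where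
  toFun a := foxHom i a 0 1
  map_add' a b := by simp
  map_smul' c a := by simp

theorem fox_mul (i : X) (a b : FreeAlgebra K X) :
    fox i (a * b) = fox i a * b + algebraMapInv a • fox i b := by
  obtain ⟨h, -⟩ := foxHom_diag i a
  obtain ⟨-, -, h'⟩ := foxHom_diag i b
  simp [fox, Matrix.mul_apply, h, h', Algebra.smul_def, add_comm]

@[simp]
theorem fox_algebraMap (i : X) (r : K) : fox i (algebraMap K (FreeAlgebra K X) r) = 0 := by
  simp [fox, Matrix.algebraMap_matrix_apply]

theorem fox_ι (i j : X) : fox i (ι K j) = if j = i then 1 else 0 := by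
  simp [fox, foxHom]

theorem fox_ι_mul (i j : X) (b : FreeAlgebra K X) :
    fox i (ι K j * b) = if j = i then b else 0 := by
  rw [fox_mul, fox_ι]; split_ifs <;> simp

@[simp]
theorem fox_ι_mul_self (i : X) (b : FreeAlgebra K X) : fox i (ι K i * b) = b := by
  rw [fox_ι_mul, if_pos rfl]

theorem fox_ι_mul_of_ne {i j : X} (h : j ≠ i) (b : FreeAlgebra K X) : fox i (ι K j * b) = 0 := by
  rw [fox_ι_mul, if_neg h]

theorem fox_sum [Fintype X] (a : FreeAlgebra K X) :
    a = algebraMap K _ (algebraMapInv a) + ∑ i, ι K i * fox i a := by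
  induction a using FreeAlgebra.induction with
  | grade0 r => simp
  | grade1 i => simp [fox_ι]
  | mul a b ha hb =>
    have h : ∑ i, ι K i * fox i (a * b) = (∑ i, ι K i * fox i a) * b +
        algebraMapInv a • ∑ i, ι K i * fox i b := by
      simp only [fox_mul, mul_add, Finset.sum_add_distrib, Finset.sum_mul, Finset.smul_sum,
        mul_assoc, mul_smul_comm]
    rw [h, map_mul, map_mul]
    calc a * b = algebraMapInv a • b + (∑ i, ι K i * fox i a) * b := by
          rw [Algebra.smul_def, ← add_mul, ← ha]
      _ = algebraMapInv a • (algebraMap K _ (algebraMapInv b) + ∑ i, ι K i * fox i b) +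
          (∑ i, ι K i * fox i a) * b := by rw [← hb]
      _ = _ := by rw [smul_add, Algebra.smul_def, add_assoc, add_comm (_ * b)]
  | add a b ha hb =>
    conv_lhs => rw [ha, hb]
    simp only [map_add, mul_add, Finset.sum_add_distrib]
    abel

theorem coeff_succ_degreeHom [Fintype X] (a : FreeAlgebra K X) (m : ℕ) :
    (degreeHom a).coeff (m + 1) = ∑ i, ι K i * (degreeHom (fox i a)).coeff m := by
  conv_lhs => rw [fox_sum a]
  rw [map_add, map_sum, coeff_add, finsetSum_coeff, AlgHom.commutes, Polynomial.algebraMap_apply,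
    coeff_C_succ, zero_add]
  refine Finset.sum_congr rfl fun i _ => ?_
  rw [map_mul, degreeHom_ι, mul_assoc, coeff_C_mul, X_mul, coeff_mul_X]

theorem fox_coeff_succ_degreeHom [Fintype X] (i : X) (a : FreeAlgebra K X) (m : ℕ) :
    fox i ((degreeHom a).coeff (m + 1)) = (degreeHom (fox i a)).coeff m := by
  simp [coeff_succ_degreeHom, fox_ι_mul]

theorem natDegree_degreeHom_fox_le [Fintype X] (i : X) {a : FreeAlgebra K X} {m : ℕ}
    (h : (degreeHom a).natDegree ≤ m + 1) : (degreeHom (fox i a)).natDegree ≤ m := by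
  rw [natDegree_le_iff_coeff_eq_zero] at h ⊢
  intro N hN
  rw [← fox_coeff_succ_degreeHom, h _ (by omega), map_zero]

theorem exists_smul_of_coeff_mul_eq [Fintype X] (m : ℕ) {a b f g : FreeAlgebra K X}
    (ha : (degreeHom a).coeff m ≠ 0)
    (h : (degreeHom a).coeff m * g = (degreeHom b).coeff m * f) : ∃ c : K, g = c • f := by
  induction m generalizing a b with
  | zero =>
    rw [coeff_zero_degreeHom] at ha
    rw [coeff_zero_degreeHom, coeff_zero_degreeHom, ← Algebra.smul_def, ← Algebra.smul_def] at h
    have ha' : algebraMapInv a ≠ 0 := fun h => ha (by rw [h, map_zero])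
    exact ⟨(algebraMapInv a)⁻¹ * algebraMapInv b, by
      rw [mul_smul, ← h, smul_smul, inv_mul_cancel₀ ha', one_smul]⟩
  | succ m ih =>
    obtain ⟨i, hi⟩ : ∃ i, (degreeHom (fox i a)).coeff m ≠ 0 := by
      by_contra! hi
      exact ha (by simp [coeff_succ_degreeHom, hi])
    refine ih (b := fox i b) hi ?_
    have := congrArg (fox i) h
    simpa [coeff_succ_degreeHom, Finset.sum_mul, mul_assoc, fox_ι_mul] using this

end Fox

/-- The subalgebra generated by `1`, `01` and `001` is free on these words. -/
theorem lift_prefix_code_injective {n : ℕ} {i j : Fin n} (hij : i ≠ j) :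
    Function.Injective (lift K (![ι K j, ι K i * ι K j, ι K i * (ι K i * ι K j)] :
      Fin 3 → FreeAlgebra K (Fin n))) := by
  set φ := lift K (![ι K j, ι K i * ι K j, ι K i * (ι K i * ι K j)] :
      Fin 3 → FreeAlgebra K (Fin n)) with hφ
  have hε (a) : algebraMapInv (φ a) = algebraMapInv a := by
    have : algebraMapInv.comp φ = algebraMapInv := by
      ext k; fin_cases k <;> simp [hφ]
    exact DFunLike.congr_fun this a
  rw [injective_iff_map_eq_zero]
  suffices ∀ m : ℕ, ∀ a, (degreeHom a).natDegree ≤ m → φ a = 0 → a = 0 from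
    fun a => this _ a le_rfl
  intro m
  induction m with
  | zero =>
    intro a ha h
    rw [eq_algebraMap_of_natDegree_eq_zero (Nat.le_zero.1 ha), ← hε, h, map_zero, map_zero]
  | succ m ih =>
    intro a ha h
    have hs := h
    rw [fox_sum a, ← hε, h] at hs
    simp only [map_zero, zero_add, Fin.sum_univ_three, map_add, map_mul] at hs
    simp only [hφ, lift_ι_apply] at hs
    simp only [← hφ, Matrix.cons_val, mul_assoc] at hs
    have h0 := congrArg (fox j) hs
    have h1 := congrArg (fun t => fox j (fox i t)) hs
    have h2 := congrArg (fun t => fox j (fox i (fox i t))) hs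
    simp [fox_ι_mul, hij, hij.symm] at h0 h1 h2
    have key (k : Fin 3) : fox k a = 0 :=
      ih _ (natDegree_degreeHom_fox_le k ha) (by fin_cases k <;> simpa)
    rw [fox_sum a, ← hε, h]
    simp [key]

end FreeAlgebra

/-- An irreducible element of a retract of a unique factorization domain is prime. -/
theorem Irreducible.prime_of_retract {R P : Type*} [CommRing R] [CommRing P] [IsDomain P]
    [UniqueFactorizationMonoid P] (i : R →+* P) (q : P →+* R) (h : ∀ r, q (i r) = r) {r : R}
    (hr : Irreducible r) : Prime r := by
  have key : ∀ x : P, Irreducible (q x) → ∃ p, Prime p ∧ p ∣ x ∧ Associated (q p) (q x) := by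
    intro x
    induction x using UniqueFactorizationMonoid.induction_on_prime with
    | h₁ => intro hx; rw [map_zero] at hx; exact absurd rfl hx.ne_zero
    | h₂ x hu => intro hx; exact absurd (hu.map q) hx.not_isUnit
    | h₃ a p ha hp ih =>
      intro hx
      rw [map_mul] at hx
      rcases hx.isUnit_or_isUnit rfl with hu | hu
      · have hass : Associated (q a) (q p * q a) := associated_unit_mul_right _ _ hu
        obtain ⟨p', hp', hd, h'⟩ := ih (hass.symm.irreducible hx)
        exact ⟨p', hp', hd.mul_left p, h'.trans (by rwa [map_mul])⟩
      · exact ⟨p, hp, dvd_mul_right _ _, by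
          rw [map_mul]; exact associated_mul_unit_right _ _ hu⟩
  obtain ⟨p, hp, hd, hass⟩ := key (i r) (by rwa [h])
  rw [h] at hass
  refine ⟨hr.ne_zero, hr.not_isUnit, fun a b hab => ?_⟩
  have := hd.trans (map_dvd i hab)
  rw [map_mul] at this
  refine (hp.dvd_or_dvd this).imp (fun h' => ?_) fun h' => ?_ <;>
  · have := map_dvd q h'
    rw [h] at this
    exact hass.symm.dvd.trans this

namespace FreeAlgebra

variable {K : Type*} [Field K] {X : Type*}

/-- The augmentation ideal, as a subspace. -/
noncomputable def augmentation : Submodule K (FreeAlgebra K X) :=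
  LinearMap.ker (algebraMapInv : FreeAlgebra K X →ₐ[K] K).toLinearMap

@[simp]
theorem mem_augmentation {a : FreeAlgebra K X} : a ∈ augmentation ↔ algebraMapInv a = (0 : K) :=
  Iff.rfl

theorem X_pow_dvd_degreeHom_of_mem {a : FreeAlgebra K X} {k : ℕ} (h : a ∈ augmentation ^ k) :
    Polynomial.X ^ k ∣ degreeHom a := by
  induction k generalizing a with
  | zero => simp
  | succ k ih =>
    rw [pow_succ] at h
    induction h using Submodule.mul_induction_on' with
    | mem_mul_mem b hb c hc =>
      obtain ⟨p, hp⟩ := ih hb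
      have : Polynomial.X ∣ degreeHom c := by
        rw [Polynomial.X_dvd_iff, coeff_zero_degreeHom, mem_augmentation.1 hc, map_zero]
      obtain ⟨q, hq⟩ := this
      exact ⟨p * q, by rw [map_mul, hp, hq, pow_succ, mul_assoc, mul_assoc, ← mul_assoc p,
        ← Polynomial.X_mul, mul_assoc]⟩
    | add b _ c _ hb hc => rw [map_add]; exact dvd_add hb hc

theorem eq_zero_of_X_pow_dvd_degreeHom {a : FreeAlgebra K X} {f : ℕ → ℕ} (hf : ∀ k, k ≤ f k)
    (h : ∀ k, Polynomial.X ^ f k ∣ degreeHom a) : a = 0 := by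
  apply degreeHom_injective
  ext k
  have := Polynomial.X_pow_dvd_iff.1 (h (k + 1)) k (hf (k + 1))
  simpa using this

theorem augmentation_le [Fintype X] [DecidableEq X] :
    (augmentation : Submodule K (FreeAlgebra K X)) ≤
      Submodule.span K (Set.range (ι K)) ⊔ augmentation ^ 2 := by
  intro a ha
  rw [fox_sum a, mem_augmentation.1 ha, map_zero, zero_add]
  refine Submodule.sum_mem _ fun i _ => ?_
  have : ι K i * fox i a = algebraMapInv (fox i a) • ι K i +
      ι K i * (fox i a - algebraMap K _ (algebraMapInv (fox i a))) := by
    rw [mul_sub, Algebra.smul_def, Algebra.commutes]; abel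
  rw [this]
  refine Submodule.add_mem_sup (Submodule.smul_mem _ _ (Submodule.subset_span ⟨i, rfl⟩)) ?_
  rw [pow_two]
  refine Submodule.mul_mem_mul (by simp) ?_
  rw [mem_augmentation, map_sub]
  simp

/-- The endomorphism sending every generator to `0`. -/
noncomputable def zeroEnd : FreeAlgebra K X →ₐ[K] FreeAlgebra K X :=
  (Algebra.ofId K _).comp algebraMapInv

theorem zeroEnd_apply (a : FreeAlgebra K X) :
    zeroEnd a = algebraMap K (FreeAlgebra K X) (algebraMapInv a) := rfl

variable {E : FreeAlgebra K X →ₐ[K] FreeAlgebra K X}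

theorem map_augmentation_le (hε : ∀ a, algebraMapInv (E a) = algebraMapInv a) :
    augmentation.map E.toLinearMap ≤ augmentation := by
  rintro _ ⟨a, ha, rfl⟩
  exact (hε a).trans ha

theorem exists_map_notMem_of_ne_zeroEnd
    (hE : ∀ a, E (E a) = E a) (h0 : E ≠ zeroEnd) :
    ∃ y ∈ augmentation, E y ∉ (augmentation ^ 2 : Submodule K (FreeAlgebra K X)) := by
  by_contra! h
  have hle : augmentation.map E.toLinearMap ≤ augmentation ^ 2 := by
    rintro _ ⟨a, ha, rfl⟩
    exact h a ha
  have hidem : (augmentation.map E.toLinearMap).map E.toLinearMap =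
      augmentation.map E.toLinearMap := by
    rw [← Submodule.map_comp]
    congr 1
    ext a
    exact hE a
  have key (k : ℕ) : augmentation.map E.toLinearMap ≤ augmentation ^ 2 ^ k := by
    induction k with
    | zero =>
      rw [pow_zero, pow_one]
      refine hle.trans ?_
      rw [pow_two, Submodule.mul_le]
      intro a ha b hb
      simp [mem_augmentation.1 ha]
    | succ k ih =>
      rw [← hidem]
      refine (Submodule.map_mono ih).trans ?_
      rw [Submodule.map_pow, pow_succ' 2 k, pow_mul]
      exact pow_le_pow_left' hle _
  apply h0
  refine AlgHom.ext fun a => ?_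
  have hm : a - algebraMap K _ (algebraMapInv a) ∈ (augmentation : Submodule K _) := by
    rw [mem_augmentation, map_sub]; simp
  have : E (a - algebraMap K _ (algebraMapInv a)) = 0 :=
    eq_zero_of_X_pow_dvd_degreeHom (f := fun k => 2 ^ k) (fun k => Nat.lt_two_pow_self.le)
      fun k => X_pow_dvd_degreeHom_of_mem (key k ⟨_, hm, rfl⟩)
  rwa [map_sub, sub_eq_zero, AlgHom.commutes] at this

theorem exists_map_augmentation_le [Fintype X] [DecidableEq X]
    {E : X → X → (FreeAlgebra K X →ₐ[K] FreeAlgebra K X)}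
    (hε : ∀ i j a, algebraMapInv (E i j a) = algebraMapInv a)
    (hE : ∀ i j k a, E i j (E j k a) = E i k a)
    (hE' : ∀ i j k l a, j ≠ k → E i j (E k l a) = zeroEnd a) (i : X) (h0 : E i i ≠ zeroEnd) :
    ∃ z, E i i z = z ∧ z ≠ 0 ∧ z ∈ augmentation ∧
      augmentation.map (E i i).toLinearMap ≤ K ∙ z ⊔ augmentation ^ 2 := by
  obtain ⟨y, hy, hy'⟩ := exists_map_notMem_of_ne_zeroEnd (hE i i i) h0
  have hE2 (j k) {a} (ha : a ∈ augmentation ^ 2) :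
      E j k a ∈ (augmentation ^ 2 : Submodule K _) := by
    have := Submodule.mem_map_of_mem (f := (E j k).toLinearMap) ha
    rw [Submodule.map_pow] at this
    exact pow_le_pow_left' (map_augmentation_le (hε j k)) 2 this
  have hzero : zeroEnd y = 0 := by rw [zeroEnd_apply, mem_augmentation.1 hy, map_zero]
  have hcomb (c : X → K) (j : X) : E i j (∑ k, c k • E k i y) = c j • E i i y := by
    rw [map_sum, Finset.sum_eq_single j]
    · rw [map_smul, hE]
    · intro k _ hk
      rw [map_smul, hE' _ _ _ _ _ hk.symm, hzero, smul_zero]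
    · simp
  let q := (augmentation ^ 2 : Submodule K (FreeAlgebra K X)).mkQ
  let v : X → (FreeAlgebra K X ⧸ (augmentation ^ 2 : Submodule K (FreeAlgebra K X))) :=
    fun k => q (E k i y)
  have hq (c : X → K) : ∑ k, c k • v k = q (∑ k, c k • E k i y) := by simp [v]
  have hv : LinearIndependent K v := by
    rw [Fintype.linearIndependent_iff]
    intro c hc j
    rw [hq] at hc
    have h1 : ∑ k, c k • E k i y ∈ (augmentation ^ 2 : Submodule K _) := by
      exact (Submodule.Quotient.mk_eq_zero _).1 hc
    have h2 := hE2 i j h1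
    rw [hcomb] at h2
    by_contra hne
    exact hy' ((Submodule.smul_mem_iff _ hne).1 h2)
  let S := Submodule.span K (Set.range fun k => q (ι K k))
  have hS : Submodule.span K (Set.range v) = S := by
    have : FiniteDimensional K S := FiniteDimensional.span_of_finite K (Set.finite_range _)
    refine Submodule.eq_of_le_of_finrank_le ?_ ?_
    · rw [Submodule.span_le]
      rintro _ ⟨k, rfl⟩
      have hk : E k i y ∈ augmentation := (hε k i y).trans hy
      obtain ⟨a, ha, b, hb, hab⟩ := Submodule.mem_sup.1 (augmentation_le hk)
      have : v k = q a := by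
        have hb' : q b = 0 := (Submodule.Quotient.mk_eq_zero _).2 hb
        simp only [v]
        rw [← hab, map_add, hb', add_zero]
      rw [this]
      have := Submodule.mem_map_of_mem (f := q) ha
      rw [Submodule.map_span, ← Set.range_comp] at this
      exact this
    · rw [finrank_span_eq_card hv]
      exact finrank_range_le_card _
  refine ⟨E i i y, hE i i i y, fun h => hy' (by rw [h]; exact zero_mem _), (hε i i y).trans hy, ?_⟩
  refine (Submodule.map_mono augmentation_le).trans ?_
  rw [Submodule.map_sup, Submodule.map_pow, Submodule.map_span, ← Set.range_comp]
  refine sup_le (Submodule.span_le.2 ?_) ((pow_le_pow_left'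
    (map_augmentation_le (hε i i)) 2).trans le_sup_right)
  rintro _ ⟨j, rfl⟩
  have hj : q (ι K j) ∈ Submodule.span K (Set.range v) := hS ▸ Submodule.subset_span ⟨j, rfl⟩
  obtain ⟨c, hc⟩ := (Submodule.mem_span_range_iff_exists_fun K).1 hj
  rw [hq, eq_comm, ← sub_eq_zero, ← map_sub] at hc
  have h1 : ι K j - ∑ k, c k • E k i y ∈ (augmentation ^ 2 : Submodule K _) := by
    exact (Submodule.Quotient.mk_eq_zero _).1 hc
  have h2 := hE2 i i h1
  rw [map_sub, hcomb] at h2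
  have : E i i (ι K j) = c i • E i i y + (E i i (ι K j) - c i • E i i y) := by abel
  simp only [Function.comp, AlgHom.toLinearMap_apply, SetLike.mem_coe]
  rw [this]
  exact Submodule.add_mem_sup (Submodule.smul_mem _ _ (Submodule.mem_span_singleton_self _)) h2

theorem commute_of_map_augmentation_le (hE : ∀ a, E (E a) = E a)
    (hε : ∀ a, algebraMapInv (E a) = algebraMapInv a)
    {z : FreeAlgebra K X} (hz : E z = z) (hz' : z ∈ augmentation)
    (h : augmentation.map E.toLinearMap ≤ K ∙ z ⊔ augmentation ^ 2) (a b : FreeAlgebra K X) :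
    E a * E b = E b * E a := by
  have hpow (k : ℕ) :
      (augmentation ^ k).map E.toLinearMap ≤ K ∙ (z ^ k) ⊔ augmentation ^ (k + 1) := by
    rw [Submodule.map_pow]
    induction k with
    | zero =>
      rw [pow_zero, pow_zero, Submodule.one_eq_span]
      exact le_sup_left
    | succ k ih =>
      rw [pow_succ]
      refine (mul_le_mul' ih h).trans ?_
      have hzk : K ∙ (z ^ k) ≤ augmentation ^ k :=
        (Submodule.span_singleton_le_iff_mem _ _).2 (Submodule.pow_mem_pow _ hz' k)
      have hz1 : K ∙ z ≤ augmentation ^ 1 := by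
        rw [pow_one]; exact (Submodule.span_singleton_le_iff_mem _ _).2 hz'
      rw [Submodule.sup_mul, Submodule.mul_sup, Submodule.mul_sup, Submodule.span_mul_span,
        Set.singleton_mul_singleton, ← pow_succ]
      refine sup_le (sup_le le_sup_left ?_) (sup_le ?_ ?_)
      · refine le_trans ?_ le_sup_right
        exact (mul_le_mul' hzk le_rfl).trans (by rw [← pow_add])
      · refine le_trans ?_ le_sup_right
        exact (mul_le_mul' le_rfl hz1).trans (by rw [← pow_add])
      · refine le_trans ?_ le_sup_right
        rw [← pow_add]
        have : (augmentation * augmentation : Submodule K (FreeAlgebra K X)) ≤ augmentation := by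
          rw [Submodule.mul_le]
          intro a ha b hb
          simp [mem_augmentation.1 ha]
        rw [show k + 1 + 2 = k + 1 + 1 + 1 by ring, pow_succ, pow_succ _ (k + 1), mul_assoc]
        exact mul_le_mul' le_rfl this
  have happrox (k : ℕ) (r : FreeAlgebra K X) (hr : E r = r) (hr' : r ∈ augmentation) :
      ∃ p : Polynomial K, r - Polynomial.aeval z p ∈ augmentation ^ (k + 1) := by
    induction k with
    | zero => exact ⟨0, by simpa using hr'⟩
    | succ k ih =>
      obtain ⟨p, hp⟩ := ih
      have hEp : E (Polynomial.aeval z p) = Polynomial.aeval z p := by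
        rw [← Polynomial.aeval_algHom_apply, hz]
      have hm := hpow (k + 1) (Submodule.mem_map_of_mem (f := E.toLinearMap) hp)
      rw [AlgHom.toLinearMap_apply, map_sub, hEp, hr] at hm
      obtain ⟨c, hc, d, hd, hcd⟩ := Submodule.mem_sup.1 hm
      obtain ⟨l, rfl⟩ := Submodule.mem_span_singleton.1 hc
      refine ⟨p + l • Polynomial.X ^ (k + 1), ?_⟩
      rw [map_add, map_smul, map_pow, Polynomial.aeval_X, ← sub_sub, ← hcd, add_sub_cancel_left]
      exact hd
  have hcomm (r r' : FreeAlgebra K X) (hr : E r = r) (hr' : E r' = r') (hm : r ∈ augmentation)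
      (hm' : r' ∈ augmentation) : r * r' = r' * r := by
    rw [← sub_eq_zero]
    refine eq_zero_of_X_pow_dvd_degreeHom (f := fun k => k + 1) (fun k => Nat.le_succ k)
      fun k => ?_
    obtain ⟨p, hp⟩ := happrox k r hr hm
    obtain ⟨p', hp'⟩ := happrox k r' hr' hm'
    have h1 := X_pow_dvd_degreeHom_of_mem hp
    have h2 := X_pow_dvd_degreeHom_of_mem hp'
    have hl {f : Polynomial (FreeAlgebra K X)} (g) (hf : Polynomial.X ^ (k + 1) ∣ f) :
        Polynomial.X ^ (k + 1) ∣ g * f := by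
      obtain ⟨t, rfl⟩ := hf
      exact ⟨g * t, by rw [← mul_assoc, ← Polynomial.X_pow_mul, mul_assoc]⟩
    have e : r * r' - r' * r = (r - Polynomial.aeval z p) * r' +
        Polynomial.aeval z p * (r' - Polynomial.aeval z p') -
        ((r' - Polynomial.aeval z p') * r +
          Polynomial.aeval z p' * (r - Polynomial.aeval z p)) := by
      have : Polynomial.aeval z p * Polynomial.aeval z p' =
        Polynomial.aeval z p' * Polynomial.aeval z p := by rw [← map_mul, mul_comm, map_mul]
      simp only [sub_mul, mul_sub, this]
      abel
    rw [e, map_sub, map_add, map_add, map_mul, map_mul, map_mul, map_mul]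
    exact dvd_sub (dvd_add (h1.mul_right _) (hl _ h2)) (dvd_add (h2.mul_right _) (hl _ h1))
  have hm (a : FreeAlgebra K X) :
      E (a - algebraMap K _ (algebraMapInv a)) ∈ (augmentation : Submodule K _) := by
    rw [mem_augmentation, hε, map_sub]; simp
  have := hcomm _ _ (hE _) (hE _) (hm a) (hm b)
  have hdec (a : FreeAlgebra K X) : E a = algebraMap K _ (algebraMapInv a) +
      E (a - algebraMap K _ (algebraMapInv a)) := by
    rw [map_sub, AlgHom.commutes, add_sub_cancel]
  rw [hdec a, hdec b]
  exact (Algebra.commute_algebraMap_left _ _).add_left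
    ((Algebra.commute_algebraMap_right _ _).add_right this)

end FreeAlgebra

namespace FreeAlgebra

variable {K : Type*} [Field K] {X : Type*} {E : FreeAlgebra K X →ₐ[K] FreeAlgebra K X}

/-- The elements of degree at most `d` fixed by the endomorphism `E`. -/
noncomputable def fixedDegreeLE (E : FreeAlgebra K X →ₐ[K] FreeAlgebra K X) (d : ℕ) :
    Submodule K (FreeAlgebra K X) where
  carrier := {r | E r = r ∧ (degreeHom r).natDegree ≤ d}
  zero_mem' := by simp
  add_mem' := by
    rintro a b ⟨ha, ha'⟩ ⟨hb, hb'⟩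
    refine ⟨by rw [map_add, ha, hb], ?_⟩
    rw [map_add]
    exact Polynomial.natDegree_add_le_of_degree_le ha' hb'
  smul_mem' := by
    rintro c a ⟨ha, ha'⟩
    refine ⟨by rw [map_smul, ha], ?_⟩
    rw [map_smul]
    exact (Polynomial.natDegree_smul_le _ _).trans ha'

theorem fixedDegreeLE_zero_le : fixedDegreeLE E 0 ≤ K ∙ 1 := by
  rintro r ⟨-, hr⟩
  rw [eq_algebraMap_of_natDegree_eq_zero (Nat.le_zero.1 hr), Algebra.algebraMap_eq_smul_one]
  exact Submodule.smul_mem _ _ (Submodule.mem_span_singleton_self _)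

theorem exists_fixedDegreeLE_succ_le [Fintype X] [DecidableEq X]
    (hcomm : ∀ a b, E a * E b = E b * E a) (d : ℕ) :
    ∃ r, fixedDegreeLE E (d + 1) ≤ fixedDegreeLE E d ⊔ K ∙ r := by
  by_cases h : ∃ r ∈ fixedDegreeLE E (d + 1), (degreeHom r).coeff (d + 1) ≠ 0
  · obtain ⟨r, ⟨hr, hrd⟩, hr0⟩ := h
    refine ⟨r, fun s hs => ?_⟩
    obtain ⟨hs, hsd⟩ := hs
    have hc : (degreeHom r).coeff (d + 1) * (degreeHom s).coeff (d + 1) =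
        (degreeHom s).coeff (d + 1) * (degreeHom r).coeff (d + 1) := by
      rw [← Polynomial.coeff_mul_add_eq_of_natDegree_le hrd hsd,
        ← Polynomial.coeff_mul_add_eq_of_natDegree_le hsd hrd, ← map_mul, ← map_mul, ← hr, ← hs,
        hcomm]
    obtain ⟨c, hc⟩ := exists_smul_of_coeff_mul_eq _ hr0 hc
    rw [← sub_add_cancel s (c • r)]
    refine Submodule.add_mem_sup ⟨by rw [map_sub, map_smul, hr, hs], ?_⟩
      (Submodule.smul_mem _ _ (Submodule.mem_span_singleton_self _))
    have h1 : (degreeHom (s - c • r)).natDegree ≤ d + 1 := by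
      rw [map_sub, map_smul]
      exact (Polynomial.natDegree_sub_le _ _).trans
        (max_le hsd ((Polynomial.natDegree_smul_le c _).trans hrd))
    refine Nat.le_of_lt_succ (lt_of_le_of_ne h1 fun (he : _ = d + 1) => ?_)
    have h2 : (degreeHom (s - c • r)).coeff (d + 1) = 0 := by
      rw [map_sub, map_smul, Polynomial.coeff_sub, Polynomial.coeff_smul, hc, sub_self]
    rw [← he, Polynomial.coeff_natDegree, Polynomial.leadingCoeff_eq_zero] at h2
    rw [h2, Polynomial.natDegree_zero] at he
    omega
  · push Not at h
    refine ⟨0, fun s hs => Submodule.mem_sup_left ⟨hs.1, ?_⟩⟩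
    refine Nat.le_of_lt_succ (lt_of_le_of_ne hs.2 fun (he : _ = d + 1) => ?_)
    have h2 := h s hs
    rw [← he, Polynomial.coeff_natDegree, Polynomial.leadingCoeff_eq_zero] at h2
    rw [h2, Polynomial.natDegree_zero] at he
    omega

theorem finiteDimensional_fixedDegreeLE [Fintype X] [DecidableEq X]
    (hcomm : ∀ a b, E a * E b = E b * E a) (d : ℕ) :
    FiniteDimensional K (fixedDegreeLE E d) := by
  induction d with
  | zero => exact Submodule.finiteDimensional_of_le fixedDegreeLE_zero_le
  | succ d ih =>
    obtain ⟨r, hr⟩ := exists_fixedDegreeLE_succ_le hcomm d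
    exact Submodule.finiteDimensional_of_le hr

theorem finrank_fixedDegreeLE_add_le [Fintype X] [DecidableEq X]
    (hcomm : ∀ a b, E a * E b = E b * E a) (d m : ℕ) :
    Module.finrank K (fixedDegreeLE E (d + m)) ≤ Module.finrank K (fixedDegreeLE E d) + m := by
  induction m with
  | zero => rfl
  | succ m ih =>
    obtain ⟨r, hr⟩ := exists_fixedDegreeLE_succ_le hcomm (d + m)
    have := finiteDimensional_fixedDegreeLE hcomm (d + m)
    have h1 := (Submodule.finrank_mono hr).trans (Submodule.finrank_add_le_finrank_add_finrank _ _)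
    have h2 : Module.finrank K (K ∙ r) ≤ 1 := by
      simpa using finrank_span_le_card (R := K) ({r} : Set (FreeAlgebra K X))
    rw [← add_assoc]
    omega

theorem natDegree_degreeHom_aeval_le (r : FreeAlgebra K X) {f : Polynomial K} {m : ℕ}
    (hf : f.natDegree ≤ m) :
    (degreeHom (Polynomial.aeval r f)).natDegree ≤ m * (degreeHom r).natDegree := by
  rw [Polynomial.aeval_eq_sum_range, map_sum]
  refine Polynomial.natDegree_sum_le_of_forall_le _ _ fun k hk => ?_
  rw [map_smul, map_pow]
  refine (Polynomial.natDegree_smul_le _ _).trans (Polynomial.natDegree_pow_le.trans ?_)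
  exact Nat.mul_le_mul_right _ ((Finset.mem_range_succ_iff.1 hk).trans hf)

theorem exists_aeval_eq_mul [Fintype X] [DecidableEq X]
    (hcomm : ∀ a b, E a * E b = E b * E a) {u r : FreeAlgebra K X}
    (hu : E u = u) (hu0 : u ≠ 0) (hr : E r = r) :
    ∃ f : Polynomial K, f ≠ 0 ∧ ∃ y, E y = y ∧ Polynomial.aeval r f = u * y := by
  set m := (degreeHom u).natDegree with hm
  set d := m * (degreeHom r).natDegree with hd
  have hfin := finiteDimensional_fixedDegreeLE hcomm d
  have hfin' := finiteDimensional_fixedDegreeLE hcomm (d + m)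
  let T : Polynomial.degreeLT K (m + 1) × fixedDegreeLE E d →ₗ[K] FreeAlgebra K X :=
    ((Polynomial.aeval r).toLinearMap ∘ₗ (Polynomial.degreeLT K (m + 1)).subtype).coprod
      (LinearMap.mulLeft K u ∘ₗ (fixedDegreeLE E d).subtype)
  have hT (p) : T p = Polynomial.aeval r (p.1 : Polynomial K) + u * p.2 := rfl
  have hmem (p) : T p ∈ fixedDegreeLE E (d + m) := by
    obtain ⟨⟨f, hf⟩, ⟨y, hy, hyd⟩⟩ := p
    rw [hT]
    refine add_mem ⟨by rw [← Polynomial.aeval_algHom_apply, hr], ?_⟩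
      ⟨(map_mul E _ _).trans (congrArg₂ _ hu hy), ?_⟩
    · refine (natDegree_degreeHom_aeval_le r (m := m) ?_).trans (Nat.le_add_right _ _)
      have := Polynomial.mem_degreeLT.1 hf
      exact Polynomial.natDegree_le_of_degree_le (Order.le_of_lt_succ (by exact_mod_cast this))
    · rw [map_mul]
      refine Polynomial.natDegree_mul_le.trans ?_
      simp only
      omega
  have hlt : Module.finrank K (fixedDegreeLE E (d + m)) <
      Module.finrank K (Polynomial.degreeLT K (m + 1) × fixedDegreeLE E d) := by
    rw [Module.finrank_prod, (Polynomial.degreeLTEquiv K (m + 1)).finrank_eq,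
      Module.finrank_fin_fun]
    have := finrank_fixedDegreeLE_add_le hcomm d m
    omega
  have hfd : FiniteDimensional K (Polynomial.degreeLT K (m + 1)) :=
    (Polynomial.degreeLTEquiv K (m + 1)).symm.finiteDimensional
  obtain ⟨⟨f, y⟩, hp, hp0⟩ := (Submodule.ne_bot_iff _).1
    (LinearMap.ker_ne_bot_of_finrank_lt (f := T.codRestrict _ hmem) hlt)
  have hp' : Polynomial.aeval r (f : Polynomial K) + u * y = 0 := congrArg Subtype.val hp
  refine ⟨f, fun h0 => ?_, -y, ?_, ?_⟩
  · rw [h0, map_zero, zero_add] at hp'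
    apply hp0
    rcases mul_eq_zero.1 hp' with h | h
    · exact absurd h hu0
    · exact Prod.ext (Subtype.ext h0) (Subtype.ext h)
  · rw [map_neg, y.2.1]
  · rw [mul_neg, eq_neg_of_add_eq_zero_left hp']

theorem dvd_or_dvd_of_minimal (hE : ∀ a, E (E a) = E a)
    (hcomm : ∀ a b, E a * E b = E b * E a) {u : FreeAlgebra K X}
    (hu : E u = u) (hu0 : u ≠ 0) (hεu : algebraMapInv u = (0 : K))
    (hmin : ∀ r, E r = r → r ≠ 0 → algebraMapInv r = (0 : K) →
      (degreeHom u).natDegree ≤ (degreeHom r).natDegree)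
    {a b c : FreeAlgebra K X} (ha : E a = a) (hb : E b = b) (hc : E c = c) (h : a * b = u * c) :
    (∃ d, E d = d ∧ a = u * d) ∨ ∃ d, E d = d ∧ b = u * d := by
  have hfix (r : E.range) : E r = r := by
    obtain ⟨_, s, rfl⟩ := r
    exact hE s
  let _ : CommRing E.range :=
    { (inferInstance : Ring E.range) with
      mul_comm := fun x y => Subtype.ext (by
        have := hcomm x y
        rwa [hfix, hfix] at this) }
  let i : E.range →+* MvPolynomial X K :=
    (lift K (MvPolynomial.X : X → MvPolynomial X K)).toRingHom.comp E.range.val.toRingHom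
  let q : MvPolynomial X K →+* E.range :=
    MvPolynomial.eval₂Hom (algebraMap K E.range) fun j => ⟨E (ι K j), _, rfl⟩
  have hq (r : FreeAlgebra K X) :
      ((q (lift K (MvPolynomial.X : X → MvPolynomial X K) r) : E.range) : FreeAlgebra K X) =
        E r := by
    induction r with
    | grade0 k => simp [q]
    | grade1 x => simp [q]
    | mul a b ha hb => rw [map_mul, map_mul, Subalgebra.coe_mul, ha, hb, map_mul]
    | add a b ha hb => rw [map_add, map_add, Subalgebra.coe_add, ha, hb, map_add]
  have hqi (r) : q (i r) = r := Subtype.ext ((hq r).trans (hfix r))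
  have hirr : Irreducible (⟨u, u, hu⟩ : E.range) := by
    have hunit {x y : FreeAlgebra K X} (hx : E x = x) (hy : E y = y) (hxy : u = x * y)
        (hεx : algebraMapInv x = (0 : K)) : IsUnit (⟨y, y, hy⟩ : E.range) := by
      have hx0 : x ≠ 0 := by rintro rfl; exact hu0 (by rw [hxy, zero_mul])
      have hy0 : y ≠ 0 := by rintro rfl; exact hu0 (by rw [hxy, mul_zero])
      have h1 := hmin x hx hx0 hεx
      rw [hxy, natDegree_degreeHom_mul hx0 hy0] at h1
      have h2 := eq_algebraMap_of_natDegree_eq_zero (a := y) (by omega)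
      have h3 : (algebraMapInv y : K) ≠ 0 := by
        intro h
        rw [h, map_zero] at h2
        exact hy0 h2
      have : (⟨y, y, hy⟩ : E.range) = algebraMap K E.range (algebraMapInv y) := Subtype.ext h2
      rw [this]
      exact (IsUnit.mk0 _ h3).map _
    refine ⟨fun h => ?_, ?_⟩
    · obtain ⟨v, hv⟩ := h.exists_right_inv
      have := congrArg (fun z : E.range => (algebraMapInv (z : FreeAlgebra K X) : K)) hv
      simp [hεu] at this
    · rintro ⟨x, hx⟩ ⟨y, hy⟩ hxy
      have hx' := hfix ⟨x, hx⟩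
      have hy' := hfix ⟨y, hy⟩
      have hxy' : u = x * y := congrArg Subtype.val hxy
      have := hεu
      rw [hxy', map_mul, mul_eq_zero] at this
      rcases this with h | h
      · exact Or.inr (hunit hx' hy' hxy' h)
      · refine Or.inl (hunit hy' hx' ?_ h)
        have := hcomm x y
        rw [hx', hy'] at this
        rw [hxy', this]
  have hprime := hirr.prime_of_retract i q hqi
  have hdvd : (⟨u, u, hu⟩ : E.range) ∣ ⟨a, a, ha⟩ * ⟨b, b, hb⟩ :=
    ⟨⟨c, c, hc⟩, Subtype.ext h⟩
  exact (hprime.dvd_or_dvd hdvd).imp (fun ⟨d, hd⟩ => ⟨d, hfix d, congrArg Subtype.val hd⟩)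
    fun ⟨d, hd⟩ => ⟨d, hfix d, congrArg Subtype.val hd⟩

theorem exists_eq_aeval [Fintype X] [DecidableEq X]
    (hE : ∀ a, E (E a) = E a)
    (hcomm : ∀ a b, E a * E b = E b * E a) {z : FreeAlgebra K X}
    (hz : E z = z) (hz0 : z ≠ 0) (hεz : algebraMapInv z = (0 : K)) :
    ∃ u, E u = u ∧ u ≠ 0 ∧ algebraMapInv u = (0 : K) ∧
      ∀ a, ∃ p : Polynomial K, E a = Polynomial.aeval u p := by
  obtain ⟨u, ⟨hu, hu0, hεu⟩, hmin⟩ := WellFounded.has_min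
    (InvImage.wf (fun r : FreeAlgebra K X => (degreeHom r).natDegree) Nat.lt_wfRel.wf)
    {r | E r = r ∧ r ≠ 0 ∧ algebraMapInv r = (0 : K)} ⟨z, hz, hz0, hεz⟩
  have hmin' : ∀ r, E r = r → r ≠ 0 → algebraMapInv r = (0 : K) →
      (degreeHom u).natDegree ≤ (degreeHom r).natDegree :=
    fun r h1 h2 h3 => not_lt.1 (hmin r ⟨h1, h2, h3⟩)
  have hpos : 0 < (degreeHom u).natDegree := by
    refine Nat.pos_of_ne_zero fun h => hu0 ?_
    rw [eq_algebraMap_of_natDegree_eq_zero h, hεu, map_zero]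
  have hdvd_pow {r g c : FreeAlgebra K X} (hr : E r = r) (hg : E g = g) (hc : E c = c) (k : ℕ)
      (h : r ^ k * g = u * c) : (∃ d, E d = d ∧ r = u * d) ∨ ∃ d, E d = d ∧ g = u * d := by
    induction k generalizing c with
    | zero => exact Or.inr ⟨c, hc, by rw [← h, pow_zero, one_mul]⟩
    | succ k ih =>
      rw [pow_succ', mul_assoc] at h
      rcases dvd_or_dvd_of_minimal hE hcomm hu hu0 hεu hmin' hr
        (by rw [map_mul, map_pow, hr, hg]) hc h with h' | ⟨d, hd, h'⟩
      · exact Or.inl h'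
      · exact ih hd h'
  have hdvd (r : FreeAlgebra K X) (hr : E r = r) (hεr : algebraMapInv r = (0 : K)) :
      ∃ d, E d = d ∧ r = u * d := by
    obtain ⟨f, hf0, y, hy, hfy⟩ := exists_aeval_eq_mul hcomm hu hu0 hr
    obtain ⟨g, hg, hg'⟩ := Polynomial.exists_eq_pow_rootMultiplicity_mul_and_not_dvd f hf0 0
    rw [Polynomial.C_0, sub_zero] at hg hg'
    rw [hg, map_mul, map_pow, Polynomial.aeval_X] at hfy
    refine (hdvd_pow hr (by rw [← Polynomial.aeval_algHom_apply, hr]) hy _ hfy).resolve_right ?_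
    rintro ⟨d, -, hd⟩
    apply hg'
    have := congrArg (algebraMapInv : FreeAlgebra K X →ₐ[K] K) hd
    rw [← Polynomial.aeval_algHom_apply, hεr, map_mul, hεu, zero_mul] at this
    rwa [Polynomial.X_dvd_iff, Polynomial.coeff_zero_eq_aeval_zero]
  have hpoly (m : ℕ) : ∀ r, E r = r → (degreeHom r).natDegree ≤ m →
      ∃ p : Polynomial K, r = Polynomial.aeval u p := by
    induction m with
    | zero =>
      intro r hr hrm
      exact ⟨Polynomial.C (algebraMapInv r), by
        rw [Polynomial.aeval_C, ← eq_algebraMap_of_natDegree_eq_zero (Nat.le_zero.1 hrm)]⟩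
    | succ m ih =>
      intro r hr hrm
      obtain ⟨d, hd, h⟩ := hdvd (r - algebraMap K _ (algebraMapInv r))
        (by rw [map_sub, hr, AlgHom.commutes]) (by rw [map_sub]; simp)
      have hdm : (degreeHom d).natDegree ≤ m := by
        by_cases hd0 : d = 0
        · simp [hd0]
        · have h1 := natDegree_degreeHom_mul hu0 hd0
          have h2 : (degreeHom (u * d)).natDegree ≤ m + 1 := by
            rw [← h, map_sub, AlgHom.commutes]
            refine (Polynomial.natDegree_sub_le _ _).trans (max_le hrm ?_)
            rw [Polynomial.algebraMap_apply, Polynomial.natDegree_C]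
            exact Nat.zero_le _
          omega
      obtain ⟨p, hp⟩ := ih d hd hdm
      refine ⟨Polynomial.C (algebraMapInv r) + Polynomial.X * p, ?_⟩
      rw [map_add, map_mul, Polynomial.aeval_C, Polynomial.aeval_X, ← hp, ← h, add_sub_cancel]
  exact ⟨u, hu, hu0, hεu, fun a => hpoly _ (E a) (hE a) le_rfl⟩

theorem aeval_injective {u : FreeAlgebra K X} (hu0 : u ≠ 0) (hεu : algebraMapInv u = (0 : K)) :
    Function.Injective (Polynomial.aeval u : Polynomial K →ₐ[K] FreeAlgebra K X) := by
  rw [injective_iff_map_eq_zero]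
  intro f hf
  by_contra hf0
  obtain ⟨g, hg, hg'⟩ := Polynomial.exists_eq_pow_rootMultiplicity_mul_and_not_dvd f hf0 0
  rw [Polynomial.C_0, sub_zero] at hg hg'
  rw [hg, map_mul, map_pow, Polynomial.aeval_X] at hf
  have := (mul_eq_zero.1 hf).resolve_left (pow_ne_zero _ hu0)
  apply hg'
  have := congrArg (algebraMapInv : FreeAlgebra K X →ₐ[K] K) this
  rw [← Polynomial.aeval_algHom_apply, hεu, map_zero] at this
  rwa [Polynomial.X_dvd_iff, Polynomial.coeff_zero_eq_aeval_zero]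

theorem exists_algHom_apply_eq {u : FreeAlgebra K X} (hu : E u = u) (hu0 : u ≠ 0)
    (hεu : algebraMapInv u = (0 : K)) (h : ∀ a, ∃ p : Polynomial K, E a = Polynomial.aeval u p)
    (b : FreeAlgebra K X) : ∃ f : FreeAlgebra K X →ₐ[K] FreeAlgebra K X, f u = b := by
  choose p hp using fun i => h (ι K i)
  have hE : E = (Polynomial.aeval u).comp (lift K p) := by
    ext i
    simp [hp]
  have hX : lift K p u = Polynomial.X := by
    apply aeval_injective hu0 hεu
    rw [Polynomial.aeval_X]
    exact (DFunLike.congr_fun hE u).symm.trans hu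
  exact ⟨(Polynomial.aeval b).comp (lift K p), by
    rw [AlgHom.comp_apply, hX, Polynomial.aeval_X]⟩

end FreeAlgebra

namespace FreeAlgebra

variable {K : Type*} [Field K] {X : Type*}

/-- Conjugation by an algebra automorphism, as an automorphism of the endomorphism monoid. -/
def endCongr (η : FreeAlgebra K X ≃ₐ[K] FreeAlgebra K X) :
    MulAut (FreeAlgebra K X →ₐ[K] FreeAlgebra K X) where
  toFun ν := (η : FreeAlgebra K X →ₐ[K] FreeAlgebra K X).comp (ν.comp η.symm)
  invFun ν := (η.symm : FreeAlgebra K X →ₐ[K] FreeAlgebra K X).comp (ν.comp η)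
  left_inv ν := by ext; simp
  right_inv ν := by ext; simp
  map_mul' μ ν := by ext; simp

@[simp]
theorem endCongr_apply_apply (η : FreeAlgebra K X ≃ₐ[K] FreeAlgebra K X)
    (ν : FreeAlgebra K X →ₐ[K] FreeAlgebra K X) (a : FreeAlgebra K X) :
    endCongr η ν a = η (ν (η.symm a)) := rfl

/-- Translation of the generators by scalars. -/
noncomputable def translation (c : X → K) : FreeAlgebra K X ≃ₐ[K] FreeAlgebra K X :=
  AlgEquiv.ofAlgHom (lift K fun i => ι K i + algebraMap K _ (c i))
    (lift K fun i => ι K i - algebraMap K _ (c i))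
    (by ext i; simp) (by ext i; simp)

theorem translation_symm_ι (c : X → K) (i : X) :
    (translation c).symm (ι K i) = ι K i - algebraMap K _ (c i) := by
  simp [translation]

theorem exists_endCongr_zeroEnd (Φ : MulAut (FreeAlgebra K X →ₐ[K] FreeAlgebra K X)) :
    ∃ η : FreeAlgebra K X ≃ₐ[K] FreeAlgebra K X, (endCongr η * Φ) zeroEnd = zeroEnd := by
  have h0 (g : FreeAlgebra K X →ₐ[K] FreeAlgebra K X) : g * zeroEnd = zeroEnd := by
    ext a; simp [zeroEnd_apply]
  have h1 : zeroEnd * Φ zeroEnd = Φ zeroEnd := by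
    have := congrArg Φ (h0 (Φ.symm zeroEnd))
    rwa [map_mul, Φ.apply_symm_apply] at this
  refine ⟨translation fun i => algebraMapInv (Φ zeroEnd (ι K i)), ?_⟩
  ext i
  have h2 : algebraMap K _ (algebraMapInv (Φ zeroEnd (ι K i))) = Φ zeroEnd (ι K i) :=
    DFunLike.congr_fun h1 (ι K i)
  simp only [Function.comp_apply]
  rw [MulAut.mul_apply, endCongr_apply_apply, translation_symm_ι, map_sub, AlgHom.commutes, h2,
    sub_self, map_zero, zeroEnd_apply, algebraMapInv_ι, map_zero]

theorem exists_algEquiv_of_adjoint {Φ : MulAut (FreeAlgebra K X →ₐ[K] FreeAlgebra K X)}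
    {s : FreeAlgebra K X ≃ FreeAlgebra K X} (hs : ∀ ν a, Φ ν (s a) = s (ν a)) :
    ∃ η : FreeAlgebra K X ≃ₐ[K] FreeAlgebra K X, ∀ i, η (ι K i) = s (ι K i) := by
  have hex (a : X → FreeAlgebra K X) :
      ∃ f : FreeAlgebra K X →ₐ[K] FreeAlgebra K X, ∀ i, f (s (ι K i)) = a i :=
    ⟨Φ (lift K fun i => s.symm (a i)), fun i => by rw [hs, lift_ι_apply, s.apply_symm_apply]⟩
  have huniq (f g : FreeAlgebra K X →ₐ[K] FreeAlgebra K X)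
      (h : ∀ i, f (s (ι K i)) = g (s (ι K i))) : f = g := by
    apply Φ.symm.injective
    ext i
    apply s.injective
    simp only [Function.comp_apply]
    rw [← hs, ← hs, Φ.apply_symm_apply, Φ.apply_symm_apply, h]
  obtain ⟨f, hf⟩ := hex (ι K)
  refine ⟨AlgEquiv.ofAlgHom (lift K fun i => s (ι K i)) f (huniq _ _ fun i => ?_) ?_, fun i => ?_⟩
  · simp [hf]
  · ext i; simp [hf]
  · simp

variable [DecidableEq X]

/-- The endomorphism sending one generator to `a` and the others to `0`. -/
noncomputable def singleEnd (i : X) (a : FreeAlgebra K X) :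
    FreeAlgebra K X →ₐ[K] FreeAlgebra K X := lift K (Pi.single i a)

@[simp]
theorem singleEnd_ι_self (i : X) (a : FreeAlgebra K X) : singleEnd i a (ι K i) = a := by
  simp [singleEnd]

theorem singleEnd_ι_of_ne {i j : X} (h : j ≠ i) (a : FreeAlgebra K X) :
    singleEnd i a (ι K j) = 0 := by
  simp [singleEnd, h]

theorem mul_singleEnd (g : FreeAlgebra K X →ₐ[K] FreeAlgebra K X) (i : X) (a : FreeAlgebra K X) :
    g * singleEnd i a = singleEnd i (g a) := by
  ext j
  simp only [Function.comp_apply]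
  rw [AlgHom.mul_apply]
  obtain rfl | h := eq_or_ne j i
  · simp
  · simp [singleEnd_ι_of_ne h]

@[simp]
theorem singleEnd_zero (i : X) : singleEnd i (0 : FreeAlgebra K X) = zeroEnd := by
  ext j
  simp [singleEnd, zeroEnd_apply]

theorem exists_adjoint_of_map_zeroEnd [Fintype X] (i : X)
    (Φ : MulAut (FreeAlgebra K X →ₐ[K] FreeAlgebra K X)) (hΦ : Φ zeroEnd = zeroEnd) :
    ∃ s : FreeAlgebra K X ≃ FreeAlgebra K X, (∀ ν a, Φ ν (s a) = s (ν a)) ∧ s 0 = 0 := by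
  let E : X → X → (FreeAlgebra K X →ₐ[K] FreeAlgebra K X) :=
    fun j k => Φ (singleEnd k (ι K j))
  have hmul (j k l m : X) : E j k * E l m = Φ (singleEnd m (singleEnd k (ι K j) (ι K l))) := by
    rw [← map_mul, mul_singleEnd]
  have hε (j k a) : algebraMapInv (E j k a) = (algebraMapInv a : K) := by
    have h1 : zeroEnd * E j k = zeroEnd := by
      conv_rhs => rw [← hΦ, ← singleEnd_zero k]
      rw [← hΦ, ← map_mul, mul_singleEnd, zeroEnd_apply, algebraMapInv_ι, map_zero]
    exact (algebraMap K (FreeAlgebra K X)).injective (DFunLike.congr_fun h1 a)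
  have hE (j k l a) : E j k (E k l a) = E j l a := by
    rw [← AlgHom.mul_apply, hmul, singleEnd_ι_self]
  have hE' (j k l m a) (h : k ≠ l) : E j k (E l m a) = zeroEnd a := by
    rw [← AlgHom.mul_apply, hmul, singleEnd_ι_of_ne h.symm, singleEnd_zero, hΦ]
  have h0 : E i i ≠ zeroEnd := by
    intro h
    have h1 := DFunLike.congr_fun (Φ.injective (h.trans hΦ.symm)) (ι K i)
    rw [singleEnd_ι_self, zeroEnd_apply, algebraMapInv_ι, map_zero] at h1
    exact ι_ne_zero i h1
  obtain ⟨z, hz, hz0, hzε, hz'⟩ := exists_map_augmentation_le hε hE hE' i h0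
  have hcomm := commute_of_map_augmentation_le (hE i i i) (hε i i) hz hzε hz'
  obtain ⟨u, hu, hu0, hεu, haeval⟩ := exists_eq_aeval (hE i i i) hcomm hz hz0 hzε
  have hinj : Function.Injective fun a => Φ (singleEnd i a) u := by
    intro a b hab
    have h1 : Φ (singleEnd i a) * E i i = Φ (singleEnd i b) * E i i := by
      refine AlgHom.ext fun x => ?_
      obtain ⟨p, hp⟩ := haeval x
      rw [AlgHom.mul_apply, AlgHom.mul_apply, hp, ← Polynomial.aeval_algHom_apply,
        ← Polynomial.aeval_algHom_apply]
      exact congrArg (fun y => Polynomial.aeval y p) hab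
    rw [← map_mul, ← map_mul, mul_singleEnd, mul_singleEnd, singleEnd_ι_self,
      singleEnd_ι_self] at h1
    simpa using DFunLike.congr_fun (Φ.injective h1) (ι K i)
  have hsurj : Function.Surjective fun a => Φ (singleEnd i a) u := by
    intro b
    obtain ⟨f, hf⟩ := exists_algHom_apply_eq hu hu0 hεu haeval b
    refine ⟨Φ.symm f (ι K i), ?_⟩
    simp only
    rw [← mul_singleEnd, map_mul, Φ.apply_symm_apply, AlgHom.mul_apply]
    exact (congrArg f hu).trans hf
  have hbij : Function.Bijective fun a => Φ (singleEnd i a) u := ⟨hinj, hsurj⟩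
  refine ⟨Equiv.ofBijective _ hbij, fun ν a => ?_, ?_⟩
  · simp only [Equiv.ofBijective_apply]
    rw [← AlgHom.mul_apply, ← map_mul, mul_singleEnd]
  · rw [Equiv.ofBijective_apply, singleEnd_zero, hΦ, zeroEnd_apply, hεu, map_zero]

theorem exists_endCongr_adjoint [Fintype X] [Nonempty X]
    (Φ : MulAut (FreeAlgebra K X →ₐ[K] FreeAlgebra K X)) :
    ∃ (η : FreeAlgebra K X ≃ₐ[K] FreeAlgebra K X) (s : FreeAlgebra K X ≃ FreeAlgebra K X),
      (∀ ν a, (endCongr η * Φ) ν (s a) = s (ν a)) ∧ s 0 = 0 ∧ ∀ i, s (ι K i) = ι K i := by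
  obtain ⟨τ, hτ⟩ := exists_endCongr_zeroEnd Φ
  obtain ⟨s, hs, hs0⟩ := exists_adjoint_of_map_zeroEnd (Classical.arbitrary X) _ hτ
  obtain ⟨η, hη⟩ := exists_algEquiv_of_adjoint hs
  refine ⟨τ.trans η.symm, s.trans η.symm.toEquiv, fun ν a => ?_, ?_, fun i => ?_⟩
  · have := hs ν a
    simp only [MulAut.mul_apply, endCongr_apply_apply] at this
    simp [this]
  · simp [hs0]
  · simp [← hη]

end FreeAlgebra

namespace FreeAlgebra

variable {K : Type*} [Field K] {X : Type*}

/-- Substitution-compatible permutations of a free algebra fixing `0` and the generators. -/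
structure SubstCompatible (s : FreeAlgebra K X ≃ FreeAlgebra K X) : Prop where
  map_zero : s 0 = 0
  map_ι : ∀ i, s (ι K i) = ι K i
  map_subst : ∀ f g : FreeAlgebra K X →ₐ[K] FreeAlgebra K X,
    (∀ i, g (ι K i) = s (f (ι K i))) → ∀ a, s (f a) = g (s a)

theorem SubstCompatible.symm {s : FreeAlgebra K X ≃ FreeAlgebra K X} (hs : SubstCompatible s) :
    SubstCompatible s.symm where
  map_zero := by rw [Equiv.symm_apply_eq, hs.map_zero]
  map_ι i := by rw [Equiv.symm_apply_eq, hs.map_ι]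
  map_subst f g h a := by
    rw [Equiv.symm_apply_eq, hs.map_subst g f (fun i => by rw [h, s.apply_symm_apply]),
      s.apply_symm_apply]

variable [DecidableEq X] {B C : Type*} [Ring B] [Algebra K B] [Ring C] [Algebra K C]

/-- The homomorphism sending two generators to `a` and `b` and the others to `0`. -/
noncomputable def pairHom (i j : X) (a b : B) : FreeAlgebra K X →ₐ[K] B :=
  lift K fun k => if k = i then a else if k = j then b else 0

theorem pairHom_ι (i j : X) (a b : B) (k : X) :
    pairHom i j a b (ι K k) = if k = i then a else if k = j then b else 0 :=
  lift_ι_apply _ _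

@[simp]
theorem pairHom_ι_left (i j : X) (a b : B) : pairHom i j a b (ι K i) = a := by
  simp [pairHom_ι]

theorem pairHom_ι_right {i j : X} (hij : i ≠ j) (a b : B) : pairHom i j a b (ι K j) = b := by
  simp [pairHom_ι, hij.symm]

theorem map_pairHom (g : B →ₐ[K] C) (i j : X) (a b : B) (c : FreeAlgebra K X) :
    g (pairHom i j a b c) = pairHom i j (g a) (g b) c := by
  have : g.comp (pairHom i j a b) = (pairHom i j (g a) (g b) : FreeAlgebra K X →ₐ[K] C) := by
    ext k
    simp only [Function.comp_apply, AlgHom.comp_apply, pairHom_ι]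
    split_ifs <;> simp
  exact DFunLike.congr_fun this c

theorem pairHom_swap {i j : X} (hij : i ≠ j) (a b : B) :
    (pairHom j i b a : FreeAlgebra K X →ₐ[K] B) = pairHom i j a b := by
  ext k
  simp only [Function.comp_apply, pairHom_ι]
  split_ifs <;> simp_all

theorem pairHom_zero_zero (i j : X) (c : FreeAlgebra K X) :
    pairHom i j 0 0 c = algebraMap K B (algebraMapInv c) := by
  have : (pairHom i j 0 0 : FreeAlgebra K X →ₐ[K] B) = (Algebra.ofId K B).comp algebraMapInv := by
    ext k
    simp [pairHom_ι]
  exact DFunLike.congr_fun this c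

theorem pairHom_eq [Fintype X] {i j : X} (hij : i ≠ j) (a b : B) (c : FreeAlgebra K X) :
    pairHom i j a b c = algebraMap K B (algebraMapInv c) + a * pairHom i j a b (fox i c) +
      b * pairHom i j a b (fox j c) := by
  conv_lhs => rw [fox_sum c]
  rw [map_add, AlgHom.commutes, map_sum, add_assoc,
    Fintype.sum_eq_add i j hij fun k hk => by simp [pairHom_ι, hk.1, hk.2],
    map_mul, map_mul, pairHom_ι_left, pairHom_ι_right hij]

/-- A substitution that is additive in both variables has the first Fox derivative of
the bilinear form. -/
theorem exists_pairHom_fox_eq_smul [Fintype X] {i j : X} (hij : i ≠ j) {q : FreeAlgebra K X}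
    (hl : ∀ a b c : FreeAlgebra K (Fin 3),
      pairHom i j (a + b) c q = pairHom i j a c q + pairHom i j b c q)
    (hr : ∀ a b c : FreeAlgebra K (Fin 3),
      pairHom i j a (b + c) q = pairHom i j a b q + pairHom i j a c q) :
    ∃ α : K, ∀ a b : FreeAlgebra K X, pairHom i j a b (fox i q) = α • b := by
  have h02 : (0 : Fin 3) ≠ 2 := by decide
  have h01 : (0 : Fin 3) ≠ 1 := by decide
  have h12 : (1 : Fin 3) ≠ 2 := by decide
  have h1 (a b : FreeAlgebra K X) : pairHom i j a b (fox i q) = pairHom i j 0 b (fox i q) := by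
    have h := congrArg (fox 0) (hl (ι K 0) (ι K 2) (ι K 1))
    rw [pairHom_eq hij, pairHom_eq hij (ι K 0), pairHom_eq hij (ι K 2)] at h
    simp only [map_add, fox_algebraMap, add_mul, fox_ι_mul, h02.symm, h01.symm, if_true, if_false,
      add_zero, zero_add] at h
    have h' := congrArg (lift K ![0, b, a]) h
    simp only [map_pairHom, map_add, lift_ι_apply] at h'
    simpa using h'
  have h2 : pairHom i j (ι K 0) (ι K 1 + ι K 2) (fox i q) =
      pairHom i j (ι K 0) (ι K 1) (fox i q) +
        (pairHom i j (ι K 0) (ι K 2) (fox i q) : FreeAlgebra K (Fin 3)) := by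
    have h := congrArg (fox 0) (hr (ι K 0) (ι K 1) (ι K 2))
    rw [pairHom_eq hij, pairHom_eq hij _ (ι K 1), pairHom_eq hij _ (ι K 2)] at h
    simpa only [map_add, fox_algebraMap, add_mul, fox_ι_mul, h02.symm, h01.symm, if_true, if_false,
      add_zero, zero_add] using h
  have hε : (algebraMapInv (fox i q) : K) = 0 := by
    have h := congrArg (lift K ![(0 : K), 0, 0]) h2
    simp only [map_pairHom, map_add, lift_ι_apply] at h
    simpa [pairHom_zero_zero] using h
  have h3 (a b : FreeAlgebra K X) :
      pairHom i j a b (fox j (fox i q)) = pairHom i j a 0 (fox j (fox i q)) := by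
    have h := congrArg (fox 1) h2
    rw [pairHom_eq hij, pairHom_eq hij _ (ι K 1), pairHom_eq hij _ (ι K 2)] at h
    simp only [map_add, fox_algebraMap, add_mul, fox_ι_mul, h12.symm, h01, if_true, if_false,
      add_zero, zero_add] at h
    have h' := congrArg (lift K ![a, 0, b]) h
    simp only [map_pairHom, map_add, lift_ι_apply] at h'
    simpa using h'
  refine ⟨algebraMapInv (fox j (fox i q)), fun a b => ?_⟩
  rw [h1, pairHom_eq hij, h3, pairHom_zero_zero, hε, map_zero, zero_mul, zero_add, zero_add,
    ← Algebra.commutes, Algebra.smul_def]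

namespace SubstCompatible

variable {s : FreeAlgebra K X ≃ FreeAlgebra K X}

theorem map_pairHom (hs : SubstCompatible s) (i j : X) (a b c : FreeAlgebra K X) :
    s (pairHom i j a b c) = pairHom i j (s a) (s b) (s c) := by
  refine hs.map_subst _ _ (fun k => ?_) c
  simp only [pairHom_ι]
  split_ifs <;> simp [hs.map_zero]

theorem algebraMapInv_apply (hs : SubstCompatible s) (i : X) {c : FreeAlgebra K X}
    (hc : algebraMapInv c = (0 : K)) : algebraMapInv (s c) = (0 : K) := by
  have h := hs.map_pairHom i i 0 0 c
  rw [hs.map_zero, pairHom_zero_zero, pairHom_zero_zero, hc, _root_.map_zero, hs.map_zero] at h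
  have := congrArg (algebraMapInv : FreeAlgebra K X →ₐ[K] K) h
  simpa using this.symm

variable [Fintype X] {i j : X}

theorem exists_smul_ι_eq_mul (hs : SubstCompatible s) (hij : i ≠ j) (α : K) :
    ∃ t, s (α • ι K i) = ι K i * t := by
  have h := hs.map_pairHom i j (ι K i) 0 (α • ι K i)
  rw [map_smul, pairHom_ι_left, hs.map_ι, hs.map_zero, pairHom_eq hij,
    hs.algebraMapInv_apply i (by simp), _root_.map_zero, zero_add, zero_mul, add_zero] at h
  exact ⟨_, h⟩

theorem map_add (hs : SubstCompatible s) (hij : i ≠ j) (a b : FreeAlgebra K X) :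
    s (a + b) = s a + s b := by
  set p := s (ι K i + ι K j) with hp
  have hadd (a b) : s (a + b) = pairHom i j (s a) (s b) p := by
    rw [hp, ← hs.map_pairHom, _root_.map_add (pairHom i j a b), pairHom_ι_left, pairHom_ι_right hij]
  have hε : algebraMapInv p = (0 : K) := hs.algebraMapInv_apply i (by simp)
  have hpair (a b : FreeAlgebra K X) : pairHom i j a b p =
      a * pairHom i j a b (fox i p) + b * pairHom i j a b (fox j p) := by
    rw [pairHom_eq hij, hε, _root_.map_zero, zero_add]
  obtain ⟨c, hc⟩ : ∃ c, fox j p = algebraMap K _ c := by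
    obtain ⟨t, ht⟩ := hs.exists_smul_ι_eq_mul hij (-1)
    have h := hadd ((-1 : K) • ι K i) (ι K i + ι K j)
    rw [neg_one_smul, neg_add_cancel_left, hs.map_ι, ← neg_one_smul K, ht, ← hp, hpair] at h
    have h' := congrArg (fox j) h
    rw [_root_.map_add, mul_assoc, fox_ι_mul_of_ne hij, zero_add, fox_mul, hε, zero_smul, add_zero,
      fox_ι, if_pos rfl] at h'
    exact exists_eq_algebraMap_of_mul_eq_one h'.symm
  have hc' : fox i p = algebraMap K _ c := by
    have h := hadd (ι K j) (ι K i)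
    rw [add_comm, ← hp, hs.map_ι, hs.map_ι, hpair, hc, AlgHom.commutes] at h
    rw [h, _root_.map_add, fox_ι_mul_of_ne hij.symm, fox_ι_mul_self, zero_add]
  have hpair' (a b : FreeAlgebra K X) : pairHom i j a b p = c • (a + b) := by
    rw [hpair, hc, hc', AlgHom.commutes, smul_add, ← Algebra.commutes, ← Algebra.commutes,
      Algebra.smul_def, Algebra.smul_def]
  have hc1 : c = 1 := by
    have h := congrArg (fun z => algebraMapInv (fox i z)) (hadd (ι K i) 0)
    simpa [hpair', hs.map_ι, hs.map_zero, fox_ι] using h.symm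
  rw [hadd, hpair', hc1, one_smul]

theorem exists_map_smul (hs : SubstCompatible s) (hij : i ≠ j) (α : K) :
    ∃ c : K, ∀ a, s (α • a) = c • s a := by
  obtain rfl | hα := eq_or_ne α 0
  · exact ⟨0, fun a => by rw [zero_smul, zero_smul, hs.map_zero]⟩
  have hsmul (α : K) (a) : s (α • a) = pairHom i j (s a) 0 (s (α • ι K i)) := by
    have := hs.map_pairHom i j a 0 (α • ι K i)
    rwa [map_smul, pairHom_ι_left, hs.map_zero] at this
  obtain ⟨t, ht⟩ := hs.exists_smul_ι_eq_mul hij α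
  obtain ⟨w, hw⟩ := hs.exists_smul_ι_eq_mul hij α⁻¹
  have h := hsmul α⁻¹ (α • ι K i)
  rw [inv_smul_smul₀ hα, hs.map_ι, hw, map_mul, pairHom_ι_left, ht, mul_assoc] at h
  have h' := congrArg (fox i) h
  rw [fox_ι_mul_self, fox_ι, if_pos rfl] at h'
  obtain ⟨c, rfl⟩ := exists_eq_algebraMap_of_mul_eq_one h'.symm
  exact ⟨c, fun a => by
    rw [hsmul, ht, map_mul, pairHom_ι_left, AlgHom.commutes, ← Algebra.commutes, Algebra.smul_def]⟩

theorem exists_ringEquiv_map_smul (hs : SubstCompatible s) (hij : i ≠ j) :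
    ∃ φ : K ≃+* K, ∀ (α : K) a, s (α • a) = φ α • s a := by
  choose φ hφ using hs.exists_map_smul hij
  choose ψ hψ using hs.symm.exists_map_smul hij
  have hinj : Function.Injective fun c : K => c • ι K i := smul_left_injective K (ι_ne_zero i)
  have hval (α : K) : s (α • ι K i) = φ α • ι K i := by rw [hφ, hs.map_ι]
  have hval' (α : K) : s.symm (α • ι K i) = ψ α • ι K i := by rw [hψ, hs.symm.map_ι]
  refine ⟨RingEquiv.mk ⟨φ, ψ, fun α => hinj ?_, fun α => hinj ?_⟩ (fun α β => hinj ?_)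
    (fun α β => hinj ?_), hφ⟩
  · simp only [← hval', ← hval, s.symm_apply_apply]
  · simp only [← hval', ← hval, s.apply_symm_apply]
  · simp only [← hval]
    rw [mul_smul, mul_smul, hφ, hval]
  · simp only [← hval]
    rw [add_smul, add_smul, hs.map_add hij, hval, hval]

end SubstCompatible

namespace SubstCompatible

variable {n : ℕ} {s : FreeAlgebra K (Fin n) ≃ FreeAlgebra K (Fin n)} {i j : Fin n}

theorem exists_map_mul (hs : SubstCompatible s) (hij : i ≠ j) :
    ∃ α β : K, ∀ a b, s (a * b) = α • (s a * s b) + β • (s b * s a) := by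
  set q := s (ι K i * ι K j) with hq
  have hmul (a b) : s (a * b) = pairHom i j (s a) (s b) q := by
    rw [hq, ← hs.map_pairHom, map_mul (pairHom i j a b), pairHom_ι_left, pairHom_ι_right hij]
  have hmul' (a b) : pairHom i j a b q = s (s.symm a * s.symm b) := by
    rw [hmul, s.apply_symm_apply, s.apply_symm_apply]
  have hinj := lift_prefix_code_injective (K := K) hij
  have hl (a b c : FreeAlgebra K (Fin 3)) :
      pairHom i j (a + b) c q = pairHom i j a c q + pairHom i j b c q := by
    apply hinj
    simp only [_root_.map_add, FreeAlgebra.map_pairHom, hmul', hs.symm.map_add hij, add_mul,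
      hs.map_add hij]
  have hr (a b c : FreeAlgebra K (Fin 3)) :
      pairHom i j a (b + c) q = pairHom i j a b q + pairHom i j a c q := by
    apply hinj
    simp only [_root_.map_add, FreeAlgebra.map_pairHom, hmul', hs.symm.map_add hij, mul_add,
      hs.map_add hij]
  obtain ⟨α, hα⟩ := exists_pairHom_fox_eq_smul hij hl hr
  simp only [← pairHom_swap hij] at hl hr
  obtain ⟨β, hβ⟩ := exists_pairHom_fox_eq_smul hij.symm (fun a b c => hr c a b)
    fun a b c => hl b c a
  refine ⟨α, β, fun a b => ?_⟩
  rw [hmul, pairHom_eq hij, hα, ← pairHom_swap hij (s a), hβ, hs.algebraMapInv_apply i (by simp),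
    _root_.map_zero, zero_add, mul_smul_comm, mul_smul_comm]

theorem map_mul_or_map_mul_rev (hs : SubstCompatible s) (hij : i ≠ j) :
    (∃ α : K, α ≠ 0 ∧ ∀ a b, s (a * b) = α • (s a * s b)) ∨
      ∃ β : K, β ≠ 0 ∧ ∀ a b, s (a * b) = β • (s b * s a) := by
  obtain ⟨α, β, h⟩ := hs.exists_map_mul hij
  have hassoc : α * β = 0 := by
    have h1 : s (ι K i * (ι K i * ι K j)) = s (ι K i * ι K i * ι K j) := by rw [mul_assoc]
    have h2 := congrArg (fun z => (algebraMapInv (fox j (fox i (fox i z))) : K)) h1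
    simp [h, hs.map_ι, fox_mul, fox_ι, hij.symm] at h2
    exact mul_eq_zero.2 h2.symm
  have hne : ¬ (α = 0 ∧ β = 0) := by
    rintro ⟨rfl, rfl⟩
    have h1 := h (ι K i) (ι K j)
    rw [zero_smul, zero_smul, add_zero, ← hs.map_zero] at h1
    exact mul_ne_zero (ι_ne_zero i) (ι_ne_zero j) (s.injective h1)
  rcases mul_eq_zero.1 hassoc with rfl | rfl
  · exact Or.inr ⟨β, fun hβ => hne ⟨rfl, hβ⟩, fun a b => by rw [h, zero_smul, zero_add]⟩
  · exact Or.inl ⟨α, fun hα => hne ⟨hα, rfl⟩, fun a b => by rw [h, zero_smul, add_zero]⟩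

end SubstCompatible

end FreeAlgebra

namespace Stmt0

variable (K : Type*) [Field K] (n : ℕ)

variable {K n} in
theorem IsAdjoint.of_apply {Φ : MulAut (FreeAlgebra K (Fin n) →ₐ[K] FreeAlgebra K (Fin n))}
    {s : FreeAlgebra K (Fin n) ≃ FreeAlgebra K (Fin n)} (h : ∀ ν a, Φ ν (s a) = s (ν a)) :
    IsAdjoint K n Φ s := fun ν a => by rw [← h, s.apply_symm_apply]

theorem isSemiInner_endCongr (η : FreeAlgebra K (Fin n) ≃ₐ[K] FreeAlgebra K (Fin n)) :
    IsSemiInner K n (FreeAlgebra.endCongr η) :=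
  ⟨η.toEquiv, .of_apply fun ν a => by simp, map_add η, map_mul η, RingEquiv.refl K, map_smul η⟩

theorem isSemiInner_or_isMirror_of_adjoint (hn : 2 ≤ n)
    {Φ : MulAut (FreeAlgebra K (Fin n) →ₐ[K] FreeAlgebra K (Fin n))}
    {s : FreeAlgebra K (Fin n) ≃ FreeAlgebra K (Fin n)} (h : ∀ ν a, Φ ν (s a) = s (ν a))
    (hs0 : s 0 = 0) (hs1 : ∀ i, s (FreeAlgebra.ι K i) = FreeAlgebra.ι K i) :
    IsSemiInner K n Φ ∨ IsMirror K n Φ := by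
  have hs : FreeAlgebra.SubstCompatible s := by
    refine ⟨hs0, hs1, fun f g hfg a => ?_⟩
    rw [← h]
    refine DFunLike.congr_fun (FreeAlgebra.hom_ext (funext fun i => ?_)) _
    rw [Function.comp_apply, Function.comp_apply, hfg, ← h, hs1]
  have hij : (⟨0, by omega⟩ : Fin n) ≠ ⟨1, by omega⟩ := by simp
  have hadd := hs.map_add hij
  obtain ⟨φ, hφ⟩ := hs.exists_ringEquiv_map_smul hij
  rcases hs.map_mul_or_map_mul_rev hij with ⟨α, hα, hmul⟩ | ⟨α, hα, hmul⟩
  on_goal 1 => left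
  on_goal 2 => right
  all_goals
    refine ⟨s.trans (MulAction.toPerm (Units.mk0 α hα)), .of_apply fun ν a => ?_,
      fun a b => ?_, ?_⟩
    · simp [Units.smul_def, h]
    · simp [Units.smul_def, hadd]
  · exact ⟨fun a b => by simp [Units.smul_def, hmul],
      φ, fun c a => by simp [Units.smul_def, hφ, smul_comm α]⟩
  · exact fun a b => by simp [Units.smul_def, hmul]

theorem autEnd_generated_by_semiInner_and_mirror (hn : 2 ≤ n)
    (Φ : MulAut (FreeAlgebra K (Fin n) →ₐ[K] FreeAlgebra K (Fin n))) :
    Φ ∈ Subgroup.closure {Ψ : MulAut (FreeAlgebra K (Fin n) →ₐ[K] FreeAlgebra K (Fin n)) |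
      IsSemiInner K n Ψ ∨ IsMirror K n Ψ} := by
  have : Nonempty (Fin n) := ⟨⟨0, by omega⟩⟩
  obtain ⟨η, s, hs, hs0, hs1⟩ := FreeAlgebra.exists_endCongr_adjoint Φ
  rw [← inv_mul_cancel_left (FreeAlgebra.endCongr η) Φ]
  exact mul_mem (inv_mem (Subgroup.subset_closure (Or.inl (isSemiInner_endCongr K n η))))
    (Subgroup.subset_closure (isSemiInner_or_isMirror_of_adjoint K n hn hs hs0 hs1))

end Stmt0
end

section
/- Every automorphism Φ of the monoid End A of K-algebra endomorphisms of the free associative algebra A is quasi-inner, i.e., there exists a bijection s : A → A such that Φ(ν) = s ∘ ν ∘ s⁻¹ (as set maps) for every ν ∈ End A. -/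
/-!
Statement 1: Every automorphism `Φ` of the monoid `End A` of `K`-algebra endomorphisms
of the free associative algebra `A = K⟨x₁,…,xₙ⟩` (`n ≥ 2`) is quasi-inner: there is a
bijection `s : A → A` with `Φ ν = s ∘ ν ∘ s⁻¹` (as set maps) for every `ν ∈ End A`.
-/

namespace Stmt1

variable (K : Type*) [Field K] (n : ℕ)

/-- `Φ` is quasi-inner: there is a bijection `s : A → A` such that
`Φ ν = s ∘ ν ∘ s⁻¹` as set maps, for every endomorphism `ν`. -/
def IsQuasiInner (Φ : MulAut (FreeAlgebra K (Fin n) →ₐ[K] FreeAlgebra K (Fin n))) : Prop :=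
  ∃ s : FreeAlgebra K (Fin n) ≃ FreeAlgebra K (Fin n),
    ∀ (ν : FreeAlgebra K (Fin n) →ₐ[K] FreeAlgebra K (Fin n)) (a : FreeAlgebra K (Fin n)),
      Φ ν a = s (ν (s.symm a))

open Polynomial in
/-- `K[X]` is integral over the subalgebra generated by a nonconstant polynomial. -/
theorem isIntegral_aeval_of_natDegree_ne_zero {K : Type*} [Field K] (p : K[X])
    (hp : p.natDegree ≠ 0) : (aeval p : K[X] →ₐ[K] K[X]).toRingHom.IsIntegral := by
  set φ : K[X] →+* K[X] := (aeval p : K[X] →ₐ[K] K[X]).toRingHom with hφ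
  have hC (c : K) : φ (C c) = C c := by simp [hφ]
  have hX : φ X = p := by simp [hφ]
  have hp0 : p ≠ 0 := by rintro rfl; simp at hp
  have hlc : p.leadingCoeff ≠ 0 := leadingCoeff_ne_zero.2 hp0
  have hXint : φ.IsIntegralElem X := by
    have hm : (C p.leadingCoeff⁻¹ * p).Monic := by
      rw [mul_comm]; exact monic_mul_leadingCoeff_inv hp0
    have hd : (C p.leadingCoeff⁻¹ * p).natDegree ≠ 0 := by
      rwa [natDegree_C_mul (inv_ne_zero hlc)]
    refine ⟨(C p.leadingCoeff⁻¹ * p).map C - C (C p.leadingCoeff⁻¹ * X), ?_, ?_⟩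
    · refine (hm.map C).sub_of_left (lt_of_le_of_lt degree_C_le ?_)
      rw [hm.degree_map]
      exact natDegree_pos_iff_degree_pos.1 (Nat.pos_of_ne_zero hd)
    · have hcomp : φ.comp C = C := RingHom.ext hC
      rw [eval₂_sub, eval₂_map, hcomp, eval₂_C, eval₂_C_X, map_mul, hC, hX, sub_self]
  intro q
  induction q using Polynomial.induction_on' with
  | add a b ha hb => exact ha.add φ hb
  | monomial m c =>
    rw [← C_mul_X_pow_eq_monomial]
    refine RingHom.IsIntegralElem.mul φ (hC c ▸ φ.isIntegralElem_map) ?_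
    induction m with
    | zero => simpa using φ.isIntegralElem_one
    | succ m ih => rw [pow_succ]; exact ih.mul φ hXint

open Polynomial in
/-- A nonzero prime element of `P` lying in the kernel of a character divides every element of
the kernel that is integral over `K[t]`, as soon as it divides `t`. -/
theorem prime_dvd_of_integral {K P : Type*} [Field K] [CommRing P] [Algebra K P]
    (χ : P →ₐ[K] K) {q t r : P} (hq : Prime q) (hqχ : χ q = 0) (hqt : q ∣ t) (hr : χ r = 0)
    (hint : (aeval t : K[X] →ₐ[K] P).toRingHom.IsIntegralElem r) : q ∣ r := by
  obtain ⟨G, hG, hGr⟩ := hint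
  set g : K[X] := G.map (evalRingHom 0) with hg
  have hgm : g.Monic := hG.map _
  have hdvd : q ∣ aeval r g := by
    have key : Ideal.Quotient.mk (Ideal.span {q}) (aeval r g) = 0 := by
      have h1 := congrArg (Ideal.Quotient.mk (Ideal.span {q})) hGr
      rw [hom_eval₂, map_zero] at h1
      rw [← h1, hg, aeval_def, eval₂_map, hom_eval₂]
      congr 1
      refine Polynomial.ringHom_ext (fun c => by simp) ?_
      have : Ideal.Quotient.mk (Ideal.span {q}) t = 0 :=
        Ideal.Quotient.eq_zero_iff_mem.2 (Ideal.mem_span_singleton.2 hqt)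
      simp [this]
    exact Ideal.mem_span_singleton.1 (Ideal.Quotient.eq_zero_iff_mem.1 key)
  obtain ⟨h, hgh, hh⟩ := exists_eq_pow_rootMultiplicity_mul_and_not_dvd g hgm.ne_zero 0
  rw [hgh, map_mul, map_pow, map_sub, aeval_X, aeval_C, map_zero, sub_zero] at hdvd
  rcases hq.dvd_or_dvd hdvd with h1 | ⟨w, hw⟩
  · exact hq.dvd_of_dvd_pow h1
  · exfalso
    apply hh
    rw [dvd_iff_isRoot, IsRoot.def]
    have := congrArg χ hw
    rwa [map_mul, hqχ, zero_mul, ← aeval_algHom_apply, hr, coe_aeval_eq_eval] at this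

open Polynomial in
/-- A retract of a factorial `K`-algebra with a character that embeds into `K[X]` is generated by
a single element. -/
theorem exists_generator_of_retract {K P : Type*} [Field K] [CommRing P] [IsDomain P]
    [UniqueFactorizationMonoid P] [Algebra K P] (χ₀ : P →ₐ[K] K) (F : P →ₐ[K] P)
    (hF : ∀ p, F (F p) = F p) (δ : P →ₐ[K] K[X]) (hδ : ∀ p, δ (F p) = 0 → F p = 0)
    (hne : ∃ p, (δ (F p)).natDegree ≠ 0) :
    ∃ u, F u = u ∧ ∀ p, ∃ G : K[X], F p = aeval u G := by
  obtain ⟨p₀, hp₀⟩ := hne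
  set χ : P →ₐ[K] K := χ₀.comp F with hχ
  have hχF (p : P) : χ (F p) = χ p := by simp [hχ, hF]
  set t : P := F (p₀ - algebraMap K P (χ p₀)) with ht
  have hδt : (δ t).natDegree ≠ 0 := by
    rw [ht, map_sub, map_sub, AlgHom.commutes, AlgHom.commutes, algebraMap_eq, natDegree_sub_C]
    exact hp₀
  have ht0 : t ≠ 0 := by
    intro h; simp [h] at hδt
  have hχt : χ t = 0 := by rw [ht, hχF]; simp
  obtain ⟨q, hq, hqt, hqχ⟩ : ∃ q, Prime q ∧ q ∣ t ∧ χ q = 0 := by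
    obtain ⟨s, hs, a, ha⟩ := UniqueFactorizationMonoid.exists_prime_factors t ht0
    have h0 : (s.map χ).prod = 0 := by
      have h1 : χ s.prod * χ a = 0 := by rw [← map_mul, ha, hχt]
      rw [Multiset.prod_hom]
      exact (mul_eq_zero.1 h1).resolve_right (a.isUnit.map χ).ne_zero
    obtain ⟨q, hqs, hq0⟩ := Multiset.mem_map.1 (Multiset.prod_eq_zero_iff.1 h0)
    exact ⟨q, hs q hqs, (Multiset.dvd_prod hqs).trans ⟨a, ha.symm⟩, hq0⟩
  have hdiv (p : P) (hp : χ p = 0) : ∃ z, F p = F q * F z := by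
    have hint : (aeval t : K[X] →ₐ[K] P).toRingHom.IsIntegralElem (F p) := by
      obtain ⟨G, hG, hGr⟩ := isIntegral_aeval_of_natDegree_ne_zero _ hδt (δ (F p))
      refine ⟨G, hG, ?_⟩
      set e : P := G.eval₂ (aeval t : K[X] →ₐ[K] P).toRingHom (F p) with he
      have hFt : F t = t := hF _
      have hFe : F e = e := by
        have := hom_eval₂ G (aeval t : K[X] →ₐ[K] P).toRingHom F.toRingHom (F p)
        simp only [AlgHom.toRingHom_eq_coe, RingHom.coe_coe, hF] at this
        rw [he]; simp only [AlgHom.toRingHom_eq_coe]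
        rw [this]
        congr 1
        exact Polynomial.ringHom_ext (fun c => by simp) (by simp [hFt])
      rw [← hFe]
      apply hδ
      rw [hFe, ← hGr, he]
      have := hom_eval₂ G (aeval t : K[X] →ₐ[K] P).toRingHom δ.toRingHom (F p)
      simp only [AlgHom.toRingHom_eq_coe, RingHom.coe_coe] at this ⊢
      rw [this]
      congr 1
      exact Polynomial.ringHom_ext (fun c => by simp) (by simp)
    obtain ⟨z, hz⟩ := prime_dvd_of_integral χ hq hqχ hqt (by rw [hχF, hp]) hint
    exact ⟨z, by rw [← hF p, hz, map_mul]⟩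
  have hδu : (δ (F q)).natDegree ≠ 0 := by
    intro h
    obtain ⟨z, hz⟩ := hdiv t hχt
    have hFt : F t = t := hF _
    have h1 := eq_C_of_natDegree_eq_zero h
    have h2 : F (q - algebraMap K P ((δ (F q)).coeff 0)) = 0 := by
      apply hδ
      rw [map_sub, map_sub, AlgHom.commutes, AlgHom.commutes, algebraMap_eq, ← h1, sub_self]
    have h3 := congrArg χ h2
    rw [hχF, map_sub, hqχ, AlgHom.commutes, map_zero, zero_sub, neg_eq_zero] at h3
    rw [map_sub, AlgHom.commutes, show (δ (F q)).coeff 0 = 0 from h3, map_zero, sub_zero] at h2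
    rw [hFt, h2, zero_mul] at hz
    exact ht0 hz
  refine ⟨F q, hF q, ?_⟩
  suffices H : ∀ (d : ℕ) (p : P), (δ (F p)).natDegree < d → ∃ G : K[X], F p = aeval (F q) G from
    fun p => H _ p (Nat.lt_succ_self _)
  intro d
  induction d with
  | zero => intro p hp; exact absurd hp (Nat.not_lt_zero _)
  | succ d ih =>
    intro p hp
    obtain ⟨z, hz⟩ := hdiv (p - algebraMap K P (χ p)) (by simp)
    rw [map_sub, AlgHom.commutes, sub_eq_iff_eq_add] at hz
    by_cases hz0 : F z = 0
    · exact ⟨C (χ p), by rw [hz, hz0, aeval_C]; simp⟩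
    · have hdeg : (δ (F z)).natDegree < d := by
        have h1 : (δ (F p)).natDegree = (δ (F q)).natDegree + (δ (F z)).natDegree := by
          rw [hz, map_add, AlgHom.commutes, algebraMap_eq, natDegree_add_C, map_mul, natDegree_mul]
          · intro h; simp [h] at hδu
          · exact fun h => hz0 (hδ z h)
        omega
      obtain ⟨G, hG⟩ := ih z hdeg
      exact ⟨X * G + C (χ p), by rw [hz, hG]; simp⟩

section Idempotents

variable {K : Type*} [Field K] {n : ℕ}

/-- A left zero of the monoid of endomorphisms takes only scalar values. -/
theorem exists_scalar_of_leftZero {z : FreeAlgebra K (Fin n) →ₐ[K] FreeAlgebra K (Fin n)}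
    (hz : ∀ ν : FreeAlgebra K (Fin n) →ₐ[K] FreeAlgebra K (Fin n), ν * z = z)
    (a : FreeAlgebra K (Fin n)) : ∃ c : K, z a = algebraMap K _ c := by
  have h := DFunLike.congr_fun
    (hz ((Algebra.ofId K (FreeAlgebra K (Fin n))).comp FreeAlgebra.algebraMapInv)) a
  exact ⟨_, h.symm⟩

/-- An endomorphism taking only scalar values is a left zero of the monoid of endomorphisms. -/
theorem leftZero_of_exists_scalar {z : FreeAlgebra K (Fin n) →ₐ[K] FreeAlgebra K (Fin n)}
    (hz : ∀ a, ∃ c : K, z a = algebraMap K _ c)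
    (ν : FreeAlgebra K (Fin n) →ₐ[K] FreeAlgebra K (Fin n)) : ν * z = z := by
  refine AlgHom.ext fun a => ?_
  obtain ⟨c, hc⟩ := hz a
  rw [AlgHom.mul_apply, hc, AlgHom.commutes]

open Polynomial in
/-- The endomorphism sending all generators to `x₀` is evaluation at `x₀` of the polynomial
obtained by identifying all generators. -/
theorem lift_const_apply (x a : FreeAlgebra K (Fin n)) :
    FreeAlgebra.lift K (fun _ : Fin n => x) a =
      aeval x (FreeAlgebra.lift K (fun _ : Fin n => (X : K[X])) a) := by
  refine DFunLike.congr_fun (f := FreeAlgebra.lift K (fun _ : Fin n => x))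
    (g := (aeval x).comp (FreeAlgebra.lift K (fun _ : Fin n => (X : K[X])))) ?_ a
  ext i
  simp

open Polynomial in
/-- In the corner monoid of the idempotent sending all generators to one of them, a product of two
elements that are not left zeros is not a left zero. -/
theorem leftZero_or_of_lift_const (i : Fin n)
    {e : FreeAlgebra K (Fin n) →ₐ[K] FreeAlgebra K (Fin n)}
    (he : e = FreeAlgebra.lift K (fun _ => FreeAlgebra.ι K i))
    (g h : FreeAlgebra K (Fin n) →ₐ[K] FreeAlgebra K (Fin n))
    (hgh : ∀ ν, ν * (e * g * e * h * e) = e * g * e * h * e) :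
    (∀ ν, ν * (e * g * e) = e * g * e) ∨ (∀ ν, ν * (e * h * e) = e * h * e) := by
  set x := FreeAlgebra.ι K i with hx
  set π : FreeAlgebra K (Fin n) →ₐ[K] K[X] := FreeAlgebra.lift K (fun _ => X) with hπ
  have hea (a) : e a = aeval x (π a) := by rw [he]; exact lift_const_apply x a
  have hπx : π x = X := by simp [hπ, hx]
  have hπa (p : K[X]) : π (aeval x p) = p := by rw [← aeval_algHom_apply, hπx, aeval_X_left_apply]
  have hege (k : FreeAlgebra K (Fin n) →ₐ[K] FreeAlgebra K (Fin n)) (a) :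
      (e * k * e) a = aeval x ((π a).comp (π (k x))) := by
    rw [AlgHom.mul_apply, AlgHom.mul_apply, hea (k (e a)), hea a, ← aeval_algHom_apply,
      ← aeval_algHom_apply, comp_eq_aeval]
  have hconst (k : FreeAlgebra K (Fin n) →ₐ[K] FreeAlgebra K (Fin n))
      (hk : (π (k x)).natDegree = 0) : ∀ ν, ν * (e * k * e) = e * k * e := by
    refine leftZero_of_exists_scalar fun a => ?_
    rw [hege, eq_C_of_natDegree_eq_zero hk, comp_C, aeval_C]
    exact ⟨_, rfl⟩
  obtain ⟨c, hc⟩ := exists_scalar_of_leftZero hgh x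
  have h1 : (e * g * e * h * e) x = (e * g * e) ((e * h * e) x) := by
    have hee : e * e = e := by
      refine AlgHom.ext fun a => ?_
      rw [AlgHom.mul_apply, hea a, hea, hπa]
    rw [← AlgHom.mul_apply]
    congr 1
    simp only [mul_assoc]
    rw [← mul_assoc e e, hee]
  rw [h1, hege h, hege g, hπa, hπx, X_comp] at hc
  have h2 := congrArg π hc
  rw [hπa, AlgHom.commutes, algebraMap_eq] at h2
  have h3 := congrArg natDegree h2
  rw [natDegree_comp, natDegree_C, mul_eq_zero] at h3
  exact h3.symm.imp (hconst g) (hconst h)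

open Polynomial in
/-- The image of an idempotent endomorphism with two distinct characters is a polynomial algebra in
one variable, provided that products of elements of its corner monoid that are not left zeros are
not left zeros. -/
theorem exists_generator_of_idempotent
    {f : FreeAlgebra K (Fin n) →ₐ[K] FreeAlgebra K (Fin n)} (hff : f * f = f)
    (hprod : ∀ g h : FreeAlgebra K (Fin n) →ₐ[K] FreeAlgebra K (Fin n),
      (∀ ν, ν * (f * g * f * h * f) = f * g * f * h * f) →
      (∀ ν, ν * (f * g * f) = f * g * f) ∨ (∀ ν, ν * (f * h * f) = f * h * f))
    (hchar : ∃ z z' : FreeAlgebra K (Fin n) →ₐ[K] FreeAlgebra K (Fin n),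
      (∀ ν, ν * z = z) ∧ (∀ ν, ν * z' = z') ∧ z * f ≠ z' * f) :
    ∃ u, f u = u ∧ (∀ a, ∃ G : K[X], f a = aeval u G) ∧
      Function.Injective (aeval u : K[X] →ₐ[K] FreeAlgebra K (Fin n)) := by
  have hf (a) : f (f a) = f a := DFunLike.congr_fun hff a
  -- a homomorphism to `K[X]` that is not constant on the image of `f`
  obtain ⟨γ, a₀, hγ⟩ : ∃ (γ : FreeAlgebra K (Fin n) →ₐ[K] K[X]) (a₀ : _),
      (γ (f a₀)).natDegree ≠ 0 := by
    obtain ⟨z, z', hz, hz', hne⟩ := hchar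
    choose α hα using fun i => exists_scalar_of_leftZero hz (FreeAlgebra.ι K i)
    choose β hβ using fun i => exists_scalar_of_leftZero hz' (FreeAlgebra.ι K i)
    refine ⟨FreeAlgebra.lift K fun i => C (α i) + C (β i - α i) * X, ?_⟩
    set γ : FreeAlgebra K (Fin n) →ₐ[K] K[X] :=
      FreeAlgebra.lift K fun i => C (α i) + C (β i - α i) * X with hγ
    by_contra! hcon
    apply hne
    have h0 : z = (aeval (0 : FreeAlgebra K (Fin n))).comp γ := by
      ext i; simp [hγ, hα]
    have h1 : z' = (aeval (1 : FreeAlgebra K (Fin n))).comp γ := by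
      ext i; simp [hγ, hβ]
    refine AlgHom.ext fun a => ?_
    rw [AlgHom.mul_apply, AlgHom.mul_apply, h0, h1, AlgHom.comp_apply, AlgHom.comp_apply,
      eq_C_of_natDegree_eq_zero (hcon a), aeval_C, aeval_C]
  set r₀ := f a₀ with hr₀
  -- composites of `γ ∘ f` with evaluation at an element of the image of `f`
  have hτ (r) : ∃ g : FreeAlgebra K (Fin n) →ₐ[K] FreeAlgebra K (Fin n),
      ∀ a, g a = aeval r (γ a) := ⟨(aeval r).comp γ, fun a => rfl⟩
  have hfτ (r) (p : K[X]) : f (aeval (f r) p) = aeval (f r) p := by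
    rw [← aeval_algHom_apply, hf]
  have haeval0 (p : K[X]) : aeval (0 : K[X]) p = C (p.eval 0) := by
    rw [← map_zero (algebraMap K K[X]), aeval_algebraMap_apply, coe_aeval_eq_eval, algebraMap_eq]
  have hinj (a) (ha : γ (f a) = 0) : f a = 0 := by
    obtain ⟨g, hg⟩ := hτ r₀
    obtain ⟨h, hh⟩ := hτ (f a)
    have hgf (b) : (f * g * f) b = aeval r₀ (γ (f b)) := by
      rw [AlgHom.mul_apply, AlgHom.mul_apply, hg, hr₀, hfτ]
    have hhf (b) : (f * h * f) b = aeval (f a) (γ (f b)) := by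
      rw [AlgHom.mul_apply, AlgHom.mul_apply, hh, hfτ]
    have hgh : ∀ ν, ν * (f * g * f * h * f) = f * g * f * h * f := by
      refine leftZero_of_exists_scalar fun b => ⟨(γ (f b)).eval 0, ?_⟩
      have h1 : (f * g * f * h * f) b = (f * g) ((f * h * f) b) := rfl
      rw [h1, hhf, AlgHom.mul_apply, hg, hr₀, hfτ, ← aeval_algHom_apply γ, ha, haeval0, aeval_C]
    rcases hprod g h hgh with h1 | h1
    · exfalso
      obtain ⟨c, hc⟩ := exists_scalar_of_leftZero h1 a₀
      rw [hgf] at hc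
      have h2 := congrArg (fun y => (γ y).natDegree) hc
      simp only [← aeval_algHom_apply, AlgHom.commutes, algebraMap_eq, natDegree_C] at h2
      rw [← hr₀, ← comp_eq_aeval, natDegree_comp, mul_self_eq_zero] at h2
      exact hγ h2
    · obtain ⟨c, hc⟩ := exists_scalar_of_leftZero h1 a₀
      rw [hhf, ← hr₀] at hc
      set Q := γ r₀ - C c with hQ
      have hQ0 : Q ≠ 0 := by
        intro h2
        rw [hQ, sub_eq_zero] at h2
        rw [h2, natDegree_C] at hγ
        exact hγ rfl
      have hQr : aeval (f a) Q = 0 := by rw [hQ, map_sub, hc, aeval_C, sub_self]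
      obtain ⟨S, hQS, hS⟩ := exists_eq_pow_rootMultiplicity_mul_and_not_dvd Q hQ0 0
      rw [hQS, map_mul, map_pow, map_sub, aeval_X, aeval_C, map_zero, sub_zero] at hQr
      rcases mul_eq_zero.1 hQr with h2 | h2
      · exact eq_zero_of_pow_eq_zero h2
      · exfalso
        apply hS
        have h3 := congrArg γ h2
        rw [← aeval_algHom_apply, ha, map_zero] at h3
        rwa [haeval0, C_eq_zero, ← IsRoot.def, ← dvd_iff_isRoot] at h3
  -- pass to the commutative polynomial ring
  set ab : FreeAlgebra K (Fin n) →ₐ[K] MvPolynomial (Fin n) K :=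
    FreeAlgebra.lift K MvPolynomial.X with hab
  have habs (p) : ∃ a, ab a = p := by
    induction p using MvPolynomial.induction_on with
    | C c => exact ⟨algebraMap K _ c, by simp [MvPolynomial.algebraMap_eq]⟩
    | add p q hp hq =>
      obtain ⟨a, rfl⟩ := hp
      obtain ⟨b, rfl⟩ := hq
      exact ⟨a + b, map_add _ _ _⟩
    | mul_X p i hp =>
      obtain ⟨a, rfl⟩ := hp
      exact ⟨a * FreeAlgebra.ι K i, by simp [hab]⟩
  set F : MvPolynomial (Fin n) K →ₐ[K] MvPolynomial (Fin n) K :=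
    MvPolynomial.aeval fun i => ab (f (FreeAlgebra.ι K i)) with hF
  set δ : MvPolynomial (Fin n) K →ₐ[K] K[X] :=
    MvPolynomial.aeval fun i => γ (FreeAlgebra.ι K i) with hδ
  have hFab (a) : F (ab a) = ab (f a) := by
    refine DFunLike.congr_fun (f := F.comp ab) (g := ab.comp f) ?_ a
    ext i : 2
    simp [hF, hab]
  have hδab (a) : δ (ab a) = γ a := by
    refine DFunLike.congr_fun (f := δ.comp ab) (g := γ) ?_ a
    ext i : 2
    simp [hδ, hab]
  obtain ⟨v, hv, hgen⟩ := exists_generator_of_retract (MvPolynomial.aeval fun _ => 0) F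
    (fun p => by obtain ⟨a, rfl⟩ := habs p; rw [hFab, hFab, hf]) δ
    (fun p hp => by
      obtain ⟨a, rfl⟩ := habs p
      rw [hFab, hδab] at hp
      rw [hFab, hinj a hp, map_zero])
    ⟨ab a₀, by rwa [hFab, hδab]⟩
  obtain ⟨w, rfl⟩ := habs v
  rw [hFab] at hv
  have hgen' (a) : ∃ G : K[X], f a = aeval (f w) G := by
    obtain ⟨G, hG⟩ := hgen (ab a)
    refine ⟨G, ?_⟩
    have h1 : f (a - aeval (f w) G) = 0 := by
      apply hinj
      rw [← hδab, map_sub, hfτ, map_sub, ← hFab, hG, ← aeval_algHom_apply, hv, sub_self, map_zero]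
    rwa [map_sub, hfτ, sub_eq_zero] at h1
  refine ⟨f w, hf w, hgen', ?_⟩
  have hdeg : (γ (f w)).natDegree ≠ 0 := by
    intro h
    obtain ⟨G, hG⟩ := hgen' a₀
    rw [← hr₀] at hG
    rw [hG, ← aeval_algHom_apply, ← comp_eq_aeval, natDegree_comp, h, mul_zero] at hγ
    exact hγ rfl
  rw [injective_iff_map_eq_zero]
  intro G hG
  have h1 := congrArg γ hG
  rw [← aeval_algHom_apply, ← comp_eq_aeval, map_zero, comp_eq_zero_iff] at h1
  rcases h1 with h1 | ⟨-, h1⟩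
  · exact h1
  · rw [h1, natDegree_C] at hdeg
    exact absurd rfl hdeg

end Idempotents

open Polynomial in
theorem autEnd_quasiInner (hn : 2 ≤ n)
    (Φ : MulAut (FreeAlgebra K (Fin n) →ₐ[K] FreeAlgebra K (Fin n))) :
    IsQuasiInner K n Φ := by
  set i₀ : Fin n := ⟨0, by omega⟩ with hi₀
  set θ : FreeAlgebra K (Fin n) → (FreeAlgebra K (Fin n) →ₐ[K] FreeAlgebra K (Fin n)) :=
    fun a => FreeAlgebra.lift K fun _ => a with hθ
  have hθι (a i) : θ a (FreeAlgebra.ι K i) = a := by simp [hθ]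
  have hνθ (ν : FreeAlgebra K (Fin n) →ₐ[K] FreeAlgebra K (Fin n)) (a) : ν * θ a = θ (ν a) := by
    ext i; simp [hθ]
  set e := θ (FreeAlgebra.ι K i₀) with he
  have hθe (a) : θ a * e = θ a := by rw [he, hνθ, hθι]
  have hνe (ν : FreeAlgebra K (Fin n) →ₐ[K] FreeAlgebra K (Fin n)) :
      ν * e = θ (ν (FreeAlgebra.ι K i₀)) := hνθ _ _
  have hΦ (z : FreeAlgebra K (Fin n) →ₐ[K] FreeAlgebra K (Fin n)) :
      (∀ ν, ν * Φ z = Φ z) ↔ ∀ ν, ν * z = z := by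
    constructor
    · intro h ν
      exact Φ.injective (by rw [map_mul, h])
    · intro h ν
      obtain ⟨ν, rfl⟩ := Φ.surjective ν
      rw [← map_mul, h]
  obtain ⟨u, hu, hgen, hinj⟩ := exists_generator_of_idempotent (f := Φ e)
    (by rw [← map_mul, hθe])
    (fun g h => by
      obtain ⟨g, rfl⟩ := Φ.surjective g
      obtain ⟨h, rfl⟩ := Φ.surjective h
      simp only [← map_mul, hΦ]
      exact leftZero_or_of_lift_const i₀ rfl g h)
    ⟨Φ (θ 0), Φ (θ 1),
      (hΦ _).2 fun ν => by rw [hνθ, map_zero],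
      (hΦ _).2 fun ν => by rw [hνθ, map_one], fun h => by
        rw [← map_mul Φ, ← map_mul Φ, hθe, hθe] at h
        have := DFunLike.congr_fun (Φ.injective h) (FreeAlgebra.ι K i₀)
        rw [hθι, hθι] at this
        exact zero_ne_one this⟩
  choose G hG using fun i => hgen (FreeAlgebra.ι K i)
  have hΦθ (a b) : Φ (θ a) b = Φ (θ a) (Φ e b) := by
    rw [← AlgHom.mul_apply, ← map_mul, hθe]
  have hs_inj : Function.Injective fun a => Φ (θ a) u := by
    intro a b hab
    have h1 : Φ (θ a) = Φ (θ b) := by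
      ext i
      simp only [Function.comp_apply]
      rw [hΦθ a, hΦθ b, hG, ← aeval_algHom_apply, ← aeval_algHom_apply]
      exact congrArg (fun y => aeval y (G i)) hab
    have := DFunLike.congr_fun (Φ.injective h1) (FreeAlgebra.ι K i₀)
    rwa [hθι, hθι] at this
  have hs_surj : Function.Surjective fun a => Φ (θ a) u := by
    intro b
    set ν : FreeAlgebra K (Fin n) →ₐ[K] FreeAlgebra K (Fin n) :=
      FreeAlgebra.lift K fun i => aeval b (G i) with hν
    set ρ : FreeAlgebra K (Fin n) →ₐ[K] K[X] := FreeAlgebra.lift K G with hρ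
    have hνρ (a) : ν a = aeval b (ρ a) := by
      refine DFunLike.congr_fun (f := ν) (g := (aeval b).comp ρ) ?_ a
      ext i; simp [hν, hρ]
    have huρ (a) : Φ e a = aeval u (ρ a) := by
      refine DFunLike.congr_fun (f := Φ e) (g := (aeval u).comp ρ) ?_ a
      ext i; simp [hG, hρ]
    have hρu : ρ u = X := hinj (by rw [← huρ, hu, aeval_X])
    obtain ⟨μ, hμ⟩ := Φ.surjective ν
    refine ⟨μ (FreeAlgebra.ι K i₀), ?_⟩
    change Φ (θ _) u = b
    rw [← hνe, map_mul, AlgHom.mul_apply, hu, hμ, hνρ, hρu, aeval_X]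
  have hs_bij : Function.Bijective fun a => Φ (θ a) u := ⟨hs_inj, hs_surj⟩
  refine ⟨Equiv.ofBijective _ hs_bij, fun ν a => ?_⟩
  obtain ⟨b, rfl⟩ := (Equiv.ofBijective _ hs_bij).surjective a
  rw [Equiv.symm_apply_apply, Equiv.ofBijective_apply, Equiv.ofBijective_apply, ← hνθ, map_mul,
    AlgHom.mul_apply]

end Stmt1
end

section
/- If Φ is a quasi-inner automorphism of End A, then Φ is either a semi-inner automorphism, a mirror automorphism, or a composition of a semi-inner and a mirror automorphism of End A. -/
/-!
Statement 2: If `Φ` is a quasi-inner automorphism of `End A` for the free associative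
algebra `A = K⟨x₁,…,xₙ⟩` (`n ≥ 2`), then `Φ` is either semi-inner, or mirror, or a
composition of a semi-inner and a mirror automorphism.
-/

namespace Stmt2

variable (K : Type*) [Field K] (n : ℕ)

/-- `s` is an adjoint bijection for `Φ`, i.e. `Φ ν = s ∘ ν ∘ s⁻¹` as set maps. -/
def IsAdjoint (Φ : MulAut (FreeAlgebra K (Fin n) →ₐ[K] FreeAlgebra K (Fin n)))
    (s : FreeAlgebra K (Fin n) ≃ FreeAlgebra K (Fin n)) : Prop :=
  ∀ (ν : FreeAlgebra K (Fin n) →ₐ[K] FreeAlgebra K (Fin n)) (a : FreeAlgebra K (Fin n)),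
    Φ ν a = s (ν (s.symm a))

/-- `Φ` is quasi-inner: it has an adjoint bijection. -/
def IsQuasiInner (Φ : MulAut (FreeAlgebra K (Fin n) →ₐ[K] FreeAlgebra K (Fin n))) : Prop :=
  ∃ s : FreeAlgebra K (Fin n) ≃ FreeAlgebra K (Fin n), IsAdjoint K n Φ s

/-- `Φ` is semi-inner: quasi-inner with an adjoint bijection which is additive,
multiplicative and semilinear over some field automorphism of `K`. -/
def IsSemiInner (Φ : MulAut (FreeAlgebra K (Fin n) →ₐ[K] FreeAlgebra K (Fin n))) : Prop :=
  ∃ s : FreeAlgebra K (Fin n) ≃ FreeAlgebra K (Fin n), IsAdjoint K n Φ s ∧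
    (∀ a b : FreeAlgebra K (Fin n), s (a + b) = s a + s b) ∧
    (∀ a b : FreeAlgebra K (Fin n), s (a * b) = s a * s b) ∧
    ∃ φ : K ≃+* K, ∀ (α : K) (a : FreeAlgebra K (Fin n)), s (α • a) = φ α • s a

/-- `Φ` is mirror: quasi-inner with an adjoint bijection which is an
anti-automorphism of `A`. -/
def IsMirror (Φ : MulAut (FreeAlgebra K (Fin n) →ₐ[K] FreeAlgebra K (Fin n))) : Prop :=
  ∃ s : FreeAlgebra K (Fin n) ≃ FreeAlgebra K (Fin n), IsAdjoint K n Φ s ∧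
    (∀ a b : FreeAlgebra K (Fin n), s (a + b) = s a + s b) ∧
    (∀ a b : FreeAlgebra K (Fin n), s (a * b) = s b * s a)

section FreeAlgebraWords

variable {F : Type*} [Field F] {X : Type*}

/-- The coefficient of a word in an element of the free algebra. -/
noncomputable def wordCoeff (u : List X) : FreeAlgebra F X →ₗ[F] F where
  toFun a := (FreeAlgebra.equivMonoidAlgebraFreeMonoid a).coeff (FreeMonoid.ofList u)
  map_add' a b := by simp
  map_smul' c a := by simp

lemma wordCoeff_ext {a b : FreeAlgebra F X} (h : ∀ u, wordCoeff u a = wordCoeff u b) :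
    a = b := by
  apply FreeAlgebra.equivMonoidAlgebraFreeMonoid.injective
  ext u
  exact h (FreeMonoid.toList u)

@[simp] lemma wordCoeff_nil_algebraMap (c : F) :
    wordCoeff ([] : List X) (algebraMap F (FreeAlgebra F X) c) = c := by
  simp [wordCoeff]

@[simp] lemma wordCoeff_cons_algebraMap (c : F) (i : X) (u : List X) :
    wordCoeff (i :: u) (algebraMap F (FreeAlgebra F X) c) = 0 := by
  simp [wordCoeff]

@[simp] lemma wordCoeff_nil_one : wordCoeff ([] : List X) (1 : FreeAlgebra F X) = 1 := by
  simpa using wordCoeff_nil_algebraMap (X := X) (1 : F)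

@[simp] lemma wordCoeff_cons_one (i : X) (u : List X) :
    wordCoeff (i :: u) (1 : FreeAlgebra F X) = 0 := by
  simpa using wordCoeff_cons_algebraMap (1 : F) i u

lemma equiv_ι_mul (i : X) (a : FreeAlgebra F X) :
    FreeAlgebra.equivMonoidAlgebraFreeMonoid (FreeAlgebra.ι F i * a) =
      MonoidAlgebra.single (FreeMonoid.of i) 1 * FreeAlgebra.equivMonoidAlgebraFreeMonoid a := by
  simp [FreeAlgebra.equivMonoidAlgebraFreeMonoid, MonoidAlgebra.of_apply]

@[simp] lemma wordCoeff_nil_ι_mul (i : X) (a : FreeAlgebra F X) :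
    wordCoeff [] (FreeAlgebra.ι F i * a) = 0 := by
  change (FreeAlgebra.equivMonoidAlgebraFreeMonoid (FreeAlgebra.ι F i * a)).coeff _ = 0
  rw [equiv_ι_mul]
  apply MonoidAlgebra.coeff_single_mul_of_forall_mul_ne
  intro d h
  exact List.cons_ne_nil _ _ (congrArg FreeMonoid.toList h)

@[simp] lemma wordCoeff_cons_ι_mul [DecidableEq X] (i j : X) (u : List X)
    (a : FreeAlgebra F X) :
    wordCoeff (j :: u) (FreeAlgebra.ι F i * a) = if i = j then wordCoeff u a else 0 := by
  change (FreeAlgebra.equivMonoidAlgebraFreeMonoid (FreeAlgebra.ι F i * a)).coeff _ = _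
  rw [equiv_ι_mul]
  split_ifs with hij
  · subst hij
    rw [MonoidAlgebra.coeff_single_mul_eq_mul_coeff (m₂ := FreeMonoid.ofList u), one_mul]
    · rfl
    · intro m _
      exact mul_right_inj (FreeMonoid.of i)
  · apply MonoidAlgebra.coeff_single_mul_of_forall_mul_ne
    intro d h
    exact hij (List.cons.inj (congrArg FreeMonoid.toList h)).1

@[simp] lemma wordCoeff_nil_ι (i : X) : wordCoeff [] (FreeAlgebra.ι F i) = 0 := by
  simpa using wordCoeff_nil_ι_mul i (1 : FreeAlgebra F X)

@[simp] lemma wordCoeff_cons_ι [DecidableEq X] (i j : X) (u : List X) :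
    wordCoeff (j :: u) (FreeAlgebra.ι F i) =
      if i = j then wordCoeff u (1 : FreeAlgebra F X) else 0 := by
  simpa using wordCoeff_cons_ι_mul i j u (1 : FreeAlgebra F X)

/-- Splitting off the first letter of every word. -/
lemma exists_eq_add_sum_ι_mul [Fintype X] (a : FreeAlgebra F X) :
    ∃ (c : F) (d : X → FreeAlgebra F X),
      a = algebraMap F _ c + ∑ i, FreeAlgebra.ι F i * d i := by
  classical
  induction a using FreeAlgebra.induction with
  | grade0 r => exact ⟨r, 0, by simp⟩
  | grade1 x => exact ⟨0, Pi.single x 1, by simp [Pi.single_apply]⟩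
  | mul a b ha hb =>
    obtain ⟨c, d, rfl⟩ := ha
    obtain ⟨c', d', rfl⟩ := hb
    refine ⟨c * c', fun i => c • d' i + d i * (algebraMap F _ c' + ∑ i, FreeAlgebra.ι F i * d' i),
      ?_⟩
    rw [add_mul]
    conv_lhs => rw [mul_add]
    simp only [mul_add, Finset.sum_add_distrib, Finset.sum_mul, map_mul,
      Finset.mul_sum, Algebra.smul_def, mul_assoc]
    simp only [add_assoc]
    simp only [Algebra.left_comm]
    congr 3
    exact Finset.sum_comm
  | add a b ha hb =>
    obtain ⟨c, d, rfl⟩ := ha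
    obtain ⟨c', d', rfl⟩ := hb
    refine ⟨c + c', d + d', ?_⟩
    simp only [map_add, Pi.add_apply, mul_add, Finset.sum_add_distrib]
    abel

lemma wordCoeff_nil_add_sum [Fintype X] (c : F) (d : X → FreeAlgebra F X) :
    wordCoeff [] (algebraMap F _ c + ∑ i, FreeAlgebra.ι F i * d i) = c := by
  simp

lemma wordCoeff_cons_add_sum [Fintype X] (c : F) (d : X → FreeAlgebra F X) (j : X)
    (u : List X) :
    wordCoeff (j :: u) (algebraMap F _ c + ∑ i, FreeAlgebra.ι F i * d i) =
      wordCoeff u (d j) := by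
  classical
  simp

/-- Evaluation of an element of the free algebra as a combination of words. -/
lemma lift_eq_sum_words {B : Type*} [Ring B] [Algebra F B] (f : X → B) (a : FreeAlgebra F X) :
    ∃ S : Finset (List X), (∀ u ∈ S, wordCoeff u a ≠ 0) ∧
      FreeAlgebra.lift F f a = ∑ u ∈ S, wordCoeff u a • (u.map f).prod := by
  classical
  refine ⟨(FreeAlgebra.equivMonoidAlgebraFreeMonoid a).coeff.support.map
    ⟨FreeMonoid.toList, FreeMonoid.toList.injective⟩, ?_, ?_⟩
  · intro u hu
    obtain ⟨v, hv, rfl⟩ := Finset.mem_map.1 hu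
    exact Finsupp.mem_support_iff.1 hv
  · have key : (FreeAlgebra.lift F f) = (MonoidAlgebra.lift F B (FreeMonoid X)
        (FreeMonoid.lift f)).comp
          (FreeAlgebra.equivMonoidAlgebraFreeMonoid (R := F) (X := X)).toAlgHom := by
      ext i
      simp [FreeAlgebra.equivMonoidAlgebraFreeMonoid]
    rw [key]
    simp only [AlgHom.comp_apply, Finset.sum_map]
    rw [MonoidAlgebra.lift_apply]
    simp only [FreeMonoid.lift_apply]
    rfl

end FreeAlgebraWords

section AssociativeSubstitution

variable {F : Type*} [Field F]

lemma map_lift_pair {B B' : Type*} [Ring B] [Ring B'] [Algebra F B] [Algebra F B']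
    (g : B →ₐ[F] B') (a b : B) (p : FreeAlgebra F (Fin 2)) :
    g (FreeAlgebra.lift F ![a, b] p) = FreeAlgebra.lift F ![g a, g b] p := by
  have : g.comp (FreeAlgebra.lift F ![a, b]) = FreeAlgebra.lift F ![g a, g b] := by
    ext i; fin_cases i <;> simp
  exact DFunLike.congr_fun this p

lemma eq_zero_of_algebraMap_add_sum_eq_zero {X : Type*} [Fintype X] {c : F}
    {d : X → FreeAlgebra F X} (h : algebraMap F _ c + ∑ i, FreeAlgebra.ι F i * d i = 0) :
    c = 0 ∧ d = 0 := by
  refine ⟨?_, funext fun j => wordCoeff_ext fun u => ?_⟩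
  · rw [← wordCoeff_nil_add_sum c d, h, map_zero]
  · rw [← wordCoeff_cons_add_sum c d, h, map_zero, Pi.zero_apply, map_zero]

/-- Elements `f i` of an algebra are free generators of a subalgebra as soon as they, together
with the scalars, are right independent. -/
lemma lift_injective_of_independent {X B : Type*} [Fintype X] [Ring B] [Algebra F B]
    (f : X → B)
    (hf : ∀ (c : F) (d : X → B), algebraMap F B c + ∑ i, f i * d i = 0 → c = 0 ∧ d = 0) :
    Function.Injective (FreeAlgebra.lift F f) := by
  rw [injective_iff_map_eq_zero]
  intro a ha
  refine wordCoeff_ext fun u => ?_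
  rw [map_zero]
  induction u generalizing a with
  | nil =>
    obtain ⟨c, d, rfl⟩ := exists_eq_add_sum_ι_mul a
    simp only [map_add, map_sum, map_mul, AlgHom.commutes, FreeAlgebra.lift_ι_apply] at ha
    rw [wordCoeff_nil_add_sum]
    exact (hf _ _ ha).1
  | cons j u ih =>
    obtain ⟨c, d, rfl⟩ := exists_eq_add_sum_ι_mul a
    simp only [map_add, map_sum, map_mul, AlgHom.commutes, FreeAlgebra.lift_ι_apply] at ha
    rw [wordCoeff_cons_add_sum]
    exact ih _ (congrFun (hf _ _ ha).2 j)

open Polynomial in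
lemma degree_add_sum_C_ι_mul {X : Type*} [Fintype X] (c : F) (d : X → (FreeAlgebra F X)[X]) :
    (c ≠ 0 → 0 ≤ degree (algebraMap F _ c + ∑ i, C (FreeAlgebra.ι F i) * d i)) ∧
      ∀ j, degree (d j) ≤ degree (algebraMap F _ c + ∑ i, C (FreeAlgebra.ι F i) * d i) := by
  have hcoeff : ∀ k, (algebraMap F _ c + ∑ i, C (FreeAlgebra.ι F i) * d i).coeff k =
      algebraMap F _ (if k = 0 then c else 0) + ∑ i, FreeAlgebra.ι F i * (d i).coeff k := by
    intro k
    rw [Polynomial.algebraMap_apply, coeff_add, finsetSum_coeff, coeff_C]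
    simp only [coeff_C_mul]
    split_ifs <;> simp
  refine ⟨fun hc => ?_, fun j => degree_mono fun k hk => ?_⟩
  · refine le_degree_of_ne_zero (n := 0) fun h => hc ?_
    rw [hcoeff] at h
    simpa using (eq_zero_of_algebraMap_add_sum_eq_zero h).1
  · rw [mem_support_iff] at hk ⊢
    intro h
    rw [hcoeff] at h
    exact hk (congrFun (eq_zero_of_algebraMap_add_sum_eq_zero h).2 j)

open Polynomial in
/-- A lower bound for the degree of `p(a, w)` when no cancellation is possible between
scalars, left multiples of `a` and left multiples of `w`. -/
lemma le_degree_lift_of_separated {B : Type*} [Ring B] [Algebra F B] {a w : B[X]} {e : ℕ}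
    (sep : ∀ (c : F) (d₀ d₁ : B[X]),
      (c ≠ 0 → 0 ≤ degree (algebraMap F _ c + (a * d₀ + w * d₁))) ∧
      degree d₀ ≤ degree (algebraMap F _ c + (a * d₀ + w * d₁)) ∧
      e + degree d₁ ≤ degree (algebraMap F _ c + (a * d₀ + w * d₁)))
    (u : List (Fin 2)) (p : FreeAlgebra F (Fin 2)) (hu : wordCoeff u p ≠ 0) :
    ((e * u.count 1 : ℕ) : WithBot ℕ) ≤ degree (FreeAlgebra.lift F ![a, w] p) := by
  induction u generalizing p with
  | nil =>
    obtain ⟨c, d, rfl⟩ := exists_eq_add_sum_ι_mul p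
    rw [wordCoeff_nil_add_sum] at hu
    simpa [Fin.sum_univ_two] using
      (sep c (FreeAlgebra.lift F ![a, w] (d 0)) (FreeAlgebra.lift F ![a, w] (d 1))).1 hu
  | cons j u ih =>
    obtain ⟨c, d, rfl⟩ := exists_eq_add_sum_ι_mul p
    rw [wordCoeff_cons_add_sum] at hu
    have hs := sep c (FreeAlgebra.lift F ![a, w] (d 0)) (FreeAlgebra.lift F ![a, w] (d 1))
    have hev : FreeAlgebra.lift F ![a, w] (algebraMap F _ c + ∑ i, FreeAlgebra.ι F i * d i) =
        algebraMap F _ c + (a * FreeAlgebra.lift F ![a, w] (d 0) +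
          w * FreeAlgebra.lift F ![a, w] (d 1)) := by
      simp [Fin.sum_univ_two]
    rw [hev]
    have h := ih _ hu
    match j with
    | 0 => simpa using h.trans hs.2.1
    | 1 =>
      refine le_trans ?_ hs.2.2
      rw [List.count_cons_self, mul_add, mul_one, add_comm, Nat.cast_add]
      exact add_le_add le_rfl h

open Polynomial in
lemma natDegree_lift_le {B : Type*} [Ring B] [Algebra F B] (q z : B) {N : ℕ}
    (p : FreeAlgebra F (Fin 2)) (hp : ∀ u, wordCoeff u p ≠ 0 → u.count 1 ≤ N) :
    natDegree (FreeAlgebra.lift F ![C q, X * C z] p) ≤ N := by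
  obtain ⟨S, hS, h⟩ := lift_eq_sum_words ![C q, X * C z] p
  rw [h]
  refine natDegree_sum_le_of_forall_le _ _ fun u hu =>
    (natDegree_smul_le _ _).trans (le_trans ?_ (hp u (hS u hu)))
  clear hu
  induction u with
  | nil => simp
  | cons j u ih =>
    rw [List.map_cons, List.prod_cons]
    refine natDegree_mul_le.trans ?_
    match j with
    | 0 => simpa using ih
    | 1 =>
      have : natDegree (X * C z) ≤ 1 := 
        natDegree_mul_le.trans (add_le_add natDegree_X_le (natDegree_C z).le)
      simp only [List.count_cons_self]
      change natDegree (X * C z) + _ ≤ _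
      omega

open Polynomial in
/-- If substitution into `p(x, y)` is associative, then every word of `p` contains at most one
letter `y`. -/
lemma count_one_le_one_of_assoc (p : FreeAlgebra F (Fin 2)) (hp : wordCoeff [] p = 0)
    (hassoc : ∀ a b c : FreeAlgebra F (Fin 3),
      FreeAlgebra.lift F ![a, FreeAlgebra.lift F ![b, c] p] p =
        FreeAlgebra.lift F ![FreeAlgebra.lift F ![a, b] p, c] p)
    (u : List (Fin 2)) (hu : wordCoeff u p ≠ 0) : u.count 1 ≤ 1 := by
  classical
  -- a word of `p` with the maximal number of letters `y`
  obtain ⟨v, hv, hmax⟩ : ∃ v, wordCoeff v p ≠ 0 ∧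
      ∀ u, wordCoeff u p ≠ 0 → u.count 1 ≤ v.count 1 := by
    have hfin : (Set.image (fun u : List (Fin 2) => u.count 1)
        {u | wordCoeff u p ≠ 0}).Finite := by
      refine Set.Finite.image _ (Set.Finite.subset
        ((FreeAlgebra.equivMonoidAlgebraFreeMonoid p).coeff.support.finite_toSet.image
          FreeMonoid.toList) ?_)
      intro u hu
      exact ⟨FreeMonoid.ofList u, by simpa [wordCoeff] using hu, rfl⟩
    obtain ⟨m, ⟨v, hv, rfl⟩, hm⟩ := hfin.exists_maximal ⟨_, u, hu, rfl⟩
    refine ⟨v, hv, fun u hu => ?_⟩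
    by_contra hlt
    exact hlt (hm ⟨u, hu, rfl⟩ (le_of_not_ge hlt))
  refine (hmax u hu).trans ?_
  set N := v.count 1 with hN
  set x : FreeAlgebra F (Fin 3) := FreeAlgebra.ι F 0
  set y : FreeAlgebra F (Fin 3) := FreeAlgebra.ι F 1
  set z : FreeAlgebra F (Fin 3) := FreeAlgebra.ι F 2
  have indep : ∀ (c : F) (d₀ d₁ d₂ : (FreeAlgebra F (Fin 3))[X]),
      (c ≠ 0 → 0 ≤ degree (algebraMap F _ c + (C x * d₀ + C y * d₁ + C z * d₂))) ∧
      degree d₀ ≤ degree (algebraMap F _ c + (C x * d₀ + C y * d₁ + C z * d₂)) ∧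
      degree d₁ ≤ degree (algebraMap F _ c + (C x * d₀ + C y * d₁ + C z * d₂)) ∧
      degree d₂ ≤ degree (algebraMap F _ c + (C x * d₀ + C y * d₁ + C z * d₂)) := by
    intro c d₀ d₁ d₂
    have h := degree_add_sum_C_ι_mul c ![d₀, d₁, d₂]
    simp only [Fin.sum_univ_three] at h
    exact ⟨h.1, h.2 0, h.2 1, h.2 2⟩
  set w : (FreeAlgebra F (Fin 3))[X] := FreeAlgebra.lift F ![C y, X * C z] p with hw
  have hwdeg : (N : WithBot ℕ) ≤ degree w := by
    have := le_degree_lift_of_separated (a := C y) (w := X * C z) (e := 1) (fun c d₀ d₁ => by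
      have h := indep c 0 d₀ (X * d₁)
      have e1 : X * C z * d₁ = C z * (X * d₁) := by
        rw [X_mul, mul_assoc]
      rw [mul_zero, zero_add, ← e1] at h
      refine ⟨h.1, h.2.2.1, le_trans (le_of_eq ?_) h.2.2.2⟩
      rw [degree_mul, degree_X]; rfl) v p hv
    rwa [one_mul] at this
  obtain ⟨r, t, hrt⟩ : ∃ r t, w = C y * r + C z * t := by
    obtain ⟨c, d, rfl⟩ := exists_eq_add_sum_ι_mul p
    rw [wordCoeff_nil_add_sum] at hp
    subst hp
    refine ⟨FreeAlgebra.lift F ![C y, X * C z] (d 0),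
      X * FreeAlgebra.lift F ![C y, X * C z] (d 1), ?_⟩
    simp [hw, Fin.sum_univ_two, mul_assoc]
  have hlow : ((N * N : ℕ) : WithBot ℕ) ≤ degree (FreeAlgebra.lift F ![C x, w] p) := by
    refine le_degree_lift_of_separated (fun c d₀ d₁ => ?_) v p hv
    have h := indep c d₀ (r * d₁) (t * d₁)
    have e1 : C x * d₀ + C y * (r * d₁) + C z * (t * d₁) = C x * d₀ + w * d₁ := by
      rw [hrt]; noncomm_ring
    rw [e1, degree_mul, degree_mul] at h
    refine ⟨h.1, h.2.1, ?_⟩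
    have hmax : degree w ≤ max (degree r) (degree t) := by
      rw [hrt]
      refine (degree_add_le _ _).trans (max_le_max ?_ ?_)
      · exact (degree_mul_le _ _).trans (by simpa using add_le_add_left degree_C_le (degree r))
      · exact (degree_mul_le _ _).trans (by simpa using add_le_add_left degree_C_le (degree t))
    rcases le_max_iff.1 (hwdeg.trans hmax) with h' | h'
    · exact (add_le_add h' le_rfl).trans h.2.2.1
    · exact (add_le_add h' le_rfl).trans h.2.2.2
  -- transport associativity along `x ↦ x, y ↦ y, z ↦ X z`
  have heq : FreeAlgebra.lift F ![C x, w] p =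
      FreeAlgebra.lift F ![C (FreeAlgebra.lift F ![x, y] p), X * C z] p := by
    have h := congrArg (FreeAlgebra.lift F ![C x, C y, X * C z]) (hassoc x y z)
    rw [map_lift_pair, map_lift_pair, map_lift_pair, map_lift_pair] at h
    have hx : FreeAlgebra.lift F ![C x, C y, X * C z] x = C x := by simp [x]
    have hy : FreeAlgebra.lift F ![C x, C y, X * C z] y = C y := by simp [y]
    have hz : FreeAlgebra.lift F ![C x, C y, X * C z] z = X * C z := by simp [z]
    rw [hx, hy, hz] at h
    have hC := map_lift_pair (Polynomial.CAlgHom (R := F) (A := FreeAlgebra F (Fin 3))) x y p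
    simp only [Polynomial.CAlgHom_apply] at hC
    rw [hC, ← h]
  rw [heq] at hlow
  have hup := natDegree_lift_le (FreeAlgebra.lift F ![x, y] p) z p hmax
  have hNN : N * N ≤ N := by
    have := hlow.trans (degree_le_of_natDegree_le hup)
    exact_mod_cast this
  nlinarith

lemma lift_pair_swap {B : Type*} [Ring B] [Algebra F B] (a b : B) (p : FreeAlgebra F (Fin 2)) :
    FreeAlgebra.lift F ![a, b] (FreeAlgebra.lift F ![FreeAlgebra.ι F 1, FreeAlgebra.ι F 0] p) =
      FreeAlgebra.lift F ![b, a] p := by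
  rw [map_lift_pair]
  simp

lemma wordCoeff_map_swap (u : List (Fin 2)) (p : FreeAlgebra F (Fin 2)) :
    wordCoeff (u.map (Equiv.swap 0 1))
      (FreeAlgebra.lift F ![FreeAlgebra.ι F 1, FreeAlgebra.ι F 0] p) = wordCoeff u p := by
  induction u generalizing p with
  | nil =>
    obtain ⟨c, d, rfl⟩ := exists_eq_add_sum_ι_mul p
    rw [wordCoeff_nil_add_sum]
    simp [Fin.sum_univ_two]
  | cons j u ih =>
    obtain ⟨c, d, rfl⟩ := exists_eq_add_sum_ι_mul p
    rw [wordCoeff_cons_add_sum, ← ih]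
    fin_cases j <;> simp [Fin.sum_univ_two]

lemma count_zero_le_one_of_assoc (p : FreeAlgebra F (Fin 2)) (hp : wordCoeff [] p = 0)
    (hassoc : ∀ a b c : FreeAlgebra F (Fin 3),
      FreeAlgebra.lift F ![a, FreeAlgebra.lift F ![b, c] p] p =
        FreeAlgebra.lift F ![FreeAlgebra.lift F ![a, b] p, c] p)
    (u : List (Fin 2)) (hu : wordCoeff u p ≠ 0) : u.count 0 ≤ 1 := by
  have h := count_one_le_one_of_assoc
    (FreeAlgebra.lift F ![FreeAlgebra.ι F 1, FreeAlgebra.ι F 0] p)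
    (by rw [← hp, ← wordCoeff_map_swap [] p]; rfl)
    (fun a b c => by simp only [lift_pair_swap]; exact (hassoc c b a).symm)
    (u.map (Equiv.swap 0 1)) (by rwa [wordCoeff_map_swap])
  have := List.count_map_of_injective u _ (Equiv.swap (0 : Fin 2) 1).injective 0
  rw [Equiv.swap_apply_left] at this
  rwa [this] at h

lemma eq_of_assoc (p : FreeAlgebra F (Fin 2)) (hp : wordCoeff [] p = 0)
    (hassoc : ∀ a b c : FreeAlgebra F (Fin 3),
      FreeAlgebra.lift F ![a, FreeAlgebra.lift F ![b, c] p] p =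
        FreeAlgebra.lift F ![FreeAlgebra.lift F ![a, b] p, c] p) :
    ∃ α β γ δ : F, p = α • FreeAlgebra.ι F 0 + β • FreeAlgebra.ι F 1 +
      γ • (FreeAlgebra.ι F 0 * FreeAlgebra.ι F 1) +
      δ • (FreeAlgebra.ι F 1 * FreeAlgebra.ι F 0) := by
  have h0 := count_zero_le_one_of_assoc p hp hassoc
  have h1 := count_one_le_one_of_assoc p hp hassoc
  refine ⟨wordCoeff [0] p, wordCoeff [1] p, wordCoeff [0, 1] p, wordCoeff [1, 0] p,
    wordCoeff_ext fun u => ?_⟩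
  match u with
  | [] => simp [hp]
  | [i] => fin_cases i <;> simp
  | [i, j] =>
    fin_cases i <;> fin_cases j <;> simp
    · by_contra h
      simpa using h0 _ h
    · by_contra h
      simpa using h1 _ h
  | i :: j :: k :: l =>
    have : wordCoeff (i :: j :: k :: l) p = 0 := by
      by_contra h
      have h0 := h0 _ h
      have h1 := h1 _ h
      fin_cases i <;> fin_cases j <;> fin_cases k <;> simp at h0 h1
    rw [this]
    simp

/-- Associativity of a substitution can be tested in any free algebra of rank at least two. -/
lemma assoc_of_assoc {n : ℕ} (hn : 2 ≤ n) (p : FreeAlgebra F (Fin 2))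
    (hassoc : ∀ a b c : FreeAlgebra F (Fin n),
      FreeAlgebra.lift F ![a, FreeAlgebra.lift F ![b, c] p] p =
        FreeAlgebra.lift F ![FreeAlgebra.lift F ![a, b] p, c] p)
    (a b c : FreeAlgebra F (Fin 3)) :
    FreeAlgebra.lift F ![a, FreeAlgebra.lift F ![b, c] p] p =
        FreeAlgebra.lift F ![FreeAlgebra.lift F ![a, b] p, c] p := by
  obtain ⟨m, rfl⟩ := Nat.exists_eq_add_of_le' hn
  set x : FreeAlgebra F (Fin (m + 2)) := FreeAlgebra.ι F 0 with hx
  set y : FreeAlgebra F (Fin (m + 2)) := FreeAlgebra.ι F 1 with hy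
  have indep : ∀ (c : F) (d₀ d₁ : FreeAlgebra F (Fin (m + 2))),
      algebraMap F _ c + (x * d₀ + y * d₁) = 0 → c = 0 ∧ d₀ = 0 ∧ d₁ = 0 := by
    intro c d₀ d₁ h
    have h' := eq_zero_of_algebraMap_add_sum_eq_zero (c := c)
      (d := Fin.cons d₀ (Fin.cons d₁ 0)) (by
        rw [Fin.sum_univ_succ, Fin.sum_univ_succ]
        simpa using h)
    exact ⟨h'.1, congrFun h'.2 0, congrFun h'.2 1⟩
  have hinj := lift_injective_of_independent (F := F) ![x, y * x, y * y] (fun c d h => by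
    have h' := indep c (d 0) (x * d 1 + y * d 2) (by
      rw [← h, Fin.sum_univ_three]
      simp
      noncomm_ring)
    have h'' := indep 0 (d 1) (d 2) (by simpa using h'.2.2)
    refine ⟨h'.1, funext fun i => ?_⟩
    fin_cases i
    exacts [h'.2.1, h''.2.1, h''.2.2])
  apply hinj
  simp only [map_lift_pair]
  exact hassoc _ _ _

lemma lift_pair_eq {p : FreeAlgebra F (Fin 2)} {α β γ δ : F}
    (hp : p = α • FreeAlgebra.ι F 0 + β • FreeAlgebra.ι F 1 +
      γ • (FreeAlgebra.ι F 0 * FreeAlgebra.ι F 1) +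
      δ • (FreeAlgebra.ι F 1 * FreeAlgebra.ι F 0))
    {B : Type*} [Ring B] [Algebra F B] (a b : B) :
    FreeAlgebra.lift F ![a, b] p = α • a + β • b + γ • (a * b) + δ • (b * a) := by
  subst hp
  simp

lemma lift_pair_zero_zero {B : Type*} [Ring B] [Algebra F B] (p : FreeAlgebra F (Fin 2)) :
    FreeAlgebra.lift F ![(0 : B), 0] p = algebraMap F B (wordCoeff [] p) := by
  obtain ⟨c, d, rfl⟩ := exists_eq_add_sum_ι_mul p
  rw [wordCoeff_nil_add_sum]
  simp [Fin.sum_univ_two]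

/-- An associative operation given by substitution, with two-sided zero `0` and unit `1`, is the
multiplication or the opposite multiplication. -/
lemma lift_pair_eq_mul_or_of_assoc {n : ℕ} (hn : 2 ≤ n) (p : FreeAlgebra F (Fin 2))
    (hassoc : ∀ a b c : FreeAlgebra F (Fin n),
      FreeAlgebra.lift F ![a, FreeAlgebra.lift F ![b, c] p] p =
        FreeAlgebra.lift F ![FreeAlgebra.lift F ![a, b] p, c] p)
    (hzero : ∀ a : FreeAlgebra F (Fin n), FreeAlgebra.lift F ![a, 0] p = 0)
    (zeroh : ∀ a : FreeAlgebra F (Fin n), FreeAlgebra.lift F ![0, a] p = 0)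
    (hone : ∀ a : FreeAlgebra F (Fin n), FreeAlgebra.lift F ![a, 1] p = a) :
    (∀ a b : FreeAlgebra F (Fin n), FreeAlgebra.lift F ![a, b] p = a * b) ∨
      (∀ a b : FreeAlgebra F (Fin n), FreeAlgebra.lift F ![a, b] p = b * a) := by
  have hp : wordCoeff [] p = 0 := by
    have h := hzero 0
    rw [lift_pair_zero_zero] at h
    simpa using h
  obtain ⟨α, β, γ, δ, hp⟩ := eq_of_assoc p hp (assoc_of_assoc hn p hassoc)
  simp only [lift_pair_eq hp] at *
  obtain ⟨m, rfl⟩ := Nat.exists_eq_add_of_le' hn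
  have hα : α = 0 := by simpa using congrArg (wordCoeff []) (hzero 1)
  have hβ : β = 0 := by simpa using congrArg (wordCoeff []) (zeroh 1)
  subst hα hβ
  have hγδ : γ + δ = 1 := by simpa using congrArg (wordCoeff []) (hone 1)
  have hγδ' : γ = 0 ∨ δ = 0 := by
    have h := congrArg (wordCoeff [0, 0, 1])
      (hassoc (FreeAlgebra.ι F 0) (FreeAlgebra.ι F 0) (FreeAlgebra.ι F 1))
    simpa [mul_add, add_mul, mul_assoc] using h
  rcases hγδ' with rfl | rfl
  · right
    have : δ = 1 := by simpa using hγδ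
    simp [this]
  · left
    have : γ = 1 := by simpa using hγδ
    simp [this]

/-- A commutative associative operation given by substitution, with neutral element `0`, is the
addition. -/
lemma lift_pair_eq_add_of_assoc {n : ℕ} (hn : 2 ≤ n) (p : FreeAlgebra F (Fin 2))
    (hassoc : ∀ a b c : FreeAlgebra F (Fin n),
      FreeAlgebra.lift F ![a, FreeAlgebra.lift F ![b, c] p] p =
        FreeAlgebra.lift F ![FreeAlgebra.lift F ![a, b] p, c] p)
    (hcomm : ∀ a b : FreeAlgebra F (Fin n),
      FreeAlgebra.lift F ![a, b] p = FreeAlgebra.lift F ![b, a] p)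
    (hzero : ∀ a : FreeAlgebra F (Fin n), FreeAlgebra.lift F ![a, 0] p = a)
    (a b : FreeAlgebra F (Fin n)) : FreeAlgebra.lift F ![a, b] p = a + b := by
  have hp : wordCoeff [] p = 0 := by
    have h := hzero 0
    rw [lift_pair_zero_zero] at h
    simpa using h
  obtain ⟨α, β, γ, δ, hp⟩ := eq_of_assoc p hp (assoc_of_assoc hn p hassoc)
  simp only [lift_pair_eq hp] at *
  obtain ⟨m, rfl⟩ := Nat.exists_eq_add_of_le' hn
  have hα : α = 1 := by simpa using congrArg (wordCoeff []) (hzero 1)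
  have hβ : β = 1 := by
    have h := hcomm 1 0
    simp only [mul_zero, zero_mul, smul_zero, zero_add, add_zero] at h
    simpa [hα] using (congrArg (wordCoeff []) h).symm
  subst hα hβ
  have hγδ : γ = δ := by
    have h := congrArg (wordCoeff [0, 1]) (hcomm (FreeAlgebra.ι F 0) (FreeAlgebra.ι F 1))
    simpa using h
  subst hγδ
  have hγ : γ = 0 := by
    have h := congrArg (wordCoeff [0, 0, 1])
      (hassoc (FreeAlgebra.ι F 0) (FreeAlgebra.ι F 0) (FreeAlgebra.ι F 1))
    simpa [mul_add, add_mul, mul_assoc] using h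
  simp [hγ]

end AssociativeSubstitution

section SubstitutionBijection

variable {F : Type*} [Field F] {n : ℕ}

/-- A substitution-preserving bijection carries substitution into a polynomial in two variables
to substitution into another one. -/
lemma exists_lift_pair_eq (hn : 2 ≤ n) {s : FreeAlgebra F (Fin n) ≃ FreeAlgebra F (Fin n)}
    (hs : ∀ (b : Fin n → FreeAlgebra F (Fin n)) a,
      s (FreeAlgebra.lift F b a) = FreeAlgebra.lift F (s ∘ b) (s a))
    (s_zero : s 0 = 0) (q : FreeAlgebra F (Fin 2)) :
    ∃ p : FreeAlgebra F (Fin 2), ∀ a b,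
      s (FreeAlgebra.lift F ![a, b] q) = FreeAlgebra.lift F ![s a, s b] p := by
  obtain ⟨m, rfl⟩ := Nat.exists_eq_add_of_le' hn
  refine ⟨FreeAlgebra.lift F (Fin.cons (FreeAlgebra.ι F 0) (Fin.cons (FreeAlgebra.ι F 1) 0))
    (s (FreeAlgebra.lift F ![FreeAlgebra.ι F 0, FreeAlgebra.ι F 1] q)), fun a b => ?_⟩
  have h := hs (Fin.cons a (Fin.cons b 0))
    (FreeAlgebra.lift F ![FreeAlgebra.ι F 0, FreeAlgebra.ι F 1] q)
  rw [map_lift_pair] at h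
  simp only [FreeAlgebra.lift_ι_apply] at h
  change s (FreeAlgebra.lift F ![a, b] q) = _ at h
  rw [h, ← AlgHom.comp_apply]
  congr 1
  ext i
  refine Fin.cases ?_ (fun i => Fin.cases ?_ (fun i => ?_) i) i <;> simp [s_zero]

theorem map_add_and_map_mul_of_map_lift (hn : 2 ≤ n)
    {s : FreeAlgebra F (Fin n) ≃ FreeAlgebra F (Fin n)}
    (hs : ∀ (b : Fin n → FreeAlgebra F (Fin n)) a,
      s (FreeAlgebra.lift F b a) = FreeAlgebra.lift F (s ∘ b) (s a))
    (s_zero : s 0 = 0) (s_one : s 1 = 1) :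
    (∀ a b, s (a + b) = s a + s b) ∧
      ((∀ a b, s (a * b) = s a * s b) ∨ (∀ a b, s (a * b) = s b * s a)) := by
  obtain ⟨p, hp⟩ := exists_lift_pair_eq hn hs s_zero (FreeAlgebra.ι F 0 + FreeAlgebra.ι F 1)
  obtain ⟨q, hq⟩ := exists_lift_pair_eq hn hs s_zero (FreeAlgebra.ι F 0 * FreeAlgebra.ι F 1)
  simp only [map_add, map_mul, FreeAlgebra.lift_ι_apply, Matrix.cons_val_zero,
    Matrix.cons_val_one] at hp hq
  simp only [hp, hq]
  constructor
  · intro a b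
    apply lift_pair_eq_add_of_assoc hn p
    · refine s.surjective.forall₃.2 fun a b c => ?_
      simp only [← hp, add_assoc]
    · refine s.surjective.forall₂.2 fun a b => ?_
      simp only [← hp, add_comm]
    · refine s.surjective.forall.2 fun a => ?_
      rw [← s_zero, ← hp, add_zero]
  · refine (lift_pair_eq_mul_or_of_assoc hn q ?_ ?_ ?_ ?_).imp (fun h a b => h _ _)
      fun h a b => h _ _
    · refine s.surjective.forall₃.2 fun a b c => ?_
      simp only [← hq, mul_assoc]
    · refine s.surjective.forall.2 fun a => ?_
      rw [← s_zero, ← hq, mul_zero]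
    · refine s.surjective.forall.2 fun a => ?_
      rw [← s_zero, ← hq, zero_mul]
    · refine s.surjective.forall.2 fun a => ?_
      rw [← s_one, ← hq, mul_one]

/-- A multiplicative additive bijection preserving substitution is semilinear. -/
lemma exists_ringEquiv_map_smul {s : FreeAlgebra F (Fin n) ≃ FreeAlgebra F (Fin n)}
    (hs : ∀ (b : Fin n → FreeAlgebra F (Fin n)) a,
      s (FreeAlgebra.lift F b a) = FreeAlgebra.lift F (s ∘ b) (s a))
    (s_zero : s 0 = 0) (s_one : s 1 = 1) (hadd : ∀ a b, s (a + b) = s a + s b)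
    (hmul : ∀ a b, s (a * b) = s a * s b) :
    ∃ φ : F ≃+* F, ∀ (α : F) (a : FreeAlgebra F (Fin n)), s (α • a) = φ α • s a := by
  have hcomp : s ∘ (0 : Fin n → FreeAlgebra F (Fin n)) = 0 := by
    ext1 i; exact s_zero
  have lift_zero : ∀ a : FreeAlgebra F (Fin n),
      FreeAlgebra.lift F (0 : Fin n → FreeAlgebra F (Fin n)) a =
        algebraMap F _ (FreeAlgebra.algebraMapInv a) := by
    intro a
    have : FreeAlgebra.lift F (0 : Fin n → FreeAlgebra F (Fin n)) =
        (Algebra.ofId F _).comp FreeAlgebra.algebraMapInv := by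
      ext i; simp [FreeAlgebra.algebraMapInv]
    exact DFunLike.congr_fun this a
  have hinj := (FreeAlgebra.algebraMap_leftInverse (R := F) (X := Fin n)).injective
  have hφ : ∀ α : F, algebraMap F _ (FreeAlgebra.algebraMapInv (s (algebraMap F _ α))) =
      s (algebraMap F _ α) := by
    intro α
    have h := hs 0 (algebraMap F _ α)
    rw [AlgHom.commutes, hcomp, lift_zero] at h
    exact h.symm
  refine ⟨RingEquiv.ofBijective (RingHom.mk' ⟨⟨fun α => FreeAlgebra.algebraMapInv
    (s (algebraMap F _ α)), ?_⟩, ?_⟩ ?_) ⟨?_, ?_⟩, ?_⟩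
  · apply hinj
    rw [hφ, map_one (algebraMap F (FreeAlgebra F (Fin n))), s_one]
  · intro α β
    apply hinj
    rw [hφ, map_mul, hmul, map_mul, hφ, hφ]
  · intro α β
    apply hinj
    change algebraMap F _ (FreeAlgebra.algebraMapInv (s (algebraMap F _ (α + β)))) =
      algebraMap F _ (FreeAlgebra.algebraMapInv (s (algebraMap F _ α)) +
        FreeAlgebra.algebraMapInv (s (algebraMap F _ β)))
    rw [hφ, map_add, hadd, map_add, hφ, hφ]
  · intro α β h
    have h' := congrArg (algebraMap F (FreeAlgebra F (Fin n))) h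
    change algebraMap F _ (FreeAlgebra.algebraMapInv (s (algebraMap F _ α))) =
      algebraMap F _ (FreeAlgebra.algebraMapInv (s (algebraMap F _ β))) at h'
    rw [hφ, hφ] at h'
    exact hinj (s.injective h')
  · intro β
    obtain ⟨a, ha⟩ := s.surjective (algebraMap F _ β)
    have h := hs 0 a
    rw [hcomp, ha, AlgHom.commutes, lift_zero] at h
    refine ⟨FreeAlgebra.algebraMapInv a, hinj ?_⟩
    exact (hφ _).trans h
  · intro α a
    change s (α • a) = (FreeAlgebra.algebraMapInv (s (algebraMap F _ α)) : F) • s a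
    rw [Algebra.smul_def, hmul, Algebra.smul_def, hφ]

end SubstitutionBijection

section Adjoint

variable {F : Type*} [Field F] {n : ℕ}

/-- An adjoint bijection can be normalised to fix `0` and `1`. -/
lemma exists_isAdjoint_map_zero_map_one
    {Φ : MulAut (FreeAlgebra F (Fin n) →ₐ[F] FreeAlgebra F (Fin n))}
    (hΦ : IsQuasiInner F n Φ) :
    ∃ s : FreeAlgebra F (Fin n) ≃ FreeAlgebra F (Fin n),
      IsAdjoint F n Φ s ∧ s 0 = 0 ∧ s 1 = 1 := by
  obtain ⟨s, hs⟩ := hΦ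
  have hconst : ∀ a, (∀ ν : FreeAlgebra F (Fin n) →ₐ[F] FreeAlgebra F (Fin n), ν a = a) →
      ∃ c, s a = algebraMap F _ c := by
    intro a ha
    let ε : FreeAlgebra F (Fin n) →ₐ[F] FreeAlgebra F (Fin n) :=
      (Algebra.ofId F _).comp FreeAlgebra.algebraMapInv
    refine ⟨FreeAlgebra.algebraMapInv (s a), ?_⟩
    have h := hs (Φ.symm ε) (s a)
    rw [MulEquiv.apply_symm_apply, s.symm_apply_apply, ha] at h
    exact h.symm
  obtain ⟨c, hc⟩ := hconst 0 fun ν => map_zero ν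
  obtain ⟨d, hd⟩ := hconst 1 fun ν => map_one ν
  have hdc : d - c ≠ 0 := by
    intro h
    rw [sub_eq_zero.1 h, ← hc] at hd
    exact one_ne_zero (s.injective hd)
  refine ⟨s.trans ((Equiv.subRight (algebraMap F _ c)).trans
    (MulAction.toPerm (Units.mk0 (d - c) hdc)⁻¹)), fun ν a => ?_, ?_, ?_⟩
  · have key := hs ν ((d - c) • a + algebraMap F _ c)
    simp only [map_add, map_smul, AlgHom.commutes] at key
    simp only [Equiv.trans_apply, Equiv.symm_trans_apply, Equiv.subRight_apply,
      Equiv.subRight_symm_apply, MulAction.toPerm_apply, MulAction.toPerm_symm_apply, inv_inv,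
      Units.smul_mk0]
    rw [← key]
    simp [Units.smul_def, smul_smul, hdc]
  · simp [hc]
  · simp only [Equiv.trans_apply, hd, Equiv.subRight_apply, ← map_sub, MulAction.toPerm_apply,
      Units.smul_def, Units.val_inv_eq_inv_val, Units.val_mk0, Algebra.smul_def, ← map_mul]
    rw [inv_mul_cancel₀ hdc, map_one]

/-- The images of the generators under an adjoint bijection are again free generators. -/
lemma exists_algEquiv_ι_eq
    {Φ : MulAut (FreeAlgebra F (Fin n) →ₐ[F] FreeAlgebra F (Fin n))}
    {s : FreeAlgebra F (Fin n) ≃ FreeAlgebra F (Fin n)} (hs : IsAdjoint F n Φ s) :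
    ∃ τ : FreeAlgebra F (Fin n) ≃ₐ[F] FreeAlgebra F (Fin n),
      ∀ i, τ (FreeAlgebra.ι F i) = s (FreeAlgebra.ι F i) := by
  let y : Fin n → FreeAlgebra F (Fin n) := fun i => s (FreeAlgebra.ι F i)
  have hs' : ∀ ν i, Φ ν (y i) = s (ν (FreeAlgebra.ι F i)) := fun ν i => by
    rw [hs, s.symm_apply_apply]
  have huniq : ∀ ν ν' : FreeAlgebra F (Fin n) →ₐ[F] FreeAlgebra F (Fin n),
      (∀ i, ν (y i) = ν' (y i)) → ν = ν' := by
    intro ν ν' h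
    obtain ⟨ν, rfl⟩ := Φ.surjective ν
    obtain ⟨ν', rfl⟩ := Φ.surjective ν'
    congr 1
    ext i
    have h := h i
    rw [hs', hs'] at h
    exact s.injective h
  let σ := FreeAlgebra.lift F y
  let μ := Φ (FreeAlgebra.lift F fun i => s.symm (FreeAlgebra.ι F i))
  have hμ : ∀ i, μ (y i) = FreeAlgebra.ι F i := fun i => by
    simp [μ, hs']
  have hσ : ∀ i, σ (FreeAlgebra.ι F i) = y i := fun i => by simp [σ]
  refine ⟨AlgEquiv.ofAlgHom σ μ (huniq _ _ fun i => ?_) ?_, hσ⟩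
  · simp [hμ, hσ]
  · ext i
    simp [hμ, hσ]

lemma symm_comp_map_lift
    {Φ : MulAut (FreeAlgebra F (Fin n) →ₐ[F] FreeAlgebra F (Fin n))}
    {s : FreeAlgebra F (Fin n) ≃ FreeAlgebra F (Fin n)} (hs : IsAdjoint F n Φ s)
    {τ : FreeAlgebra F (Fin n) ≃ₐ[F] FreeAlgebra F (Fin n)}
    (hτ : ∀ i, τ (FreeAlgebra.ι F i) = s (FreeAlgebra.ι F i))
    (b : Fin n → FreeAlgebra F (Fin n)) (a : FreeAlgebra F (Fin n)) :
    τ.symm (s (FreeAlgebra.lift F b a)) =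
      FreeAlgebra.lift F (fun i => τ.symm (s (b i))) (τ.symm (s a)) := by
  have h : (τ.symm.toAlgHom.comp (Φ (FreeAlgebra.lift F b))).comp τ.toAlgHom =
      FreeAlgebra.lift F (fun i => τ.symm (s (b i))) := by
    ext i
    simp [hτ, hs _ _]
  rw [← h]
  simp [hs _ _]

end Adjoint

theorem quasiInner_semiInner_or_mirror (hn : 2 ≤ n)
    (Φ : MulAut (FreeAlgebra K (Fin n) →ₐ[K] FreeAlgebra K (Fin n)))
    (hΦ : IsQuasiInner K n Φ) :
    IsSemiInner K n Φ ∨ IsMirror K n Φ ∨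
      ∃ Φ₁ Φ₂ : MulAut (FreeAlgebra K (Fin n) →ₐ[K] FreeAlgebra K (Fin n)),
        IsSemiInner K n Φ₁ ∧ IsMirror K n Φ₂ ∧
          ∀ ν : FreeAlgebra K (Fin n) →ₐ[K] FreeAlgebra K (Fin n), Φ ν = Φ₁ (Φ₂ ν) := by
  obtain ⟨s, hs, s_zero, s_one⟩ := exists_isAdjoint_map_zero_map_one hΦ
  obtain ⟨τ, hτ⟩ := exists_algEquiv_ι_eq hs
  have ht : ∀ (b : Fin n → FreeAlgebra K (Fin n)) a,
      (s.trans τ.symm.toEquiv) (FreeAlgebra.lift K b a) =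
        FreeAlgebra.lift K (s.trans τ.symm.toEquiv ∘ b) ((s.trans τ.symm.toEquiv) a) :=
    symm_comp_map_lift hs hτ
  have t_zero : (s.trans τ.symm.toEquiv) 0 = 0 := by simp [s_zero]
  have t_one : (s.trans τ.symm.toEquiv) 1 = 1 := by simp [s_one]
  have hst : ∀ a, s a = τ ((s.trans τ.symm.toEquiv) a) := fun a => by simp
  obtain ⟨hadd, hmul⟩ := map_add_and_map_mul_of_map_lift hn ht t_zero t_one
  have s_add : ∀ a b, s (a + b) = s a + s b := fun a b => by
    rw [hst, hadd, map_add, ← hst, ← hst]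
  rcases hmul with hmul | hmul
  · refine Or.inl ⟨s, hs, s_add, fun a b => by rw [hst, hmul, map_mul, ← hst, ← hst], ?_⟩
    obtain ⟨φ, hφ⟩ := exists_ringEquiv_map_smul ht t_zero t_one hadd hmul
    exact ⟨φ, fun α a => by rw [hst, hφ, map_smul, ← hst]⟩
  · exact Or.inr (Or.inl ⟨s, hs, s_add, fun a b => by rw [hst, hmul, map_mul, ← hst, ← hst]⟩)

end Stmt2
end

section
/- Let Φ ∈ Aut End A. The images Φ(e_ij) of the standard endomorphisms e_ij (in the base X) are the standard endomorphisms in some base U = (u₁,…,uₙ) of A if and only if Φ is a quasi-inner automorphism of End A. -/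
/-!
Statement 3: Let `Φ ∈ Aut End A` for `A = K⟨x₁,…,xₙ⟩` (`n ≥ 2`). The images
`Φ(e_ij)` of the standard endomorphisms `e_ij` (in the base `X`) are the standard
endomorphisms in some base `U = (u₁,…,uₙ)` of `A` if and only if `Φ` is quasi-inner.
-/

namespace Stmt3

variable (K : Type*) [Field K] (n : ℕ)

/-- `u` is a base of `A`: the endomorphism determined by `xᵢ ↦ uᵢ` is an
automorphism of `A`. -/
def IsBase (u : Fin n → FreeAlgebra K (Fin n)) : Prop :=
  Function.Bijective (FreeAlgebra.lift K u)

/-- The standard endomorphisms in the base `X`: `e_ij (x_k) = δ_jk x_i`. -/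
noncomputable def stdEndo (i j : Fin n) : FreeAlgebra K (Fin n) →ₐ[K] FreeAlgebra K (Fin n) :=
  FreeAlgebra.lift K (fun k => if j = k then FreeAlgebra.ι K i else 0)

/-- `Φ` is quasi-inner: there is a bijection `s : A → A` such that
`Φ ν = s ∘ ν ∘ s⁻¹` as set maps, for every endomorphism `ν`. -/
def IsQuasiInner (Φ : MulAut (FreeAlgebra K (Fin n) →ₐ[K] FreeAlgebra K (Fin n))) : Prop :=
  ∃ s : FreeAlgebra K (Fin n) ≃ FreeAlgebra K (Fin n),
    ∀ (ν : FreeAlgebra K (Fin n) →ₐ[K] FreeAlgebra K (Fin n)) (a : FreeAlgebra K (Fin n)),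
      Φ ν a = s (ν (s.symm a))

variable {K n} in
/-- A family is a base as soon as every choice of images extends uniquely to an endomorphism. -/
theorem isBase_of_extension {u : Fin n → FreeAlgebra K (Fin n)}
    (hext : ∀ b : Fin n → FreeAlgebra K (Fin n),
      ∃ μ : FreeAlgebra K (Fin n) →ₐ[K] FreeAlgebra K (Fin n), ∀ i, μ (u i) = b i)
    (huniq : ∀ μ μ' : FreeAlgebra K (Fin n) →ₐ[K] FreeAlgebra K (Fin n),
      (∀ i, μ (u i) = μ' (u i)) → μ = μ') :
    IsBase K n u := by
  obtain ⟨τ, hτ⟩ := hext (FreeAlgebra.ι K)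
  have h₁ : τ.comp (FreeAlgebra.lift K u) = AlgHom.id K _ := by
    ext i
    simp [hτ]
  have h₂ : (FreeAlgebra.lift K u).comp τ = AlgHom.id K _ :=
    huniq _ _ fun i => by simp [hτ]
  exact Function.bijective_iff_has_inverse.2
    ⟨τ, fun a => DFunLike.congr_fun h₁ a, fun a => DFunLike.congr_fun h₂ a⟩

variable {K n} in
theorem IsBase.exists_extension {u : Fin n → FreeAlgebra K (Fin n)} (hu : IsBase K n u)
    (b : Fin n → FreeAlgebra K (Fin n)) :
    ∃ μ : FreeAlgebra K (Fin n) →ₐ[K] FreeAlgebra K (Fin n), ∀ i, μ (u i) = b i := by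
  let σ := AlgEquiv.ofBijective (FreeAlgebra.lift K u) hu
  refine ⟨(FreeAlgebra.lift K b).comp σ.symm.toAlgHom, fun i => ?_⟩
  have h : σ.symm (u i) = FreeAlgebra.ι K i := by
    rw [AlgEquiv.symm_apply_eq]
    exact (FreeAlgebra.lift_ι_apply u i).symm
  simp [h]

variable {K n} in
theorem IsBase.algHom_ext {u : Fin n → FreeAlgebra K (Fin n)} (hu : IsBase K n u)
    {μ μ' : FreeAlgebra K (Fin n) →ₐ[K] FreeAlgebra K (Fin n)}
    (h : ∀ i, μ (u i) = μ' (u i)) : μ = μ' := by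
  have hc : μ.comp (FreeAlgebra.lift K u) = μ'.comp (FreeAlgebra.lift K u) := by
    ext i
    simpa using h i
  ext1
  funext i
  obtain ⟨a, ha⟩ := hu.2 (FreeAlgebra.ι K i)
  simpa [ha] using DFunLike.congr_fun hc a

variable {K n} in
theorem isQuasiInner_of_image_of_standard
    {Φ : MulAut (FreeAlgebra K (Fin n) →ₐ[K] FreeAlgebra K (Fin n))}
    {u : Fin n → FreeAlgebra K (Fin n)} (hu : IsBase K n u) (j : Fin n)
    (he : ∀ k, Φ (stdEndo K n j j) (u k) = if j = k then u j else 0) :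
    IsQuasiInner K n Φ := by
  let η : FreeAlgebra K (Fin n) → (FreeAlgebra K (Fin n) →ₐ[K] FreeAlgebra K (Fin n)) :=
    fun a => FreeAlgebra.lift K fun k => if j = k then a else 0
  have η_self (a) : η a (FreeAlgebra.ι K j) = a := by simp [η]
  have eq_η (ν : FreeAlgebra K (Fin n) →ₐ[K] FreeAlgebra K (Fin n))
      (h : ν * stdEndo K n j j = ν) : ν = η (ν (FreeAlgebra.ι K j)) := by
    ext k
    have hk := DFunLike.congr_fun h (FreeAlgebra.ι K k)
    by_cases hjk : j = k
    · subst hjk; simp [η]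
    · simpa [η, stdEndo, hjk] using hk.symm
  have η_mul (a) : η a * stdEndo K n j j = η a := by
    ext k
    by_cases hjk : j = k <;> simp [η, stdEndo, hjk]
  have mul_η (ν : FreeAlgebra K (Fin n) →ₐ[K] FreeAlgebra K (Fin n)) (a) :
      ν * η a = η (ν a) := by
    ext k
    by_cases hjk : j = k <;> simp [η, hjk]
  have Φη_of_ne (a k) (hjk : j ≠ k) : Φ (η a) (u k) = 0 := by
    rw [← η_mul, map_mul, AlgHom.mul_apply, he, if_neg hjk, map_zero]
  have hs : Function.Bijective fun a => Φ (η a) (u j) := by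
    refine ⟨fun a b hab => ?_, fun b => ?_⟩
    · have h : Φ (η a) = Φ (η b) := hu.algHom_ext fun k => by
        by_cases hjk : j = k
        · subst hjk; exact hab
        · rw [Φη_of_ne _ _ hjk, Φη_of_ne _ _ hjk]
      rw [← η_self a, ← η_self b, Φ.injective h]
    · obtain ⟨μ, hμ⟩ := hu.exists_extension fun k => if j = k then b else 0
      obtain ⟨ν, rfl⟩ := Φ.surjective μ
      have h : ν * stdEndo K n j j = ν := Φ.injective <| hu.algHom_ext fun k => by
        rw [map_mul, AlgHom.mul_apply, he, hμ]
        by_cases hjk : j = k <;> simp [hjk, hμ]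
      refine ⟨ν (FreeAlgebra.ι K j), ?_⟩
      simp only
      rw [← eq_η ν h, hμ, if_pos rfl]
  refine ⟨Equiv.ofBijective _ hs, fun ν a => ?_⟩
  obtain ⟨a, rfl⟩ := (Equiv.ofBijective _ hs).surjective a
  rw [Equiv.symm_apply_apply]
  simp only [Equiv.ofBijective_apply]
  rw [← mul_η, map_mul, AlgHom.mul_apply]

variable {K n} in
theorem IsQuasiInner.exists_isBase
    {Φ : MulAut (FreeAlgebra K (Fin n) →ₐ[K] FreeAlgebra K (Fin n))}
    (hΦ : IsQuasiInner K n Φ) :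
    ∃ u : Fin n → FreeAlgebra K (Fin n), IsBase K n u ∧
      ∀ i j k : Fin n, Φ (stdEndo K n i j) (u k) = if j = k then u i else 0 := by
  obtain ⟨s, hs⟩ := hΦ
  have hs' (ν : FreeAlgebra K (Fin n) →ₐ[K] FreeAlgebra K (Fin n)) (a) :
      Φ ν (s a - s 0) = s (ν a) - s 0 := by
    rw [map_sub, hs, hs, Equiv.symm_apply_apply, Equiv.symm_apply_apply, map_zero]
  refine ⟨fun i => s (FreeAlgebra.ι K i) - s 0, isBase_of_extension (fun b => ?_) ?_,
    fun i j k => ?_⟩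
  · refine ⟨Φ (FreeAlgebra.lift K fun i => s.symm (b i + s 0)), fun i => ?_⟩
    simp [hs']
  · intro μ μ' h
    obtain ⟨ν, rfl⟩ := Φ.surjective μ
    obtain ⟨ν', rfl⟩ := Φ.surjective μ'
    congr 1
    ext i
    simpa [hs'] using h i
  · by_cases hjk : j = k <;> simp [hs', stdEndo, hjk]

theorem image_of_standard_iff_quasiInner (hn : 2 ≤ n)
    (Φ : MulAut (FreeAlgebra K (Fin n) →ₐ[K] FreeAlgebra K (Fin n))) :
    (∃ u : Fin n → FreeAlgebra K (Fin n), IsBase K n u ∧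
        ∀ i j k : Fin n, Φ (stdEndo K n i j) (u k) = if j = k then u i else 0) ↔
      IsQuasiInner K n Φ := by
  constructor
  · rintro ⟨u, hu, he⟩
    exact isQuasiInner_of_image_of_standard hu ⟨0, by omega⟩ (he _ _)
  · exact IsQuasiInner.exists_isBase

end Stmt3
end

section
/- An endomorphism φ of A has rank 1 (i.e., its image is a commutative subalgebra of A) if and only if there exists a non-zero endomorphism ψ ∈ End A such that φ ∘ h ∘ ψ = 0 for every h ∈ End A, where 0 denotes the endomorphism sending every generator x_i to 0. -/
/-!
Statement 4: An endomorphism `φ` of `A = K⟨x₁,…,xₙ⟩` (`n ≥ 2`) has rank 1 (its image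
is a commutative subalgebra of `A`) if and only if there exists a non-zero
endomorphism `ψ` with `φ ∘ h ∘ ψ = 0` for every `h ∈ End A`, where `0` is the
endomorphism sending every generator to `0`.
-/

namespace Stmt4

variable (K : Type*) [Field K] (n : ℕ)

/-- The endomorphism of `A` sending every generator `xᵢ` to `0`. -/
noncomputable def zeroEndo : FreeAlgebra K (Fin n) →ₐ[K] FreeAlgebra K (Fin n) :=
  FreeAlgebra.lift K (fun _ => 0)

/-- `φ` has rank 1: its image is a commutative subalgebra of `A`. -/
def HasRankOne (φ : FreeAlgebra K (Fin n) →ₐ[K] FreeAlgebra K (Fin n)) : Prop :=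
  ∀ a b : FreeAlgebra K (Fin n), φ a * φ b = φ b * φ a

end Stmt4

/-- Formal power series over `K` in noncommuting variables `σ`, as functions on words. -/
def NCSeries (K σ : Type*) := List σ → K

namespace NCSeries

variable {K σ : Type*}

@[ext] theorem ext {f g : NCSeries K σ} (h : ∀ w, f w = g w) : f = g := funext h

/-- The left derivative of a series along a letter. -/
def deriv (x : σ) (f : NCSeries K σ) : NCSeries K σ := fun w => f (x :: w)

@[simp] theorem deriv_apply (x : σ) (f : NCSeries K σ) (w : List σ) :
    deriv x f w = f (x :: w) := rfl

variable [Field K]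

noncomputable instance : AddCommGroup (NCSeries K σ) := inferInstanceAs (AddCommGroup (List σ → K))

noncomputable instance : Module K (NCSeries K σ) := inferInstanceAs (Module K (List σ → K))

@[simp] theorem zero_apply (w : List σ) : (0 : NCSeries K σ) w = 0 := rfl

@[simp] theorem add_apply (f g : NCSeries K σ) (w : List σ) : (f + g) w = f w + g w := rfl

@[simp] theorem neg_apply (f : NCSeries K σ) (w : List σ) : (-f) w = -f w := rfl

@[simp] theorem sub_apply (f g : NCSeries K σ) (w : List σ) : (f - g) w = f w - g w := rfl

@[simp] theorem smul_apply (c : K) (f : NCSeries K σ) (w : List σ) : (c • f) w = c * f w := rfl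

@[simp] theorem sum_apply {ι : Type*} (s : Finset ι) (f : ι → NCSeries K σ) (w : List σ) :
    (∑ i ∈ s, f i) w = ∑ i ∈ s, f i w :=
  Finset.sum_apply (M := fun _ : List σ => K) w s f

/-- The coefficient of a word in the Cauchy product of two series. -/
def mulCoeff : List σ → NCSeries K σ → NCSeries K σ → K
  | [], f, g => f [] * g []
  | x :: w, f, g => f [] * g (x :: w) + mulCoeff w (deriv x f) g

/-- The series `1`. -/
def oneCoeff : List σ → K
  | [] => 1
  | _ :: _ => 0

instance : Mul (NCSeries K σ) := ⟨fun f g w => mulCoeff w f g⟩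

instance : One (NCSeries K σ) := ⟨oneCoeff⟩

@[simp] theorem one_nil : (1 : NCSeries K σ) [] = 1 := rfl

@[simp] theorem one_cons (x : σ) (w : List σ) : (1 : NCSeries K σ) (x :: w) = 0 := rfl

@[simp] theorem mul_nil (f g : NCSeries K σ) : (f * g) [] = f [] * g [] := rfl

theorem mul_cons (f g : NCSeries K σ) (x : σ) (w : List σ) :
    (f * g) (x :: w) = f [] * g (x :: w) + (deriv x f * g) w := rfl

theorem deriv_add (x : σ) (f g : NCSeries K σ) : deriv x (f + g) = deriv x f + deriv x g := rfl

theorem deriv_smul (x : σ) (c : K) (f : NCSeries K σ) : deriv x (c • f) = c • deriv x f := rfl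

theorem deriv_zero (x : σ) : deriv x (0 : NCSeries K σ) = 0 := rfl

theorem deriv_one (x : σ) : deriv x (1 : NCSeries K σ) = 0 := rfl

theorem deriv_mul (x : σ) (f g : NCSeries K σ) :
    deriv x (f * g) = f [] • deriv x g + deriv x f * g := rfl

private theorem add_mul' (f g h : NCSeries K σ) : (f + g) * h = f * h + g * h := by
  ext w
  induction w generalizing f g with
  | nil => simp [add_mul]
  | cons x w ih => simp only [mul_cons, deriv_add, add_apply, ih]; ring

private theorem mul_add' (f g h : NCSeries K σ) : f * (g + h) = f * g + f * h := by
  ext w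
  induction w generalizing f with
  | nil => simp [mul_add]
  | cons x w ih => simp only [mul_cons, add_apply, ih]; ring

private theorem smul_mul' (c : K) (f g : NCSeries K σ) : (c • f) * g = c • (f * g) := by
  ext w
  induction w generalizing f with
  | nil => simp [mul_assoc]
  | cons x w ih => simp only [mul_cons, deriv_smul, smul_apply, ih]; ring

private theorem mul_smul' (c : K) (f g : NCSeries K σ) : f * (c • g) = c • (f * g) := by
  ext w
  induction w generalizing f with
  | nil => simp [mul_left_comm]
  | cons x w ih => simp only [mul_cons, smul_apply, ih]; ring

private theorem zero_mul' (f : NCSeries K σ) : 0 * f = 0 := by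
  simpa using smul_mul' 0 0 f

private theorem mul_zero' (f : NCSeries K σ) : f * 0 = 0 := by
  simpa using mul_smul' 0 f 0

private theorem mul_assoc' (f g h : NCSeries K σ) : f * g * h = f * (g * h) := by
  ext w
  induction w generalizing f g with
  | nil => simp [mul_assoc]
  | cons x w ih =>
    simp only [mul_cons, deriv_mul, add_mul', smul_mul', add_apply, smul_apply, ih, mul_nil]
    ring

private theorem one_mul' (f : NCSeries K σ) : 1 * f = f := by
  ext w
  cases w with
  | nil => simp
  | cons x w => simp [mul_cons, deriv_one, zero_mul']

private theorem mul_one' (f : NCSeries K σ) : f * 1 = f := by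
  ext w
  induction w generalizing f with
  | nil => simp
  | cons x w ih => simp [mul_cons, ih]

noncomputable instance : Ring (NCSeries K σ) where
  __ := (inferInstance : AddCommGroup (NCSeries K σ))
  left_distrib := mul_add'
  right_distrib := add_mul'
  zero_mul := zero_mul'
  mul_zero := mul_zero'
  mul_assoc := mul_assoc'
  one_mul := one_mul'
  mul_one := mul_one'

noncomputable instance : Algebra K (NCSeries K σ) := Algebra.ofModule smul_mul' mul_smul'

@[simp] theorem algebraMap_nil (c : K) : algebraMap K (NCSeries K σ) c [] = c := by
  simp [Algebra.algebraMap_eq_smul_one]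

theorem exists_ne_zero {f : NCSeries K σ} (hf : f ≠ 0) : ∃ w, f w ≠ 0 := by
  by_contra! h
  exact hf (ext h)

theorem exists_shorter_of_mul_apply_ne_zero {f g : NCSeries K σ} (hg : g [] = 0) {w : List σ}
    (h : (f * g) w ≠ 0) : ∃ u : List σ, u.length < w.length ∧ f u ≠ 0 := by
  induction w generalizing f with
  | nil => simp [hg] at h
  | cons x w ih =>
    by_cases hf : f [] = 0
    · rw [mul_cons, hf, zero_mul, zero_add] at h
      obtain ⟨u, hu, hfu⟩ := ih h
      exact ⟨x :: u, by simpa using hu, hfu⟩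
    · exact ⟨[], by simp, hf⟩

theorem pow_apply_eq_zero {f : NCSeries K σ} (hf : f [] = 0) {k : ℕ} {w : List σ}
    (hw : w.length < k) : (f ^ k) w = 0 := by
  induction k generalizing w with
  | zero => simp at hw
  | succ k ih =>
    by_contra h
    rw [pow_succ] at h
    obtain ⟨u, hu, hne⟩ := exists_shorter_of_mul_apply_ne_zero hf h
    exact hne (ih (by omega))

theorem mul_apply_congr {f g h : NCSeries K σ} {w : List σ}
    (hfg : ∀ v : List σ, v.length ≤ w.length → f v = g v) : (f * h) w = (g * h) w := by
  induction w generalizing f g with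
  | nil => simp [hfg [] (by simp)]
  | cons x w ih =>
    rw [mul_cons, mul_cons, hfg [] (by simp),
      ih (f := deriv x f) (g := deriv x g) fun v hv => hfg (x :: v) (by simpa using hv)]

theorem exists_mul_one_sub_eq_one {f : NCSeries K σ} (hf : f [] = 0) :
    ∃ g : NCSeries K σ, g * (1 - f) = 1 := by
  obtain ⟨g, hg⟩ : ∃ g : NCSeries K σ,
      ∀ w, g w = (∑ k ∈ Finset.range (w.length + 1), f ^ k) w := ⟨_, fun _ => rfl⟩
  refine ⟨g, ?_⟩
  ext w
  rw [mul_apply_congr (g := ∑ k ∈ Finset.range (w.length + 1), f ^ k), geom_sum_mul_neg,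
    sub_apply, pow_apply_eq_zero hf (Nat.lt_succ_self _), sub_zero]
  intro v hv
  rw [hg]
  simp only [sum_apply]
  refine Finset.sum_subset (by simpa using hv) fun k _ hk => pow_apply_eq_zero hf ?_
  simp only [Finset.mem_range] at hk
  omega

theorem exists_left_inv {f : NCSeries K σ} (hf : f [] ≠ 0) : ∃ g : NCSeries K σ, g * f = 1 := by
  obtain ⟨g, hg⟩ := exists_mul_one_sub_eq_one (f := 1 - (f [])⁻¹ • f) (by simp [hf])
  refine ⟨(f [])⁻¹ • g, ?_⟩
  simpa using hg

theorem eq_left_mul_or_of_mul_eq_mul {a b F G : NCSeries K σ} (hF : F ≠ 0) (h : F * a = G * b) :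
    (∃ q, a = q * b) ∨ ∃ q, b = q * a := by
  obtain ⟨w, hw⟩ := exists_ne_zero hF
  clear hF
  induction w generalizing F G with
  | nil =>
    obtain ⟨g, hg⟩ := exists_left_inv hw
    exact .inl ⟨g * G, by rw [mul_assoc, ← h, ← mul_assoc, hg, one_mul]⟩
  | cons x w ih =>
    by_cases hF : F [] = 0
    · by_cases hG : G [] = 0
      · refine ih (F := deriv x F) (G := deriv x G) ?_ hw
        simpa [deriv_mul, hF, hG] using congrArg (deriv x) h
      · obtain ⟨g, hg⟩ := exists_left_inv hG
        exact .inr ⟨g * F, by rw [mul_assoc, h, ← mul_assoc, hg, one_mul]⟩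
    · obtain ⟨g, hg⟩ := exists_left_inv hF
      exact .inl ⟨g * G, by rw [mul_assoc, ← h, ← mul_assoc, hg, one_mul]⟩

theorem eq_zero_of_mul_eq_zero {f g : NCSeries K σ} (hg : g ≠ 0) (h : f * g = 0) : f = 0 := by
  by_contra hf
  obtain ⟨w, hw⟩ := exists_ne_zero hf
  clear hf
  induction w generalizing f with
  | nil =>
    obtain ⟨u, hu⟩ := exists_left_inv hw
    exact hg (by rw [← one_mul g, ← hu, mul_assoc, h, mul_zero])
  | cons x w ih =>
    by_cases hf : f [] = 0
    · refine ih (f := deriv x f) ?_ hw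
      simpa [deriv_mul, deriv_zero, hf] using congrArg (deriv x) h
    · obtain ⟨u, hu⟩ := exists_left_inv hf
      exact hg (by rw [← one_mul g, ← hu, mul_assoc, h, mul_zero])

/-- `a` and `b` are left linearly independent over the subalgebra they generate. -/
def AdjoinIndep (a b : NCSeries K σ) : Prop :=
  ∀ F ∈ Algebra.adjoin K {a, b}, ∀ G ∈ Algebra.adjoin K {a, b},
    F * a + G * b = 0 → F = 0 ∧ G = 0

theorem AdjoinIndep.symm {a b : NCSeries K σ} (h : AdjoinIndep a b) : AdjoinIndep b a := by
  intro F hF G hG e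
  rw [Set.pair_comm] at hF hG
  exact (h G hG F hF (by rw [add_comm, e])).symm

theorem exists_eq_of_mem_adjoin {a b f : NCSeries K σ} (hf : f ∈ Algebra.adjoin K {a, b}) :
    ∃ s : K, ∃ F ∈ Algebra.adjoin K {a, b}, ∃ G ∈ Algebra.adjoin K {a, b},
      f = algebraMap K _ s + F * a + G * b := by
  induction hf using Algebra.adjoin_induction with
  | mem x hx =>
    rcases hx with rfl | rfl
    · exact ⟨0, 1, one_mem _, 0, zero_mem _, by simp⟩
    · exact ⟨0, 0, zero_mem _, 1, one_mem _, by simp⟩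
  | algebraMap r => exact ⟨r, 0, zero_mem _, 0, zero_mem _, by simp⟩
  | add x y _ _ hx hy =>
    obtain ⟨s, F, hF, G, hG, rfl⟩ := hx
    obtain ⟨s', F', hF', G', hG', rfl⟩ := hy
    exact ⟨s + s', F + F', add_mem hF hF', G + G', add_mem hG hG', by
      rw [map_add]; noncomm_ring⟩
  | mul x y hxm _ hx hy =>
    obtain ⟨s, F, hF, G, hG, e⟩ := hx
    obtain ⟨s', F', hF', G', hG', rfl⟩ := hy
    refine ⟨s' * s, s' • F + x * F', add_mem (Subalgebra.smul_mem _ hF _) (mul_mem hxm hF'),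
      s' • G + x * G', add_mem (Subalgebra.smul_mem _ hG _) (mul_mem hxm hG'), ?_⟩
    have h : x * algebraMap K _ s' =
        algebraMap K _ (s' * s) + s' • F * a + s' • G * b := by
      rw [← Algebra.commutes, ← Algebra.smul_def, e, smul_add, smul_add, map_mul, ← Algebra.smul_def,
        smul_mul_assoc, smul_mul_assoc]
    rw [mul_add, mul_add, h]
    noncomm_ring

theorem AdjoinIndep.of_eq_mul {a b q : NCSeries K σ} (hb : b ≠ 0) (hb0 : b [] = 0) (ha : a = q * b)
    (h : AdjoinIndep (q - algebraMap K _ (q [])) b) : AdjoinIndep a b := by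
  set q' := q - algebraMap K _ (q []) with hq'
  have hq : q = q' + algebraMap K _ (q []) := by simp [hq']
  have hq'm : q' ∈ Algebra.adjoin K {q', b} := Algebra.subset_adjoin (by simp)
  have hbm : b ∈ Algebra.adjoin K {q', b} := Algebra.subset_adjoin (by simp)
  have hqm : q ∈ Algebra.adjoin K {q', b} := by
    rw [hq]; exact add_mem hq'm (Subalgebra.algebraMap_mem _ _)
  have hle : Algebra.adjoin K {a, b} ≤ Algebra.adjoin K {q', b} := by
    refine Algebra.adjoin_le ?_
    rintro x (rfl | rfl)
    · rw [ha]; exact mul_mem hqm hbm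
    · exact hbm
  intro F hF G hG e
  have e1 : F * q' + (q [] • F + G) = 0 := by
    refine eq_zero_of_mul_eq_zero hb ?_
    rw [← e, ha, hq', Algebra.smul_def, Algebra.commutes]
    noncomm_ring
  obtain ⟨s, S, hS, T, hT, e2⟩ := exists_eq_of_mem_adjoin
    (add_mem (Subalgebra.smul_mem _ hF (q [])) hG)
  have hs : s = 0 := by
    have := congrFun e1 []
    rw [e2] at this
    simpa [hq', ha, hb0] using this
  have e3 : F * q' + (S * q + T) * b = 0 := by
    rw [← e1, e2, hs, ha, map_zero, zero_add, add_mul, mul_assoc]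
  have hF0 : F = 0 :=
    (h F (hle hF) _ (add_mem (mul_mem (hle hS) hqm) (hle hT)) e3).1
  refine ⟨hF0, eq_zero_of_mul_eq_zero hb ?_⟩
  simpa [hF0] using e

theorem adjoinIndep_of_commutator_ne_zero {a b : NCSeries K σ} (ha : a [] = 0) (hb : b [] = 0)
    (hab : a * b - b * a ≠ 0) : AdjoinIndep a b := by
  obtain ⟨w, hw⟩ := exists_ne_zero hab
  clear hab
  induction hN : w.length using Nat.strong_induction_on generalizing a b w with
  | _ N ih =>
  have key : ∀ {a b q : NCSeries K σ}, b [] = 0 → (a * b - b * a) w ≠ 0 → a = q * b →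
      AdjoinIndep a b := by
    intro a b q hb hw hq
    have e : a * b - b * a = ((q - algebraMap K _ (q [])) * b
        - b * (q - algebraMap K _ (q []))) * b := by
      rw [hq, sub_mul, mul_sub, ← Algebra.commutes (q []) b]
      noncomm_ring
    rw [e] at hw
    obtain ⟨u, hu, hne⟩ := exists_shorter_of_mul_apply_ne_zero hb hw
    refine AdjoinIndep.of_eq_mul ?_ hb hq (ih _ (hN ▸ hu) (by simp) hb u hne rfl)
    rintro rfl
    simp at hw
  intro F hF G hG h
  by_cases hF0 : F = 0
  · refine ⟨hF0, eq_zero_of_mul_eq_zero (g := b) ?_ (by simpa [hF0] using h)⟩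
    rintro rfl
    simp at hw
  · have h' : F * a = (-G) * b := by rw [neg_mul]; exact eq_neg_of_add_eq_zero_left h
    rcases eq_left_mul_or_of_mul_eq_mul hF0 h' with ⟨q, hq⟩ | ⟨q, hq⟩
    · exact key hb hw hq F hF G hG h
    · refine (key ha ?_ hq).symm F hF G hG h
      rw [← neg_sub, neg_apply]
      exact neg_ne_zero.2 hw

theorem AdjoinIndep.eq_zero_of_sum_mul_pow {a b : NCSeries K σ} (h : AdjoinIndep a b) {n : ℕ}
    (F : Fin n → NCSeries K σ) (hF : ∀ i, F i ∈ Algebra.adjoin K {a, b})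
    (e : ∑ i, F i * (b * a ^ (i : ℕ)) = 0) (i : Fin n) : F i = 0 := by
  induction n with
  | zero => exact i.elim0
  | succ n ih =>
    have ham : a ∈ Algebra.adjoin K {a, b} := Algebra.subset_adjoin (by simp)
    have hbm : b ∈ Algebra.adjoin K {a, b} := Algebra.subset_adjoin (by simp)
    have e' : (∑ i : Fin n, F i.succ * (b * a ^ (i : ℕ))) * a + F 0 * b = 0 := by
      rw [← e, Fin.sum_univ_succ, Finset.sum_mul, add_comm]
      simp [pow_succ, mul_assoc]
    obtain ⟨h1, h2⟩ := h _ (sum_mem fun i _ => mul_mem (hF i.succ)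
      (mul_mem hbm (pow_mem ham _))) _ (hF 0) e'
    exact Fin.cases h2 (ih _ (fun i => hF i.succ) h1) i

/-- The series of a single letter. -/
noncomputable def X [DecidableEq σ] (x : σ) : NCSeries K σ := fun w => if w = [x] then 1 else 0

theorem mul_X_apply_append [DecidableEq σ] (f : NCSeries K σ) (x y : σ) (w : List σ) :
    (f * X x : NCSeries K σ) (w ++ [y]) = if y = x then f w else 0 := by
  induction w generalizing f with
  | nil => simp [mul_cons, X]
  | cons z w ih => simp [mul_cons, ih, X]

end NCSeries

section FreeAlgebra

variable {K σ : Type*} [Field K]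

/-- The embedding of the free algebra into the noncommutative power series. -/
noncomputable def FreeAlgebra.toNCSeries [DecidableEq σ] : FreeAlgebra K σ →ₐ[K] NCSeries K σ :=
  FreeAlgebra.lift K NCSeries.X

theorem FreeAlgebra.ι_mul_ι_ne [DecidableEq σ] {i j : σ} (h : i ≠ j) :
    FreeAlgebra.ι K i * FreeAlgebra.ι K j ≠ FreeAlgebra.ι K j * FreeAlgebra.ι K i := by
  intro e
  have := congrFun (congrArg FreeAlgebra.toNCSeries e) ([i] ++ [j])
  simp only [FreeAlgebra.toNCSeries, map_mul, FreeAlgebra.lift_ι_apply,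
    NCSeries.mul_X_apply_append] at this
  simp [NCSeries.X, h.symm] at this

variable [Fintype σ]

/-- The elements of a free algebra that are obtained from `0` by iterating the formation of
`s + ∑ i, q i * ι i`. -/
inductive IsHorner : FreeAlgebra K σ → Prop
  | zero : IsHorner 0
  | node (s : K) (q : σ → FreeAlgebra K σ) (hq : ∀ i, IsHorner (q i)) :
      IsHorner (algebraMap K _ s + ∑ i, q i * FreeAlgebra.ι K i)

theorem IsHorner.add {p r : FreeAlgebra K σ} (hp : IsHorner p) (hr : IsHorner r) :
    IsHorner (p + r) := by
  induction hp generalizing r with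
  | zero => simpa using hr
  | node s q hq ih =>
    cases hr with
    | zero => simpa using IsHorner.node s q hq
    | node s' q' hq' =>
      convert IsHorner.node (s + s') (fun i => q i + q' i) (fun i => ih i (hq' i)) using 1
      simp only [map_add, add_mul, Finset.sum_add_distrib]
      abel

theorem IsHorner.algebraMap_mul {p : FreeAlgebra K σ} (hp : IsHorner p) (c : K) :
    IsHorner (algebraMap K _ c * p) := by
  induction hp with
  | zero => simpa using IsHorner.zero
  | node s q hq ih =>
    convert IsHorner.node (c * s) _ ih using 1
    simp only [map_mul, mul_add, Finset.mul_sum, mul_assoc]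

theorem IsHorner.mul {p r : FreeAlgebra K σ} (hp : IsHorner p) (hr : IsHorner r) :
    IsHorner (p * r) := by
  induction hr with
  | zero => simpa using IsHorner.zero
  | node s q hq ih =>
    convert (hp.algebraMap_mul s).add (IsHorner.node 0 _ ih) using 1
    simp only [map_zero, zero_add, mul_add, Finset.mul_sum, mul_assoc, Algebra.commutes]

theorem isHorner_algebraMap (c : K) : IsHorner (algebraMap K (FreeAlgebra K σ) c) := by
  simpa using IsHorner.node c (fun _ : σ => 0) fun _ => IsHorner.zero

theorem isHorner (p : FreeAlgebra K σ) : IsHorner p := by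
  classical
  induction p using FreeAlgebra.induction with
  | grade0 c => exact isHorner_algebraMap c
  | grade1 x =>
    convert IsHorner.node 0 (Pi.single x (1 : FreeAlgebra K σ)) fun i => ?_ using 1
    · simp [Pi.single_apply]
    · by_cases h : i = x
      · subst h
        simpa using isHorner_algebraMap (σ := σ) (1 : K)
      · simpa [h] using IsHorner.zero
  | mul p r hp hr => exact hp.mul hr
  | add p r hp hr => exact hp.add hr

theorem FreeAlgebra.eq_zero_of_lift_eq_zero {τ : Type*} {a : σ → NCSeries K τ}
    (ha : ∀ i, a i [] = 0)
    (hindep : ∀ q : σ → FreeAlgebra K σ,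
      ∑ i, FreeAlgebra.lift K a (q i) * a i = 0 → ∀ i, FreeAlgebra.lift K a (q i) = 0)
    {p : FreeAlgebra K σ} (hp : FreeAlgebra.lift K a p = 0) : p = 0 := by
  induction isHorner p with
  | zero => rfl
  | node s q hq ih =>
    simp only [map_add, map_sum, map_mul, AlgHom.commutes, FreeAlgebra.lift_ι_apply] at hp
    have hs : s = 0 := by simpa [ha] using congrFun hp []
    have h0 := hindep q (by simpa [hs] using hp)
    simp [hs, fun i => ih i (h0 i)]

theorem FreeAlgebra.toNCSeries_injective [DecidableEq σ] :
    Function.Injective (FreeAlgebra.toNCSeries : FreeAlgebra K σ →ₐ[K] NCSeries K σ) := by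
  refine (injective_iff_map_eq_zero _).2 fun p hp =>
    FreeAlgebra.eq_zero_of_lift_eq_zero (fun i => ?_) (fun q hq i => ?_) hp
  · simp [NCSeries.X]
  · ext w
    simpa [NCSeries.mul_X_apply_append] using congrFun hq (w ++ [i])

/-- If a homomorphism `φ` to a free algebra has noncommutative image, then some homomorphism `h`
from a free algebra of any finite rank makes `φ ∘ h` injective. -/
theorem FreeAlgebra.exists_comp_injective [DecidableEq σ] {n : ℕ} {B : Type*} [Ring B] [Algebra K B]
    (φ : B →ₐ[K] FreeAlgebra K σ) {u v : B} (huv : φ u * φ v ≠ φ v * φ u) :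
    ∃ h : FreeAlgebra K (Fin n) →ₐ[K] B, Function.Injective (φ.comp h) := by
  set θ : B →ₐ[K] NCSeries K σ := FreeAlgebra.toNCSeries.comp φ with hθ
  set x : B := u - algebraMap K B (θ u []) with hx
  set y : B := v - algebraMap K B (θ v []) with hy
  have hx0 : θ x [] = 0 := by simp [hx]
  have hy0 : θ y [] = 0 := by simp [hy]
  have hxy : θ x * θ y - θ y * θ x ≠ 0 := by
    have e : x * y - y * x = u * v - v * u := by
      simp only [hx, hy, sub_mul, mul_sub]
      rw [Algebra.commutes (θ u []) v, Algebra.commutes (θ v []) u,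
        Algebra.commutes (θ u []) (algebraMap K B (θ v []))]
      abel
    rw [← map_mul, ← map_mul, ← map_sub, e, map_sub, map_mul, map_mul, sub_ne_zero]
    simp only [hθ, AlgHom.comp_apply, ← map_mul]
    exact fun e => huv (by simpa using FreeAlgebra.toNCSeries_injective e)
  have hind := NCSeries.adjoinIndep_of_commutator_ne_zero hx0 hy0 hxy
  set h : FreeAlgebra K (Fin n) →ₐ[K] B := FreeAlgebra.lift K fun i => y * x ^ (i : ℕ) with hh
  have hlift : θ.comp h = FreeAlgebra.lift K fun i : Fin n => θ y * θ x ^ (i : ℕ) := by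
    ext i
    simp [hh]
  refine ⟨h, (injective_iff_map_eq_zero _).2 fun p hp => ?_⟩
  have hp' : θ.comp h p = 0 := by
    have := congrArg FreeAlgebra.toNCSeries hp
    simpa [hθ] using this
  rw [hlift] at hp'
  refine FreeAlgebra.eq_zero_of_lift_eq_zero (fun i => by simp [hy0]) (fun q hq => ?_) hp'
  refine hind.eq_zero_of_sum_mul_pow _ (fun i => ?_) hq
  induction q i using FreeAlgebra.induction with
  | grade0 c => rw [AlgHom.commutes]; exact Subalgebra.algebraMap_mem _ _
  | grade1 j =>
    rw [FreeAlgebra.lift_ι_apply]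
    exact mul_mem (Algebra.subset_adjoin (by simp)) (pow_mem (Algebra.subset_adjoin (by simp)) _)
  | mul _ _ hp hr => rw [map_mul]; exact mul_mem hp hr
  | add _ _ hp hr => rw [map_add]; exact add_mem hp hr

end FreeAlgebra

namespace Stmt4

variable (K : Type*) [Field K] (n : ℕ)

theorem rankOne_iff (hn : 2 ≤ n) (φ : FreeAlgebra K (Fin n) →ₐ[K] FreeAlgebra K (Fin n)) :
    HasRankOne K n φ ↔
      ∃ ψ : FreeAlgebra K (Fin n) →ₐ[K] FreeAlgebra K (Fin n),
        (∃ i : Fin n, ψ (FreeAlgebra.ι K i) ≠ 0) ∧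
        ∀ h : FreeAlgebra K (Fin n) →ₐ[K] FreeAlgebra K (Fin n),
          φ.comp (h.comp ψ) = zeroEndo K n := by
  constructor
  · intro hφ
    have h01 : (⟨0, by omega⟩ : Fin n) ≠ ⟨1, by omega⟩ := by simp
    refine ⟨FreeAlgebra.lift K fun _ => FreeAlgebra.ι K ⟨0, by omega⟩ * FreeAlgebra.ι K ⟨1, by omega⟩
      - FreeAlgebra.ι K ⟨1, by omega⟩ * FreeAlgebra.ι K ⟨0, by omega⟩, ⟨⟨0, by omega⟩, ?_⟩, ?_⟩
    · rw [FreeAlgebra.lift_ι_apply, sub_ne_zero]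
      exact FreeAlgebra.ι_mul_ι_ne h01
    · intro h
      ext i
      simp [zeroEndo, hφ (h (FreeAlgebra.ι K ⟨0, by omega⟩))]
  · rintro ⟨ψ, ⟨i, hi⟩, hψ⟩ u v
    by_contra huv
    obtain ⟨h, hinj⟩ := FreeAlgebra.exists_comp_injective (n := n) φ huv
    refine hi (hinj ?_)
    simpa [zeroEndo] using DFunLike.congr_fun (hψ h) (FreeAlgebra.ι K i)

end Stmt4
end

section
/- If Φ is an automorphism of the monoid End A and φ ∈ End A has rank 1, then Φ(φ) has rank 1. -/
/-!
Statement 5: If `Φ` is an automorphism of the monoid `End A` for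
`A = K⟨x₁,…,xₙ⟩` (`n ≥ 2`) and `φ ∈ End A` has rank 1, then `Φ(φ)` has rank 1.
-/

namespace Stmt5

variable (K : Type*) [Field K] (n : ℕ)

/-- `φ` has rank 1: its image is a commutative subalgebra of `A`. -/
def HasRankOne (φ : FreeAlgebra K (Fin n) →ₐ[K] FreeAlgebra K (Fin n)) : Prop :=
  ∀ a b : FreeAlgebra K (Fin n), φ a * φ b = φ b * φ a

section

open Polynomial
open scoped IsMulCommutative

variable {K n}

/-- An element killed by every homomorphism to `K[X]` is killed by every homomorphism under which
the images of the generators commute. -/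
theorem map_eq_zero_of_commuting {B : Type*} [Ring B] [Algebra K B] {a : FreeAlgebra K (Fin n)}
    (ha : ∀ τ : FreeAlgebra K (Fin n) →ₐ[K] K[X], τ a = 0)
    (ρ : FreeAlgebra K (Fin n) →ₐ[K] B)
    (hρ : ∀ i j, ρ (FreeAlgebra.ι K i) * ρ (FreeAlgebra.ι K j) =
      ρ (FreeAlgebra.ι K j) * ρ (FreeAlgebra.ι K i)) : ρ a = 0 := by
  let π : FreeAlgebra K (Fin n) →ₐ[K] MvPolynomial (Fin n) K := FreeAlgebra.lift K MvPolynomial.X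
  have hπ : π a = 0 := by
    apply MvPolynomial.map_injective (C : K →+* K[X]) C_injective
    rw [map_zero]
    apply MvPolynomial.funext
    intro q
    rw [MvPolynomial.eval_map, map_zero]
    exact ha ((MvPolynomial.aeval q).comp π)
  let s : Set B := Set.range fun i => ρ (FreeAlgebra.ι K i)
  have hs : ∀ x ∈ s, ∀ y ∈ s, x * y = y * x := by
    rintro _ ⟨i, rfl⟩ _ ⟨j, rfl⟩
    exact hρ i j
  have := Algebra.isMulCommutative_adjoin K hs
  let σ : MvPolynomial (Fin n) K →ₐ[K] Algebra.adjoin K s :=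
    MvPolynomial.aeval fun i => ⟨ρ (FreeAlgebra.ι K i), Algebra.subset_adjoin ⟨i, rfl⟩⟩
  have hσ : ((Algebra.adjoin K s).val.comp σ).comp π = ρ := by
    ext i
    simp [π, σ]
  rw [← hσ, AlgHom.comp_apply, hπ, map_zero]

/-- If all homomorphisms to `K[X]` send `a` to constants, then they send it to the same one. -/
theorem exists_forall_map_eq_C {a : FreeAlgebra K (Fin n)}
    (ha : ∀ τ : FreeAlgebra K (Fin n) →ₐ[K] K[X], ∃ c, τ a = C c) :
    ∃ c, ∀ τ : FreeAlgebra K (Fin n) →ₐ[K] K[X], τ a = C c := by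
  refine ⟨FreeAlgebra.lift K (0 : Fin n → K) a, fun τ => ?_⟩
  obtain ⟨c, hc⟩ := ha τ
  let q : Fin n → K := fun i => aeval (0 : K) (τ (FreeAlgebra.ι K i))
  let l : FreeAlgebra K (Fin n) →ₐ[K] K[X] := FreeAlgebra.lift K fun i => C (q i) * X
  obtain ⟨d, hd⟩ := ha l
  have h₁ : (aeval (0 : K)).comp τ = (aeval (1 : K)).comp l := by
    ext i
    simp [l, q]
  have h₀ : (aeval (0 : K)).comp l = FreeAlgebra.lift K (0 : Fin n → K) := by
    ext i
    simp [l]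
  have e₁ := DFunLike.congr_fun h₁ a
  have e₀ := DFunLike.congr_fun h₀ a
  simp only [AlgHom.comp_apply, hc, hd, aeval_C, Algebra.algebraMap_self, RingHom.id_apply]
    at e₁ e₀
  rw [hc, ← e₀, e₁]

/-- The homomorphism multiplying each generator by a central variable. -/
noncomputable def grading : FreeAlgebra K (Fin n) →ₐ[K] (FreeAlgebra K (Fin n))[X] :=
  FreeAlgebra.lift K fun i => C (FreeAlgebra.ι K i) * X

theorem grading_injective :
    Function.Injective (grading : FreeAlgebra K (Fin n) →ₐ[K] (FreeAlgebra K (Fin n))[X]) := by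
  let e : (FreeAlgebra K (Fin n))[X] →ₐ[K] FreeAlgebra K (Fin n) :=
    eval₂AlgHom (AlgHom.id K _) 1 fun a => Commute.one_right a
  have he : e.comp grading = AlgHom.id K (FreeAlgebra K (Fin n)) := by
    ext i
    have heval : ∀ p, e p = p.eval 1 := fun _ => rfl
    simp [heval, grading]
  exact Function.LeftInverse.injective (DFunLike.congr_fun he)

theorem mem_span_X_pow {R : Type*} [Ring R] {k : ℕ} {p : R[X]} :
    p ∈ Ideal.span {(X : R[X]) ^ k} ↔ X ^ k ∣ p := by
  rw [Ideal.mem_span_singleton']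
  exact ⟨fun ⟨a, h⟩ => ⟨a, by rw [← h, X_pow_mul]⟩, fun ⟨a, h⟩ => ⟨a, by rw [h, X_pow_mul]⟩⟩

theorem isTwoSided_span_X_pow {R : Type*} [Ring R] (k : ℕ) :
    (Ideal.span {(X : R[X]) ^ k}).IsTwoSided where
  mul_mem_of_left b h := by
    rw [mem_span_X_pow] at h ⊢
    exact h.mul_right b

/-- If `ρ` sends commutators of generators into the ideal `(X ^ k)`, then it sends there every
element killed by all homomorphisms to `K[X]`. -/
theorem X_pow_dvd_of_commutators {a : FreeAlgebra K (Fin n)}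
    (ha : ∀ τ : FreeAlgebra K (Fin n) →ₐ[K] K[X], τ a = 0) {R : Type*} [Ring R] [Algebra K R]
    (ρ : FreeAlgebra K (Fin n) →ₐ[K] R[X]) (k : ℕ)
    (hρ : ∀ i j, X ^ k ∣ ρ (FreeAlgebra.ι K i) * ρ (FreeAlgebra.ι K j) -
      ρ (FreeAlgebra.ι K j) * ρ (FreeAlgebra.ι K i)) : X ^ k ∣ ρ a := by
  have := isTwoSided_span_X_pow (R := R) k
  have h := map_eq_zero_of_commuting ha
    ((Ideal.Quotient.mkₐ K (Ideal.span {(X : R[X]) ^ k})).comp ρ) fun i j => by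
      rw [← map_mul, ← map_mul]
      refine Ideal.Quotient.eq.2 (mem_span_X_pow.2 ?_)
      simpa only [AlgHom.coe_toRingHom, map_mul] using hρ i j
  exact mem_span_X_pow.1 (Ideal.Quotient.eq_zero_iff_mem.1 h)

/-- An idempotent endomorphism that is constant modulo commutators is constant. -/
theorem idempotent_eq_const {f : FreeAlgebra K (Fin n) →ₐ[K] FreeAlgebra K (Fin n)}
    (hf : ∀ a, f (f a) = f a) {κ : Fin n → K}
    (hκ : ∀ i, ∀ τ : FreeAlgebra K (Fin n) →ₐ[K] K[X], τ (f (FreeAlgebra.ι K i)) = C (κ i))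
    (i : Fin n) : f (FreeAlgebra.ι K i) = algebraMap K _ (κ i) := by
  let u : Fin n → FreeAlgebra K (Fin n) := fun i => f (FreeAlgebra.ι K i) - algebraMap K _ (κ i)
  have hu : ∀ i, ∀ τ : FreeAlgebra K (Fin n) →ₐ[K] K[X], τ (u i) = 0 := by
    intro i τ
    simp only [u, map_sub, hκ, AlgHom.commutes]
    exact sub_self _
  have hfu : ∀ i, f (u i) = u i := fun i => by simp [u, hf]
  have hdvd : ∀ k i, X ^ (k + 1) ∣ grading (u i) := by
    intro k
    induction k with
    | zero =>
      intro i
      refine X_pow_dvd_of_commutators (hu i) grading _ fun i j => ?_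
      simp only [grading, FreeAlgebra.lift_ι_apply, zero_add, pow_one, ← mul_assoc]
      exact dvd_sub ⟨_, (X_mul ..).symm⟩ ⟨_, (X_mul ..).symm⟩
    | succ k ih =>
      intro i
      rw [← hfu i]
      refine X_pow_dvd_of_commutators (hu i) (grading.comp f) _ fun i j => ?_
      have hsub : ∀ i, f (FreeAlgebra.ι K i) = u i + algebraMap K _ (κ i) := fun i => by simp [u]
      have hcomm : grading.comp f (FreeAlgebra.ι K i) * grading.comp f (FreeAlgebra.ι K j) -
          grading.comp f (FreeAlgebra.ι K j) * grading.comp f (FreeAlgebra.ι K i) =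
          grading (u i) * grading (u j) - grading (u j) * grading (u i) := by
        simp only [AlgHom.comp_apply, hsub, map_add, AlgHom.commutes, mul_add, add_mul]
        rw [Algebra.commutes (κ i) (grading (u j)), Algebra.commutes (κ j) (grading (u i)),
          Algebra.commutes (κ i) (algebraMap K _ (κ j))]
        abel
      rw [hcomm]
      have hmul : ∀ i j, X ^ (k + 1 + 1) ∣ grading (u i) * grading (u j) := by
        intro i j
        obtain ⟨p, hp⟩ := ih i
        obtain ⟨q, hq⟩ := ih j
        refine ⟨X ^ k * (p * q), ?_⟩
        rw [hp, hq, mul_assoc, ← mul_assoc p (X ^ (k + 1)), ← X_pow_mul]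
        simp only [← mul_assoc, ← pow_add]
        congr 3
        omega
      exact dvd_sub (hmul i j) (hmul j i)
  have hzero : grading (u i) = 0 := by
    ext1 d
    obtain ⟨p, hp⟩ := hdvd d i
    rw [hp, coeff_X_pow_mul', if_neg (by omega), coeff_zero]
  exact sub_eq_zero.1 (grading_injective (hzero.trans (map_zero _).symm))

/-- A nonzero element with zero augmentation is transcendental. -/
theorem aeval_injective_of_augmentation {c : FreeAlgebra K (Fin n)} (hc : c ≠ 0)
    {ε : FreeAlgebra K (Fin n) →ₐ[K] K} (hε : ε c = 0) :
    Function.Injective (aeval c : K[X] →ₐ[K] FreeAlgebra K (Fin n)) := by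
  rw [injective_iff_map_eq_zero]
  intro p hp
  by_contra h0
  obtain ⟨q, hq, hdvd⟩ := exists_eq_pow_rootMultiplicity_mul_and_not_dvd p h0 0
  rw [hq] at hp
  simp only [C_0, sub_zero, map_mul, map_pow, aeval_X] at hp hdvd
  have hq0 := (mul_eq_zero.1 hp).resolve_left (pow_ne_zero _ hc)
  apply hdvd
  rw [X_dvd_iff, coeff_zero_eq_aeval_zero, ← hε, aeval_algHom_apply, hq0, map_zero, hε]

variable (K n) in
/-- `θ` is constant: every endomorphism fixes its values. -/
def IsConst (θ : FreeAlgebra K (Fin n) →ₐ[K] FreeAlgebra K (Fin n)) : Prop :=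
  ∀ ψ : FreeAlgebra K (Fin n) →ₐ[K] FreeAlgebra K (Fin n), ψ * θ = θ

theorem isConst_iff {θ : FreeAlgebra K (Fin n) →ₐ[K] FreeAlgebra K (Fin n)} :
    IsConst K n θ ↔ ∀ a, ∃ c, θ a = algebraMap K _ c := by
  constructor
  · intro h a
    let ε : FreeAlgebra K (Fin n) →ₐ[K] K := FreeAlgebra.lift K (0 : Fin n → K)
    exact ⟨ε (θ a), (DFunLike.congr_fun (h ((Algebra.ofId K _).comp ε)) a).symm⟩
  · intro h ψ
    apply AlgHom.ext
    intro a
    obtain ⟨c, hc⟩ := h a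
    rw [AlgHom.mul_apply, hc, AlgHom.commutes]

theorem isConst_map_iff (Φ : MulAut (FreeAlgebra K (Fin n) →ₐ[K] FreeAlgebra K (Fin n)))
    {θ : FreeAlgebra K (Fin n) →ₐ[K] FreeAlgebra K (Fin n)} :
    IsConst K n (Φ θ) ↔ IsConst K n θ := by
  constructor
  · intro h ψ
    apply Φ.injective
    rw [map_mul, h]
  · intro h ψ
    obtain ⟨ψ, rfl⟩ := Φ.surjective ψ
    rw [← map_mul, h]

/-- An idempotent whose corner monoid has no nonconstant element with constant square has
commutative image. -/
theorem hasRankOne_of_corner {f : FreeAlgebra K (Fin n) →ₐ[K] FreeAlgebra K (Fin n)}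
    (hf : f * f = f)
    (hcorner : ∀ ψ, IsConst K n ((f * ψ * f) * (f * ψ * f)) → IsConst K n (f * ψ * f)) :
    HasRankOne K n f := by
  intro a b
  by_contra hab
  have hff : ∀ a, f (f a) = f a := DFunLike.congr_fun hf
  let c := f a * f b - f b * f a
  have hc : c ≠ 0 := sub_ne_zero.2 hab
  have hfc : f c = c := by simp [c, hff]
  have hτc : ∀ {B : Type _} [CommRing B] [Algebra K B] (τ : FreeAlgebra K (Fin n) →ₐ[K] B),
      τ c = 0 := by
    intro B _ _ τ
    simp only [c, map_sub, map_mul]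
    rw [mul_comm, sub_self]
  have hinj := aeval_injective_of_augmentation hc
    (hτc (FreeAlgebra.lift K (0 : Fin n → K)))
  have hconst : ∀ a, ∀ τ : FreeAlgebra K (Fin n) →ₐ[K] K[X], ∃ d, τ (f a) = C d := by
    intro a τ
    let ψ : FreeAlgebra K (Fin n) →ₐ[K] FreeAlgebra K (Fin n) := (aeval c).comp τ
    have hfψ : ∀ a, f (ψ a) = ψ a := by
      intro a
      simp only [ψ, AlgHom.comp_apply]
      rw [← aeval_algHom_apply, hfc]
    have hψ : ∀ a, ψ (ψ a) = algebraMap K _ ((τ a).coeff 0) := by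
      intro a
      simp only [ψ, AlgHom.comp_apply]
      rw [← aeval_algHom_apply, hτc, ← coeff_zero_eq_aeval_zero', AlgHom.commutes]
    have h := isConst_iff.1 (hcorner ψ (isConst_iff.2 fun a =>
      ⟨(τ (f a)).coeff 0, by simp only [AlgHom.mul_apply, hfψ, hψ, AlgHom.commutes]⟩)) a
    obtain ⟨d, hd⟩ := h
    refine ⟨d, hinj ?_⟩
    rw [aeval_C, ← hd, AlgHom.mul_apply, AlgHom.mul_apply, hfψ]
    rfl
  choose κ hκ using fun i => exists_forall_map_eq_C (hconst (FreeAlgebra.ι K i))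
  have hfκ : f = (Algebra.ofId K _).comp (FreeAlgebra.lift K κ) := by
    ext i
    simp [idempotent_eq_const hff hκ i, Algebra.ofId_apply]
  apply hab
  rw [hfκ]
  simp only [AlgHom.comp_apply, ← map_mul, mul_comm]

end

theorem rankOne_preserved (hn : 2 ≤ n)
    (Φ : MulAut (FreeAlgebra K (Fin n) →ₐ[K] FreeAlgebra K (Fin n)))
    (φ : FreeAlgebra K (Fin n) →ₐ[K] FreeAlgebra K (Fin n))
    (hφ : HasRankOne K n φ) : HasRankOne K n (Φ φ) := by
  let z : Fin n := ⟨0, by omega⟩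
  let i : Polynomial K →ₐ[K] FreeAlgebra K (Fin n) := Polynomial.aeval (FreeAlgebra.ι K z)
  let j : FreeAlgebra K (Fin n) →ₐ[K] Polynomial K := FreeAlgebra.lift K (Pi.single z Polynomial.X)
  have hji : ∀ p, j (i p) = p := by
    have : j.comp i = AlgHom.id K _ := by
      ext
      simp [i, j]
    exact DFunLike.congr_fun this
  let e : FreeAlgebra K (Fin n) →ₐ[K] FreeAlgebra K (Fin n) := i.comp j
  have hee : e * e = e := by
    apply AlgHom.ext
    intro a
    simp only [e, AlgHom.mul_apply, AlgHom.comp_apply, hji]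
  have hcorner : ∀ ψ, IsConst K n ((e * ψ * e) * (e * ψ * e)) → IsConst K n (e * ψ * e) := by
    intro ψ h
    let p : Polynomial K := j (ψ (i Polynomial.X))
    have hp : ∀ q, j (ψ (i q)) = q.comp p := by
      intro q
      have : (j.comp ψ).comp i = Polynomial.aeval p := by
        ext
        simp [p]
      exact DFunLike.congr_fun this q
    obtain ⟨d, hd⟩ := isConst_iff.1 h (i Polynomial.X)
    have hpp : p.comp p = Polynomial.C d := by
      have := congrArg j hd
      simpa only [e, AlgHom.mul_apply, AlgHom.comp_apply, hji, hp, Polynomial.X_comp,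
        AlgHom.commutes, Polynomial.algebraMap_eq] using this
    have hdeg : p.natDegree = 0 := by
      have := congrArg Polynomial.natDegree hpp
      rwa [Polynomial.natDegree_comp, Polynomial.natDegree_C, mul_self_eq_zero] at this
    obtain ⟨d, hd⟩ := Polynomial.natDegree_eq_zero.1 hdeg
    refine isConst_iff.2 fun a => ⟨(j a).eval d, ?_⟩
    simp only [e, AlgHom.mul_apply, AlgHom.comp_apply, hp, ← hd, Polynomial.comp_C]
    exact i.commutes _
  have hΦe : HasRankOne K n (Φ e) := by
    refine hasRankOne_of_corner (by rw [← map_mul, hee]) fun ψ => ?_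
    obtain ⟨ψ, rfl⟩ := Φ.surjective ψ
    simp only [← map_mul, isConst_map_iff]
    simpa only [mul_assoc] using hcorner ψ
  have hsep : ∀ α β : FreeAlgebra K (Fin n) →ₐ[K] FreeAlgebra K (Fin n),
      (∀ ψ, e * ψ * α = e * ψ * β) → φ * α = φ * β := by
    intro α β h
    apply AlgHom.ext
    intro a
    rw [AlgHom.mul_apply, AlgHom.mul_apply, ← sub_eq_zero, ← map_sub]
    refine map_eq_zero_of_commuting (fun τ => ?_) φ fun _ _ => hφ _ _
    have := congrArg j (DFunLike.congr_fun (h (i.comp τ)) a)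
    simp only [e, AlgHom.mul_apply, AlgHom.comp_apply, hji] at this
    rw [map_sub, this, sub_self]
  intro a b
  let α : FreeAlgebra K (Fin n) →ₐ[K] FreeAlgebra K (Fin n) := FreeAlgebra.lift K fun _ => a * b
  let β : FreeAlgebra K (Fin n) →ₐ[K] FreeAlgebra K (Fin n) := FreeAlgebra.lift K fun _ => b * a
  obtain ⟨α', hα⟩ := Φ.surjective α
  obtain ⟨β', hβ⟩ := Φ.surjective β
  have h : φ * α' = φ * β' := by
    refine hsep _ _ fun ψ => Φ.injective ?_
    simp only [map_mul, hα, hβ]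
    ext k
    simpa [α, β, AlgHom.mul_apply] using hΦe _ _
  have h' := congrArg Φ h
  rw [map_mul, map_mul, hα, hβ] at h'
  simpa [α, β, AlgHom.mul_apply] using DFunLike.congr_fun h' (FreeAlgebra.ι K z)

end Stmt5
end
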